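/- Let p > 2. There exists a constant C > 0 such that for every measurable g : 𝔻 → ℂ with ‖g‖_{Ľᵖ(𝔻)} < ∞, the function f = Tg satisfies: f is continuous on 𝔻̄; f possesses weak Wirtinger derivatives on 𝔻, i.e. there exist measurable functions u, v on 𝔻 with ∫_𝔻 f·(∂φ) dμ = −∫_𝔻 u·φ dμ and ∫_𝔻 f·(∂̄φ) dμ = −∫_𝔻 v·φ dμ for all φ ∈ C_c^∞(𝔻); one has v = g almost everywhere; and ∫_𝔻 (|f|ᵖ + |u|ᵖ) |z|⁻¹ dμ(z) ≤ Cᵖ · ‖g‖_{Ľᵖ(𝔻)}ᵖ. In particular, for every g with finite weighted norm the equation ∂̄f = g has a weak solution f with f and its full weak gradient of finite weighted Lᵖ norm. -/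

import Mathlib

open MeasureTheory Metric Set ENNReal NNReal

namespace CTW

/-! ### Part 1: the Hilbert transform on the line -/

noncomputable def P0 (q δ K : ℝ) (F : ℂ) : ℝ :=
  ((F.re ^ 2 + F.im ^ 2 + δ) ^ q - δ ^ q) - K * ((F.im ^ 2 + δ) ^ q - δ ^ q)

noncomputable def P1 (q δ K : ℝ) (F G : ℂ) : ℝ :=
  2 * q * (F.re ^ 2 + F.im ^ 2 + δ) ^ (q - 1) * (F.re * G.re + F.im * G.im)
    - K * (2 * q * (F.im ^ 2 + δ) ^ (q - 1) * (F.im * G.im))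

noncomputable def P2 (q δ K : ℝ) (F G H : ℂ) : ℝ :=
  2 * q * (2 * (q - 1) * (F.re ^ 2 + F.im ^ 2 + δ) ^ (q - 2) * (F.re * G.re + F.im * G.im) ^ 2
    + (F.re ^ 2 + F.im ^ 2 + δ) ^ (q - 1) *
      (G.re ^ 2 + G.im ^ 2 + F.re * H.re + F.im * H.im))
    - K * (2 * q * (2 * (q - 1) * (F.im ^ 2 + δ) ^ (q - 2) * (F.im * G.im) ^ 2
      + (F.im ^ 2 + δ) ^ (q - 1) * (G.im ^ 2 + F.im * H.im)))

lemma hasDerivAt_re {f : ℝ → ℂ} {f' : ℂ} {t : ℝ} (h : HasDerivAt f f' t) :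
    HasDerivAt (fun t => (f t).re) f'.re t :=
  Complex.reCLM.hasFDerivAt.comp_hasDerivAt t h

lemma hasDerivAt_im {f : ℝ → ℂ} {f' : ℂ} {t : ℝ} (h : HasDerivAt f f' t) :
    HasDerivAt (fun t => (f t).im) f'.im t :=
  Complex.imCLM.hasFDerivAt.comp_hasDerivAt t h

lemma hasDerivAt_P0 {q δ K : ℝ} (hδ : 0 < δ) {f : ℝ → ℂ} {f' : ℂ} {t : ℝ}
    (h : HasDerivAt f f' t) :
    HasDerivAt (fun t => P0 q δ K (f t)) (P1 q δ K (f t) f') t := by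
  have hr := hasDerivAt_re h
  have hi := hasDerivAt_im h
  have h1 : HasDerivAt (fun t => (f t).re ^ 2 + (f t).im ^ 2 + δ) _ t :=
    ((hr.pow 2).add (hi.pow 2)).add_const δ
  have h2 : HasDerivAt (fun t => (f t).im ^ 2 + δ) _ t := (hi.pow 2).add_const δ
  have p1 : (f t).re ^ 2 + (f t).im ^ 2 + δ ≠ 0 := by positivity
  have p2 : (f t).im ^ 2 + δ ≠ 0 := by positivity
  have h3 := ((h1.rpow_const (p := q) (Or.inl p1)).sub_const (δ ^ q)).sub
    (((h2.rpow_const (p := q) (Or.inl p2)).sub_const (δ ^ q)).const_mul K)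
  refine h3.congr_deriv ?_
  simp only [P1]
  push_cast
  ring

lemma hasDerivAt_P1 {q δ K : ℝ} (hδ : 0 < δ) {f g : ℝ → ℂ} {g' : ℂ} {t : ℝ}
    (h : HasDerivAt f (g t) t) (hg : HasDerivAt g g' t) :
    HasDerivAt (fun t => P1 q δ K (f t) (g t)) (P2 q δ K (f t) (g t) g') t := by
  have hr := hasDerivAt_re h
  have hi := hasDerivAt_im h
  have gr := hasDerivAt_re hg
  have gi := hasDerivAt_im hg
  have h1 : HasDerivAt (fun t => (f t).re ^ 2 + (f t).im ^ 2 + δ) _ t :=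
    ((hr.pow 2).add (hi.pow 2)).add_const δ
  have h2 : HasDerivAt (fun t => (f t).im ^ 2 + δ) _ t := (hi.pow 2).add_const δ
  have p1 : (f t).re ^ 2 + (f t).im ^ 2 + δ ≠ 0 := by positivity
  have p2 : (f t).im ^ 2 + δ ≠ 0 := by positivity
  have h3 := (((h1.rpow_const (p := q - 1) (Or.inl p1)).const_mul (2 * q)).mul
    ((hr.mul gr).add (hi.mul gi))).sub
    ((((h2.rpow_const (p := q - 1) (Or.inl p2)).const_mul (2 * q)).mul (hi.mul gi)).const_mul K)
  refine h3.congr_deriv ?_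
  simp only [P2, show q - 1 - 1 = q - 2 by ring]
  push_cast
  simp only [Pi.mul_apply, Pi.add_apply]
  ring

/-- subharmonicity -/
lemma P2_add_nonneg {q δ : ℝ} (hq : 1 < q) (hδ : 0 < δ) (F G H : ℂ) :
    0 ≤ P2 q δ (2 * q / (2 * q - 1)) F G H
      + P2 q δ (2 * q / (2 * q - 1)) F (Complex.I * G) (-H) := by
  set K := 2 * q / (2 * q - 1) with hK
  set s := F.re ^ 2 + F.im ^ 2 + δ with hs
  set t := F.im ^ 2 + δ with ht
  set E := G.re ^ 2 + G.im ^ 2 with hE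
  have hs0 : 0 < s := by positivity
  have ht0 : 0 < t := by positivity
  have hE0 : 0 ≤ E := by positivity
  have hts : t ≤ s := by rw [hs, ht]; nlinarith [sq_nonneg F.re]
  have hδt : δ ≤ t := by rw [ht]; nlinarith [sq_nonneg F.im]
  have e1 : s ^ (q - 1) = s ^ (q - 2) * s := by
    rw [show q - 1 = (q - 2) + 1 by ring, Real.rpow_add_one hs0.ne']
  have e2 : t ^ (q - 1) = t ^ (q - 2) * t := by
    rw [show q - 1 = (q - 2) + 1 by ring, Real.rpow_add_one ht0.ne']
  have key : P2 q δ K F G H + P2 q δ K F (Complex.I * G) (-H)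
      = 4 * q * E * (s ^ (q - 2) * (q * s - (q - 1) * δ)
        - K * (t ^ (q - 2) * ((q - 1 / 2) * t - (q - 1) * δ))) := by
    simp only [P2, ← hs, ← ht, e1, e2]
    simp only [Complex.mul_re, Complex.mul_im, Complex.I_re, Complex.I_im, Complex.neg_re,
      Complex.neg_im]
    have : F.im ^ 2 = t - δ := by rw [ht]; ring
    have h3 : F.re ^ 2 = s - t := by rw [hs, ht]; ring
    have h4 : G.im ^ 2 = E - G.re ^ 2 := by rw [hE]; ring
    linear_combination (4*q * (2 * (q-1) * s^(q-2) * 1/2 * (E)) - K * (4 * q * (q-1) * t^(q-2) * E)) * this + (4*q * (2 * (q-1) * s^(q-2) * 1/2 * (E))) * h3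
      + (4 * q * (s^(q-2) * s + (q-1) * s^(q-2) * (F.re^2+F.im^2)) - K * 2 * q * (t^(q-2) * t + 2 * (q-1) * t^(q-2) * F.im^2)) * h4
  rw [key]
  have hm : t ^ (q - 2) * (q * t - (q - 1) * δ) ≤ s ^ (q - 2) * (q * s - (q - 1) * δ) := by
    have a1 : t ^ (q - 2) * (q * t - (q - 1) * δ) = q * t ^ (q - 1) - (q - 1) * δ * t ^ (q - 2) := by
      rw [e2]; ring
    have a2 : s ^ (q - 2) * (q * s - (q - 1) * δ) = q * s ^ (q - 1) - (q - 1) * δ * s ^ (q - 2) := by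
      rw [e1]; ring
    have mono1 : t ^ (q - 1) ≤ s ^ (q - 1) := Real.rpow_le_rpow ht0.le hts (by linarith)
    rcases le_total q 2 with h | h
    · have mono2 : s ^ (q - 2) ≤ t ^ (q - 2) :=
        Real.rpow_le_rpow_of_nonpos ht0 hts (by linarith)
      rw [a1, a2]
      have : (q - 1) * δ * s ^ (q - 2) ≤ (q - 1) * δ * t ^ (q - 2) :=
        mul_le_mul_of_nonneg_left mono2 (mul_nonneg (by linarith) hδ.le)
      have : q * t ^ (q - 1) ≤ q * s ^ (q - 1) := mul_le_mul_of_nonneg_left mono1 (by linarith)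
      linarith
    · have mono2 : t ^ (q - 2) ≤ s ^ (q - 2) := Real.rpow_le_rpow ht0.le hts (by linarith)
      have : 0 ≤ q * t - (q - 1) * δ := by nlinarith
      have h5 : q * t - (q - 1) * δ ≤ q * s - (q - 1) * δ := by nlinarith
      exact mul_le_mul mono2 h5 this (Real.rpow_nonneg hs0.le _)
  have hK' : K * (t ^ (q - 2) * ((q - 1 / 2) * t - (q - 1) * δ))
      ≤ t ^ (q - 2) * (q * t - (q - 1) * δ) := by
    have hK1 : 1 ≤ K := by rw [hK, le_div_iff₀ (by linarith)]; linarith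
    have : K * (q - 1 / 2) = q := by rw [hK, div_mul_eq_mul_div, div_eq_iff (by linarith)]; ring
    have h6 : K * (t ^ (q - 2) * ((q - 1 / 2) * t - (q - 1) * δ))
      = t ^ (q - 2) * (q * t - K * ((q - 1) * δ)) := by
      linear_combination (t ^ (q - 2) * t) * this
    rw [h6]
    apply mul_le_mul_of_nonneg_left _ (Real.rpow_nonneg ht0.le _)
    have : 0 ≤ (q-1) * δ := mul_nonneg (by linarith) hδ.le
    nlinarith
  have : 0 ≤ 4 * q * E := by positivity
  apply mul_nonneg this
  linarith

lemma rpow_add_sub_le {q δ x m : ℝ} (hq : 1 ≤ q) (hδ : 0 ≤ δ) (hx : 0 ≤ x) (hm : x + δ ≤ m) :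
    |(x + δ) ^ q - δ ^ q| ≤ q * m ^ (q - 1) * x := by
  rw [abs_of_nonneg (sub_nonneg.2 (Real.rpow_le_rpow hδ (by linarith) (by linarith)))]
  rcases eq_or_lt_of_le (add_nonneg hx hδ) with h0 | h0
  · have : x = 0 := by linarith
    have h' : δ = 0 := by linarith
    rw [this, h']; simp
  have h := one_add_mul_self_le_rpow_one_add (s := (δ - (x + δ)) / (x + δ)) (p := q)
    (by rw [le_div_iff₀ h0]; linarith) hq
  have e : 1 + (δ - (x + δ)) / (x + δ) = δ / (x + δ) := by field_simp; ring
  rw [e, Real.div_rpow hδ h0.le] at h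
  have hp : 0 < (x + δ) ^ q := Real.rpow_pos_of_pos h0 _
  rw [le_div_iff₀ hp] at h
  have e2 : (x + δ) ^ q = (x + δ) ^ (q - 1) * (x + δ) := by
    rw [← Real.rpow_add_one h0.ne']; ring_nf
  have e3 : (1 + q * ((δ - (x + δ)) / (x + δ))) * (x + δ) ^ q
    = (x + δ) ^ q - q * (x + δ) ^ (q - 1) * x := by
    nth_rewrite 1 [e2]
    rw [e2]; field_simp; ring
  rw [e3] at h
  have : (x + δ) ^ (q - 1) ≤ m ^ (q - 1) := Real.rpow_le_rpow h0.le hm (by linarith)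
  have : q * (x + δ) ^ (q - 1) * x ≤ q * m ^ (q - 1) * x := by gcongr
  linarith

lemma sq_re_add (F : ℂ) : F.re ^ 2 + F.im ^ 2 = ‖F‖ ^ 2 := by
  rw [Complex.sq_norm, Complex.normSq_apply]; ring

lemma P0_bound {q m K : ℝ} (hq : 1 < q) (hm : 0 ≤ m) (hK : 0 ≤ K) :
    ∃ C, 0 ≤ C ∧ ∀ δ, 0 ≤ δ → δ ≤ 1 → ∀ F : ℂ, ‖F‖ ≤ m → |P0 q δ K F| ≤ C * ‖F‖ ^ 2 := by
  refine ⟨(1 + K) * (q * (m ^ 2 + 1) ^ (q - 1)), by positivity, fun δ h0 h1 F hF => ?_⟩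
  have hF2 : ‖F‖ ^ 2 ≤ m ^ 2 := by gcongr
  have hi : F.im ^ 2 ≤ ‖F‖ ^ 2 := by rw [← sq_re_add]; nlinarith [sq_nonneg F.re]
  have a := rpow_add_sub_le (q := q) (m := m ^ 2 + 1) hq.le h0 (x := ‖F‖ ^ 2) (by positivity)
    (by linarith)
  have b := rpow_add_sub_le (q := q) (m := m ^ 2 + 1) hq.le h0 (x := F.im ^ 2) (by positivity)
    (by linarith)
  unfold P0
  rw [sq_re_add]
  refine (abs_sub _ _).trans ?_
  rw [abs_mul, abs_of_nonneg hK]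
  have : q * (m ^ 2 + 1) ^ (q - 1) * F.im ^ 2 ≤ q * (m ^ 2 + 1) ^ (q - 1) * ‖F‖ ^ 2 := by gcongr
  nlinarith [mul_le_mul_of_nonneg_left (b.trans this) hK]

lemma rpow_between {δ s M r : ℝ} (hδ : 0 < δ) (h1 : δ ≤ s) (h2 : s ≤ M) :
    s ^ r ≤ δ ^ r + M ^ r := by
  rcases le_total 0 r with h | h
  · have := Real.rpow_le_rpow (by linarith) h2 h
    have := Real.rpow_nonneg hδ.le r
    linarith
  · have := Real.rpow_le_rpow_of_nonpos hδ h1 h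
    have := Real.rpow_nonneg (by linarith : 0 ≤ M) r
    linarith

set_option maxHeartbeats 1000000 in
/-- `P1`, `P2` quadratic bounds -/
lemma quad_bound_PP {q δ K m : ℝ} (hq : 1 < q) (hδ : 0 < δ) (hm : 0 ≤ m) (hK : 0 ≤ K) :
    ∃ C, 0 ≤ C ∧ ∀ b, 0 ≤ b → b ≤ m → ∀ F G H : ℂ, ‖F‖ ≤ b → ‖G‖ ≤ b → ‖H‖ ≤ b →
      |P1 q δ K F G| ≤ C * b ^ 2 ∧ |P2 q δ K F G H| ≤ C * b ^ 2 := by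
  set A := δ ^ (q - 1) + (m ^ 2 + m ^ 2 + δ) ^ (q - 1) with hA
  set B := δ ^ (q - 2) + (m ^ 2 + m ^ 2 + δ) ^ (q - 2) with hB
  have hA0 : 0 ≤ A := by positivity
  have hB0 : 0 ≤ B := by positivity
  refine ⟨2 * q * A * 2 + K * (2 * q * A) + (2 * q * (2 * (q - 1) * B * (4 * m ^ 2) + A * 4)
    + K * (2 * q * (2 * (q - 1) * B * (m ^ 2) + A * 2))), ?_, ?_⟩
  · have : 0 ≤ q - 1 := by linarith
    positivity
  intro b hb hbm F G H hF hG hH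
  have fr := (Complex.abs_re_le_norm F).trans hF
  have fi := (Complex.abs_im_le_norm F).trans hF
  have gr := (Complex.abs_re_le_norm G).trans hG
  have gi := (Complex.abs_im_le_norm G).trans hG
  have hr := (Complex.abs_re_le_norm H).trans hH
  have hi := (Complex.abs_im_le_norm H).trans hH
  have hb2 : b ^ 2 ≤ m ^ 2 := by gcongr
  have fr2 : F.re ^ 2 ≤ b ^ 2 := sq_le_sq' (abs_le.1 fr).1 (abs_le.1 fr).2
  have fi2 : F.im ^ 2 ≤ b ^ 2 := sq_le_sq' (abs_le.1 fi).1 (abs_le.1 fi).2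
  have gr2 : G.re ^ 2 ≤ b ^ 2 := sq_le_sq' (abs_le.1 gr).1 (abs_le.1 gr).2
  have gi2 : G.im ^ 2 ≤ b ^ 2 := sq_le_sq' (abs_le.1 gi).1 (abs_le.1 gi).2
  have s1 : (F.re ^ 2 + F.im ^ 2 + δ) ^ (q - 1) ≤ A :=
    rpow_between hδ (by linarith [sq_nonneg F.re, sq_nonneg F.im]) (by linarith)
  have s2 : (F.re ^ 2 + F.im ^ 2 + δ) ^ (q - 2) ≤ B :=
    rpow_between hδ (by linarith [sq_nonneg F.re, sq_nonneg F.im]) (by linarith)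
  have t1 : (F.im ^ 2 + δ) ^ (q - 1) ≤ A :=
    rpow_between hδ (by linarith [sq_nonneg F.re, sq_nonneg F.im]) (by linarith [sq_nonneg m])
  have t2 : (F.im ^ 2 + δ) ^ (q - 2) ≤ B :=
    rpow_between hδ (by linarith [sq_nonneg F.re, sq_nonneg F.im]) (by linarith [sq_nonneg m])
  have prod : ∀ x y : ℝ, |x| ≤ b → |y| ≤ b → |x * y| ≤ b ^ 2 := fun x y hx hy => by
    rw [abs_mul, sq]; exact mul_le_mul hx hy (abs_nonneg _) hb
  have d1 : |F.re * G.re + F.im * G.im| ≤ 2 * b ^ 2 :=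
    (abs_add_le _ _).trans (by linarith [prod _ _ fr gr, prod _ _ fi gi])
  have d2 : |F.im * G.im| ≤ b ^ 2 := prod _ _ fi gi
  have d3 : |G.re ^ 2 + G.im ^ 2 + F.re * H.re + F.im * H.im| ≤ 4 * b ^ 2 := by
    have := abs_le.1 (prod _ _ fr hr)
    have := abs_le.1 (prod _ _ fi hi)
    rw [abs_le]; constructor <;> linarith [sq_nonneg G.re, sq_nonneg G.im, sq_nonneg b]
  have d4 : |G.im ^ 2 + F.im * H.im| ≤ 2 * b ^ 2 := by
    have := abs_le.1 (prod _ _ fi hi)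
    rw [abs_le]; constructor <;> linarith [sq_nonneg G.re, sq_nonneg G.im, sq_nonneg b]
  have hq1 : 0 ≤ q - 1 := by linarith
  have hb4 : b ^ 2 * b ^ 2 ≤ m ^ 2 * b ^ 2 := by gcongr
  have d1s : (F.re * G.re + F.im * G.im) ^ 2 ≤ 4 * m ^ 2 * b ^ 2 := by
    have : (F.re * G.re + F.im * G.im) ^ 2 ≤ (2 * b ^ 2) ^ 2 :=
      sq_le_sq' (abs_le.1 d1).1 (abs_le.1 d1).2
    linarith [show (2 * b ^ 2) ^ 2 = 4 * (b ^ 2 * b ^ 2) by ring]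
  have d2s : (F.im * G.im) ^ 2 ≤ m ^ 2 * b ^ 2 := by
    have : (F.im * G.im) ^ 2 ≤ (b ^ 2) ^ 2 :=
      sq_le_sq' (abs_le.1 d2).1 (abs_le.1 d2).2
    linarith [show (b ^ 2) ^ 2 = (b ^ 2 * b ^ 2) by ring]
  have S1 := Real.rpow_nonneg (x := F.re ^ 2 + F.im ^ 2 + δ) (by positivity) (q - 1)
  have S2 := Real.rpow_nonneg (x := F.re ^ 2 + F.im ^ 2 + δ) (by positivity) (q - 2)
  have T1 := Real.rpow_nonneg (x := F.im ^ 2 + δ) (by positivity) (q - 1)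
  have T2 := Real.rpow_nonneg (x := F.im ^ 2 + δ) (by positivity) (q - 2)
  have c1 : |P1 q δ K F G| ≤ (2 * q * A * 2 + K * (2 * q * A)) * b ^ 2 := by
    unfold P1
    refine (abs_sub _ _).trans ?_
    rw [abs_mul, abs_mul K, abs_mul (2 * q * (F.im ^ 2 + δ) ^ (q - 1)), abs_of_nonneg hK,
      abs_of_nonneg (show 0 ≤ 2 * q * (F.im ^ 2 + δ) ^ (q - 1) by positivity),
      abs_of_nonneg (show 0 ≤ 2 * q * (F.re ^ 2 + F.im ^ 2 + δ) ^ (q - 1) by positivity)]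
    calc _ ≤ 2 * q * A * (2 * b ^ 2) + K * (2 * q * A * b ^ 2) := by gcongr
      _ = _ := by ring
  have c2 : |P2 q δ K F G H| ≤ (2 * q * (2 * (q - 1) * B * (4 * m ^ 2) + A * 4)
    + K * (2 * q * (2 * (q - 1) * B * (m ^ 2) + A * 2))) * b ^ 2 := by
    unfold P2
    refine (abs_sub _ _).trans ?_
    have u1 : |2 * (q - 1) * (F.re ^ 2 + F.im ^ 2 + δ) ^ (q - 2) * (F.re * G.re + F.im * G.im) ^ 2
        + (F.re ^ 2 + F.im ^ 2 + δ) ^ (q - 1) *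
        (G.re ^ 2 + G.im ^ 2 + F.re * H.re + F.im * H.im)| ≤
        2 * (q - 1) * B * (4 * m ^ 2 * b ^ 2) + A * (4 * b ^ 2) := by
      refine (abs_add_le _ _).trans ?_
      rw [abs_of_nonneg (show 0 ≤ 2 * (q - 1) * (F.re ^ 2 + F.im ^ 2 + δ) ^ (q - 2) *
        (F.re * G.re + F.im * G.im) ^ 2 by positivity), abs_mul, abs_of_nonneg S1]
      gcongr
    have u2 : |2 * (q - 1) * (F.im ^ 2 + δ) ^ (q - 2) * (F.im * G.im) ^ 2
      + (F.im ^ 2 + δ) ^ (q - 1) * (G.im ^ 2 + F.im * H.im)| ≤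
        2 * (q - 1) * B * (m ^ 2 * b ^ 2) + A * (2 * b ^ 2) := by
      refine (abs_add_le _ _).trans ?_
      rw [abs_of_nonneg (show 0 ≤ 2 * (q - 1) * (F.im ^ 2 + δ) ^ (q - 2) *
        (F.im * G.im) ^ 2 by positivity), abs_mul, abs_of_nonneg T1]
      gcongr
    rw [abs_mul, abs_mul K, abs_mul (2 * q), abs_of_nonneg hK,
      abs_of_nonneg (show 0 ≤ 2 * q by linarith)]
    calc _ ≤ 2 * q * (2 * (q - 1) * B * (4 * m ^ 2 * b ^ 2) + A * (4 * b ^ 2)) +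
          K * (2 * q * (2 * (q - 1) * B * (m ^ 2 * b ^ 2) + A * (2 * b ^ 2))) := by gcongr
      _ = _ := by ring
  have n1 : 0 ≤ (2 * q * A * 2 + K * (2 * q * A)) * b ^ 2 := by positivity
  have n2 : 0 ≤ (2 * q * (2 * (q - 1) * B * (4 * m ^ 2) + A * 4)
    + K * (2 * q * (2 * (q - 1) * B * (m ^ 2) + A * 2))) * b ^ 2 := by positivity
  constructor <;> rw [add_mul] <;> linarith

end CTW

namespace CTW
open Filter Topology

lemma integrable_W : Integrable (fun x : ℝ => ((1 + |x|)⁻¹) ^ 2) := by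
  refine (integrable_inv_one_add_sq).mono' ?_ ?_
  · exact (by fun_prop : Measurable (fun x : ℝ => ((1 + |x|)⁻¹) ^ 2)).aestronglyMeasurable
  · refine Eventually.of_forall fun x => ?_
    rw [Real.norm_of_nonneg (by positivity), inv_pow]
    apply inv_anti₀ (by positivity)
    nlinarith [abs_nonneg x, sq_abs x]

lemma line_vert {F : ℂ → ℂ} {F' : ℂ} {x y : ℝ} (h : HasDerivAt F F' (x + y * Complex.I)) :
    HasDerivAt (fun y : ℝ => F (x + y * Complex.I)) (Complex.I * F') y := by
  have h1 : HasDerivAt (fun y : ℝ => (x : ℂ) + y * Complex.I) Complex.I y := by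
    simpa using ((hasDerivAt_id y).ofReal_comp.mul_const Complex.I).const_add (x : ℂ)
  exact h.scomp y h1

lemma line_hor {F : ℂ → ℂ} {F' : ℂ} {x y : ℝ} (h : HasDerivAt F F' (x + y * Complex.I)) :
    HasDerivAt (fun x : ℝ => F (x + y * Complex.I)) F' x := by
  have h1 : HasDerivAt (fun x : ℝ => (x : ℂ) + y * Complex.I) 1 x := by
    simpa using ((hasDerivAt_id x).ofReal_comp.add_const (y * Complex.I))
  have h2 := h.scomp x h1
  rw [one_smul] at h2
  exact h2

lemma continuous_P0 {q δ K : ℝ} (hδ : 0 < δ) {f : ℝ → ℂ} (hf : Continuous f) :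
    Continuous (fun t => P0 q δ K (f t)) := by
  unfold P0
  have h1 : ∀ t, (f t).re ^ 2 + (f t).im ^ 2 + δ ≠ 0 := fun t => by positivity
  have h2 : ∀ t, (f t).im ^ 2 + δ ≠ 0 := fun t => by positivity
  have a : Continuous fun t => ((f t).re ^ 2 + (f t).im ^ 2 + δ) ^ q :=
    Continuous.rpow_const (by fun_prop) (fun t => Or.inl (h1 t))
  have b : Continuous fun t => ((f t).im ^ 2 + δ) ^ q :=
    Continuous.rpow_const (by fun_prop) (fun t => Or.inl (h2 t))
  fun_prop

lemma continuous_P1 {q δ K : ℝ} (hδ : 0 < δ) {f g : ℝ → ℂ} (hf : Continuous f)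
    (hg : Continuous g) : Continuous (fun t => P1 q δ K (f t) (g t)) := by
  unfold P1
  have h1 : ∀ t, (f t).re ^ 2 + (f t).im ^ 2 + δ ≠ 0 := fun t => by positivity
  have h2 : ∀ t, (f t).im ^ 2 + δ ≠ 0 := fun t => by positivity
  have a : Continuous fun t => ((f t).re ^ 2 + (f t).im ^ 2 + δ) ^ (q - 1) :=
    Continuous.rpow_const (by fun_prop) (fun t => Or.inl (h1 t))
  have b : Continuous fun t => ((f t).im ^ 2 + δ) ^ (q - 1) :=
    Continuous.rpow_const (by fun_prop) (fun t => Or.inl (h2 t))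
  fun_prop

lemma continuous_P2 {q δ K : ℝ} (hδ : 0 < δ) {f g h : ℝ → ℂ} (hf : Continuous f)
    (hg : Continuous g) (hh : Continuous h) :
    Continuous (fun t => P2 q δ K (f t) (g t) (h t)) := by
  unfold P2
  have h1 : ∀ t, (f t).re ^ 2 + (f t).im ^ 2 + δ ≠ 0 := fun t => by positivity
  have h2 : ∀ t, (f t).im ^ 2 + δ ≠ 0 := fun t => by positivity
  have a : Continuous fun t => ((f t).re ^ 2 + (f t).im ^ 2 + δ) ^ (q - 1) :=
    Continuous.rpow_const (by fun_prop) (fun t => Or.inl (h1 t))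
  have b : Continuous fun t => ((f t).im ^ 2 + δ) ^ (q - 1) :=
    Continuous.rpow_const (by fun_prop) (fun t => Or.inl (h2 t))
  have c : Continuous fun t => ((f t).re ^ 2 + (f t).im ^ 2 + δ) ^ (q - 2) :=
    Continuous.rpow_const (by fun_prop) (fun t => Or.inl (h1 t))
  have d : Continuous fun t => ((f t).im ^ 2 + δ) ^ (q - 2) :=
    Continuous.rpow_const (by fun_prop) (fun t => Or.inl (h2 t))
  fun_prop

/-- A function on the half line with monotone derivative and limit zero at infinity is
nonnegative. -/
lemma nonneg_of_convex_tendsto {J J1 J2 : ℝ → ℝ} (h1 : ∀ y, 0 < y → HasDerivAt J (J1 y) y)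
    (h2 : ∀ y, 0 < y → HasDerivAt J1 (J2 y) y) (h3 : ∀ y, 0 < y → 0 ≤ J2 y)
    (h0 : Tendsto J atTop (𝓝 0)) {y : ℝ} (hy : 0 < y) : 0 ≤ J y := by
  have mono : MonotoneOn J1 (Ioi 0) := by
    apply monotoneOn_of_deriv_nonneg (convex_Ioi 0)
    · exact fun y hy => (h2 y hy).continuousAt.continuousWithinAt
    · rw [interior_Ioi]
      exact fun y hy => (h2 y hy).differentiableAt.differentiableWithinAt
    · rw [interior_Ioi]
      intro y hy
      rw [(h2 y hy).deriv]; exact h3 y hy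
  have neg : ∀ a, 0 < a → J1 a ≤ 0 := by
    intro a ha
    by_contra hpos
    push Not at hpos
    have lin : ∀ b, a ≤ b → J1 a * (b - a) ≤ J b - J a := by
      intro b hab
      apply Convex.mul_sub_le_image_sub_of_le_deriv (convex_Ici a)
      · exact fun y hy => (h1 y (ha.trans_le hy)).continuousAt.continuousWithinAt
      · rw [interior_Ici]
        exact fun y hy => (h1 y (ha.trans hy)).differentiableAt.differentiableWithinAt
      · rw [interior_Ici]
        intro y hy
        rw [(h1 y (ha.trans hy)).deriv]
        exact mono ha (ha.trans hy) hy.le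
      · exact mem_Ici.2 le_rfl
      · exact hab
      · exact hab
    have t1 : Tendsto (fun b => J1 a * (b - a) + J a) atTop atTop :=
      tendsto_atTop_add_const_right _ _ ((tendsto_atTop_add_const_right _ (-a) tendsto_id).const_mul_atTop hpos)
    have t2 : Tendsto J atTop atTop := tendsto_atTop_mono' _ (by
      filter_upwards [eventually_ge_atTop a] with b hb
      linarith [lin b hb]) t1
    exact not_tendsto_nhds_of_tendsto_atTop t2 0 h0
  have anti : AntitoneOn J (Ioi 0) := by
    apply antitoneOn_of_deriv_nonpos (convex_Ioi 0)
    · exact fun y hy => (h1 y hy).continuousAt.continuousWithinAt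
    · rw [interior_Ioi]
      exact fun y hy => (h1 y hy).differentiableAt.differentiableWithinAt
    · rw [interior_Ioi]
      intro y hy
      rw [(h1 y hy).deriv]; exact neg y hy
  refine le_of_tendsto h0 ?_
  filter_upwards [eventually_ge_atTop y] with b hb
  exact anti hy (hy.trans_le hb) hb

set_option maxHeartbeats 1000000 in
lemma J_nonneg {F F1 F2 : ℂ → ℂ} (hF : ∀ ζ : ℂ, 0 < ζ.im → HasDerivAt F (F1 ζ) ζ)
    (hF1 : ∀ ζ : ℂ, 0 < ζ.im → HasDerivAt F1 (F2 ζ) ζ)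
    (hF2 : ContinuousOn F2 {ζ : ℂ | 0 < ζ.im})
    (hb : ∀ ε : ℝ, 0 < ε → ∃ C : ℝ, 0 ≤ C ∧ ∀ ζ : ℂ, ε ≤ ζ.im →
      ‖F ζ‖ ≤ C * (1 + |ζ.re|)⁻¹ ∧ ‖F1 ζ‖ ≤ C * (1 + |ζ.re|)⁻¹ ∧ ‖F2 ζ‖ ≤ C * (1 + |ζ.re|)⁻¹)
    (h0 : ∀ x : ℝ, Tendsto (fun y : ℝ => F (x + y * Complex.I)) atTop (𝓝 0))
    {q δ : ℝ} (hq : 1 < q) (hδ : 0 < δ) (hδ1 : δ ≤ 1) {y : ℝ} (hy : 0 < y) :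
    0 ≤ ∫ x : ℝ, P0 q δ (2 * q / (2 * q - 1)) (F (x + y * Complex.I)) := by
  set K := 2 * q / (2 * q - 1) with hK
  have hK0 : 0 ≤ K := div_nonneg (by linarith) (by linarith)
  have him : ∀ x y : ℝ, ((x : ℂ) + y * Complex.I).im = y := fun x y => by simp
  have hre : ∀ x y : ℝ, ((x : ℂ) + y * Complex.I).re = x := fun x y => by simp
  have cF : ∀ y : ℝ, 0 < y → Continuous (fun x : ℝ => F (x + y * Complex.I)) := fun y hy =>
    continuous_iff_continuousAt.2 fun x => (line_hor (hF _ (by rw [him]; exact hy))).continuousAt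
  have cF1 : ∀ y : ℝ, 0 < y → Continuous (fun x : ℝ => F1 (x + y * Complex.I)) := fun y hy =>
    continuous_iff_continuousAt.2 fun x => (line_hor (hF1 _ (by rw [him]; exact hy))).continuousAt
  have cF2 : ∀ y : ℝ, 0 < y → Continuous (fun x : ℝ => F2 (x + y * Complex.I)) := fun y hy =>
    hF2.comp_continuous (by fun_prop) (fun x => by simpa using hy)
  have cI1 : ∀ y : ℝ, 0 < y → Continuous (fun x : ℝ => Complex.I * F1 (x + y * Complex.I)) :=
    fun y hy => continuous_const.mul (cF1 y hy)
  have key : ∀ ε : ℝ, 0 < ε → ∃ C, 0 ≤ C ∧ ∀ y : ℝ, ε ≤ y → ∀ x : ℝ,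
      |P0 q δ K (F (x + y * Complex.I))| ≤ C * ((1 + |x|)⁻¹) ^ 2 ∧
      |P1 q δ K (F (x + y * Complex.I)) (Complex.I * F1 (x + y * Complex.I))|
        ≤ C * ((1 + |x|)⁻¹) ^ 2 ∧
      |P1 q δ K (F (x + y * Complex.I)) (F1 (x + y * Complex.I))| ≤ C * ((1 + |x|)⁻¹) ^ 2 ∧
      |P2 q δ K (F (x + y * Complex.I)) (Complex.I * F1 (x + y * Complex.I))
        (-F2 (x + y * Complex.I))| ≤ C * ((1 + |x|)⁻¹) ^ 2 ∧
      |P2 q δ K (F (x + y * Complex.I)) (F1 (x + y * Complex.I))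
        (F2 (x + y * Complex.I))| ≤ C * ((1 + |x|)⁻¹) ^ 2 := by
    intro ε hε
    obtain ⟨C, hC, hbC⟩ := hb ε hε
    obtain ⟨A, hA, hA'⟩ := P0_bound hq hC hK0
    obtain ⟨B, hB, hB'⟩ := quad_bound_PP hq hδ hC hK0
    refine ⟨A * C ^ 2 + B * C ^ 2, by positivity, fun y hy x => ?_⟩
    obtain ⟨b0, b1, b2⟩ := hbC (x + y * Complex.I) (by rw [him]; exact hy)
    rw [hre] at b0 b1 b2
    set w := (1 + |x|)⁻¹ with hw
    have hw0 : 0 ≤ w := by positivity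
    have hw1 : w ≤ 1 := inv_le_one_of_one_le₀ (by linarith [abs_nonneg x])
    have hCw : C * w ≤ C := by nlinarith
    have n1 : ‖Complex.I * F1 (x + y * Complex.I)‖ ≤ C * w := by simpa using b1
    have n2 : ‖-F2 (x + y * Complex.I)‖ ≤ C * w := by simpa using b2
    have r0 := hA' δ hδ.le hδ1 _ (b0.trans hCw)
    have r1 := hB' (C * w) (by positivity) hCw _ _ _ b0 n1 n2
    have r2 := hB' (C * w) (by positivity) hCw _ _ _ b0 b1 b2
    have r0' : A * ‖F (x + y * Complex.I)‖ ^ 2 ≤ A * (C * w) ^ 2 := by gcongr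
    have e1 : A * (C * w) ^ 2 ≤ (A * C ^ 2 + B * C ^ 2) * w ^ 2 := by
      have : 0 ≤ B * C ^ 2 * w ^ 2 := by positivity
      linarith [show A * (C * w) ^ 2 = A * C ^ 2 * w ^ 2 by ring,
        show (A * C ^ 2 + B * C ^ 2) * w ^ 2 = A * C ^ 2 * w ^ 2 + B * C ^ 2 * w ^ 2 by ring]
    have e2 : B * (C * w) ^ 2 ≤ (A * C ^ 2 + B * C ^ 2) * w ^ 2 := by
      have : 0 ≤ A * C ^ 2 * w ^ 2 := by positivity
      linarith [show B * (C * w) ^ 2 = B * C ^ 2 * w ^ 2 by ring,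
        show (A * C ^ 2 + B * C ^ 2) * w ^ 2 = A * C ^ 2 * w ^ 2 + B * C ^ 2 * w ^ 2 by ring]
    exact ⟨r0.trans (r0'.trans e1), r1.1.trans e2, r2.1.trans e2, r1.2.trans e2, r2.2.trans e2⟩
  have nbhd : ∀ y : ℝ, 0 < y → Ioi (y / 2) ∈ 𝓝 y := fun y hy => Ioi_mem_nhds (by linarith)
  refine nonneg_of_convex_tendsto
    (J := fun y => ∫ x : ℝ, P0 q δ K (F (x + y * Complex.I)))
    (J1 := fun y => ∫ x : ℝ, P1 q δ K (F (x + y * Complex.I)) (Complex.I * F1 (x + y * Complex.I)))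
    (J2 := fun y => ∫ x : ℝ, P2 q δ K (F (x + y * Complex.I)) (Complex.I * F1 (x + y * Complex.I))
      (-F2 (x + y * Complex.I))) ?_ ?_ ?_ ?_ hy
  · intro y hy
    obtain ⟨C, hC, hk⟩ := key (y / 2) (by linarith)
    refine (hasDerivAt_integral_of_dominated_loc_of_deriv_le (𝕜 := ℝ) (E := ℝ) (μ := volume)
      (F := fun (y : ℝ) (x : ℝ) => P0 q δ K (F (x + y * Complex.I)))
      (F' := fun (y : ℝ) (x : ℝ) => P1 q δ K (F (x + y * Complex.I)) (Complex.I * F1 (x + y * Complex.I)))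
      (nbhd y hy)
      (bound := fun x => C * ((1 + |x|)⁻¹) ^ 2) ?_ ?_ ?_ ?_ (integrable_W.const_mul C) ?_).2
    · filter_upwards [nbhd y hy] with z hz
      exact (continuous_P0 hδ (cF z (by linarith [mem_Ioi.1 hz]))).aestronglyMeasurable
    · exact (integrable_W.const_mul C).mono' (continuous_P0 hδ (cF y hy)).aestronglyMeasurable
        (Eventually.of_forall fun x => (hk y (by linarith) x).1)
    · exact (continuous_P1 hδ (cF y hy) (cI1 y hy)).aestronglyMeasurable
    · exact Eventually.of_forall fun x z hz => (hk z (le_of_lt hz) x).2.1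
    · refine Eventually.of_forall fun x z hz => ?_
      exact hasDerivAt_P0 hδ (line_vert (hF _ (by rw [him]; linarith [mem_Ioi.1 hz])))
  · intro y hy
    obtain ⟨C, hC, hk⟩ := key (y / 2) (by linarith)
    refine (hasDerivAt_integral_of_dominated_loc_of_deriv_le (𝕜 := ℝ) (E := ℝ) (μ := volume)
      (F := fun (y : ℝ) (x : ℝ) => P1 q δ K (F (x + y * Complex.I)) (Complex.I * F1 (x + y * Complex.I)))
      (F' := fun (y : ℝ) (x : ℝ) => P2 q δ K (F (x + y * Complex.I)) (Complex.I * F1 (x + y * Complex.I))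
        (-F2 (x + y * Complex.I)))
      (nbhd y hy)
      (bound := fun x => C * ((1 + |x|)⁻¹) ^ 2) ?_ ?_ ?_ ?_ (integrable_W.const_mul C) ?_).2
    · filter_upwards [nbhd y hy] with z hz
      have hz' : 0 < z := by linarith [mem_Ioi.1 hz]
      exact (continuous_P1 hδ (cF z hz') (cI1 z hz')).aestronglyMeasurable
    · exact (integrable_W.const_mul C).mono'
        (continuous_P1 hδ (cF y hy) (cI1 y hy)).aestronglyMeasurable
        (Eventually.of_forall fun x => (hk y (by linarith) x).2.1)
    · exact (continuous_P2 hδ (cF y hy) (cI1 y hy) (cF2 y hy).neg).aestronglyMeasurable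
    · exact Eventually.of_forall fun x z hz => (hk z (le_of_lt hz) x).2.2.2.1
    · refine Eventually.of_forall fun x z hz => ?_
      have hz' : 0 < ((x : ℂ) + z * Complex.I).im := by rw [him]; linarith [mem_Ioi.1 hz]
      refine hasDerivAt_P1 hδ (line_vert (hF _ hz')) ?_
      have := (line_vert (hF1 _ hz')).const_mul Complex.I
      refine this.congr_deriv ?_
      rw [← mul_assoc, Complex.I_mul_I, neg_one_mul]
  · intro y hy
    obtain ⟨C, hC, hk⟩ := key y hy
    have i1 : Integrable fun x : ℝ => P2 q δ K (F (x + y * Complex.I))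
        (Complex.I * F1 (x + y * Complex.I)) (-F2 (x + y * Complex.I)) :=
      (integrable_W.const_mul C).mono'
        (continuous_P2 hδ (cF y hy) (cI1 y hy) (cF2 y hy).neg).aestronglyMeasurable
        (Eventually.of_forall fun x => (hk y le_rfl x).2.2.2.1)
    have i2 : Integrable fun x : ℝ => P2 q δ K (F (x + y * Complex.I))
        (F1 (x + y * Complex.I)) (F2 (x + y * Complex.I)) :=
      (integrable_W.const_mul C).mono'
        (continuous_P2 hδ (cF y hy) (cF1 y hy) (cF2 y hy)).aestronglyMeasurable
        (Eventually.of_forall fun x => (hk y le_rfl x).2.2.2.2)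
    have i3 : Integrable fun x : ℝ => P1 q δ K (F (x + y * Complex.I))
        (F1 (x + y * Complex.I)) :=
      (integrable_W.const_mul C).mono'
        (continuous_P1 hδ (cF y hy) (cF1 y hy)).aestronglyMeasurable
        (Eventually.of_forall fun x => (hk y le_rfl x).2.2.1)
    have z : ∫ x : ℝ, P2 q δ K (F (x + y * Complex.I))
        (F1 (x + y * Complex.I)) (F2 (x + y * Complex.I)) = 0 := by
      refine integral_eq_zero_of_hasDerivAt_of_integrable (fun x => ?_) i2 i3
      have hz' : 0 < ((x : ℂ) + y * Complex.I).im := by rw [him]; exact hy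
      exact hasDerivAt_P1 hδ (line_hor (hF _ hz')) (line_hor (hF1 _ hz'))
    have : ∫ x : ℝ, P2 q δ K (F (x + y * Complex.I))
        (Complex.I * F1 (x + y * Complex.I)) (-F2 (x + y * Complex.I)) =
        ∫ x : ℝ, (P2 q δ K (F (x + y * Complex.I))
        (F1 (x + y * Complex.I)) (F2 (x + y * Complex.I)) + P2 q δ K (F (x + y * Complex.I))
        (Complex.I * F1 (x + y * Complex.I)) (-F2 (x + y * Complex.I))) := by
      rw [integral_add i2 i1, z, zero_add]
    simp only [this]
    exact integral_nonneg fun x => P2_add_nonneg hq hδ _ _ _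
  · obtain ⟨C, hC, hk⟩ := key 1 one_pos
    have := tendsto_integral_filter_of_dominated_convergence
      (F := fun (y : ℝ) (x : ℝ) => P0 q δ K (F (x + y * Complex.I))) (f := fun _ => (0 : ℝ))
      (l := atTop) (μ := volume)
      (fun x => C * ((1 + |x|)⁻¹) ^ 2) ?_ ?_ (integrable_W.const_mul C) ?_
    · simpa using this
    · filter_upwards [eventually_ge_atTop (1 : ℝ)] with z hz
      exact (continuous_P0 hδ (cF z (by linarith))).aestronglyMeasurable
    · filter_upwards [eventually_ge_atTop (1 : ℝ)] with z hz
      exact Eventually.of_forall fun x => (hk z hz x).1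
    · refine Eventually.of_forall fun x => ?_
      have c0 : Tendsto (P0 q δ K) (𝓝 0) (𝓝 0) := by
        have : ContinuousAt (P0 q δ K) 0 := by
          unfold P0
          have a : ContinuousAt (fun F : ℂ => (F.re ^ 2 + F.im ^ 2 + δ) ^ q) 0 :=
            ContinuousAt.rpow_const (by fun_prop) (Or.inl (by simpa using hδ.ne'))
          have b : ContinuousAt (fun F : ℂ => (F.im ^ 2 + δ) ^ q) 0 :=
            ContinuousAt.rpow_const (by fun_prop) (Or.inl (by simpa using hδ.ne'))
          fun_prop
        have h := this.tendsto
        simpa [P0] using h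
      exact c0.comp (h0 x)

end CTW

namespace CTW
open Filter Topology

/-- Jensen / Schur type inequality. -/
lemma jensen {α : Type*} [MeasurableSpace α] {μ : Measure α} {p : ℝ} (hp : 1 < p)
    {f k : α → ℝ≥0∞} (hf : AEMeasurable f μ) (hk : AEMeasurable k μ) :
    (∫⁻ x, f x * k x ∂μ) ^ p ≤ (∫⁻ x, k x ∂μ) ^ (p - 1) * ∫⁻ x, f x ^ p * k x ∂μ := by
  have hp0 : 0 < p := by linarith
  have hpq : p.HolderConjugate (p / (p - 1)) := Real.HolderConjugate.conjExponent hp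
  have h := ENNReal.lintegral_mul_le_Lp_mul_Lq μ hpq (f := fun x => f x * k x ^ (1 / p))
    (g := fun x => k x ^ (1 / (p / (p - 1)))) (by fun_prop) (by fun_prop)
  have hq0 : 0 < p / (p - 1) := by apply div_pos <;> linarith
  have e1 : ∀ x, f x * k x ^ (1 / p) * k x ^ (1 / (p / (p - 1))) = f x * k x := by
    intro x
    rw [mul_assoc, ← ENNReal.rpow_add_of_nonneg _ _ (by positivity) (by positivity)]
    have : 1 / p + 1 / (p / (p - 1)) = 1 := by field_simp; ring
    rw [this, ENNReal.rpow_one]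
  have e2 : ∀ x, (f x * k x ^ (1 / p)) ^ p = f x ^ p * k x := by
    intro x
    rw [ENNReal.mul_rpow_of_nonneg _ _ hp0.le, ← ENNReal.rpow_mul, one_div_mul_cancel hp0.ne',
      ENNReal.rpow_one]
  have e3 : ∀ x, (k x ^ (1 / (p / (p - 1)))) ^ (p / (p - 1)) = k x := by
    intro x
    rw [← ENNReal.rpow_mul, one_div_mul_cancel hq0.ne', ENNReal.rpow_one]
  simp only [Pi.mul_apply, e1, e2, e3] at h
  calc (∫⁻ x, f x * k x ∂μ) ^ p ≤ _ := ENNReal.rpow_le_rpow h hp0.le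
    _ = _ := by
      rw [ENNReal.mul_rpow_of_nonneg _ _ hp0.le, ← ENNReal.rpow_mul, ← ENNReal.rpow_mul,
        one_div_mul_cancel hp0.ne', ENNReal.rpow_one, mul_comm]
      congr 2
      field_simp

/-- Minkowski-like bound for a family of functions. -/
lemma schur {α β : Type*} [MeasurableSpace α] [MeasurableSpace β] {μ : Measure α} {ν : Measure β}
    [SFinite μ] [SFinite ν] {p : ℝ} (hp : 1 < p) {h : β → α → ℝ≥0∞} {k : β → ℝ≥0∞}
    (hh : Measurable (Function.uncurry h)) (hk : Measurable k) {B : ℝ≥0∞}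
    (hB : ∀ θ, ∫⁻ x, h θ x ^ p ∂μ ≤ B) :
    ∫⁻ x, (∫⁻ θ, h θ x * k θ ∂ν) ^ p ∂μ ≤ (∫⁻ θ, k θ ∂ν) ^ p * B := by
  have hm : ∀ x, Measurable fun θ => h θ x := fun x =>
    hh.comp (measurable_id.prodMk measurable_const)
  have hm' : ∀ θ, Measurable fun x => h θ x := fun θ =>
    hh.comp (measurable_const.prodMk measurable_id)
  have m2 : Measurable (Function.uncurry fun (x : α) (θ : β) => h θ x ^ p * k θ) := by
    have : Measurable fun z : α × β => Function.uncurry h (z.2, z.1) := hh.comp measurable_swap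
    exact (this.pow_const p).mul (hk.comp measurable_snd)
  calc ∫⁻ x, (∫⁻ θ, h θ x * k θ ∂ν) ^ p ∂μ
      ≤ ∫⁻ x, (∫⁻ θ, k θ ∂ν) ^ (p - 1) * ∫⁻ θ, h θ x ^ p * k θ ∂ν ∂μ :=
        lintegral_mono fun x => jensen hp (hm x).aemeasurable hk.aemeasurable
    _ = (∫⁻ θ, k θ ∂ν) ^ (p - 1) * ∫⁻ x, ∫⁻ θ, h θ x ^ p * k θ ∂ν ∂μ :=
        lintegral_const_mul _ m2.lintegral_prod_right'
    _ = (∫⁻ θ, k θ ∂ν) ^ (p - 1) * ∫⁻ θ, ∫⁻ x, h θ x ^ p * k θ ∂μ ∂ν := by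
        rw [lintegral_lintegral_swap m2.aemeasurable]
    _ = (∫⁻ θ, k θ ∂ν) ^ (p - 1) * ∫⁻ θ, (∫⁻ x, h θ x ^ p ∂μ) * k θ ∂ν := by
        congr 1
        refine lintegral_congr fun θ => ?_
        rw [lintegral_mul_const _ ((hm' θ).pow_const p)]
    _ ≤ (∫⁻ θ, k θ ∂ν) ^ (p - 1) * ∫⁻ θ, B * k θ ∂ν := by
        gcongr with θ; exact hB θ
    _ = (∫⁻ θ, k θ ∂ν) ^ p * B := by
        rw [lintegral_const_mul _ hk, mul_comm B, ← mul_assoc]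
        congr 1
        conv_lhs => rw [← ENNReal.rpow_one (∫⁻ θ, k θ ∂ν), ← ENNReal.rpow_mul, one_mul]
        rw [← ENNReal.rpow_add_of_nonneg _ _ (by linarith) zero_le_one]
        simp

/-- The Cauchy-type integrals. -/
noncomputable def CI (φ : ℝ → ℝ) (n : ℕ) (ζ : ℂ) : ℂ := ∫ s : ℝ, (φ s : ℂ) * ((ζ - s) ^ n)⁻¹

lemma sub_im (ζ : ℂ) (s : ℝ) : (ζ - s).im = ζ.im := by simp

lemma le_norm_sub {ε : ℝ} {ζ : ℂ} (h : ε ≤ ζ.im) (s : ℝ) : ε ≤ ‖ζ - s‖ := by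
  refine h.trans ?_
  rw [← sub_im ζ s]
  exact (le_abs_self _).trans (Complex.abs_im_le_norm _)

lemma sub_ne_zero' {ζ : ℂ} (h : 0 < ζ.im) (s : ℝ) : ζ - s ≠ 0 := by
  intro h0
  have := sub_im ζ s
  rw [h0] at this
  simp at this
  linarith

lemma norm_inv_pow_le {ε : ℝ} (hε : 0 < ε) {ζ : ℂ} (h : ε ≤ ζ.im) (s : ℝ) (n : ℕ) :
    ‖((ζ - s) ^ n)⁻¹‖ ≤ (ε ^ n)⁻¹ := by
  rw [norm_inv, norm_pow]
  gcongr
  exact le_norm_sub h s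

lemma continuous_kernel {ζ : ℂ} (h : 0 < ζ.im) (n : ℕ) :
    Continuous fun s : ℝ => ((ζ - s) ^ n)⁻¹ := by
  refine Continuous.inv₀ (by fun_prop) fun s => pow_ne_zero _ (sub_ne_zero' h s)

lemma hasDerivAt_CI {φ : ℝ → ℝ} (hφ : Continuous φ) (hs : HasCompactSupport φ) (n : ℕ) {ζ : ℂ}
    (hζ : 0 < ζ.im) : HasDerivAt (CI φ n) (-(n : ℂ) * CI φ (n + 1) ζ) ζ := by
  have hi : Integrable φ := hφ.integrable_of_hasCompactSupport hs
  have hnb : {z : ℂ | ζ.im / 2 < z.im} ∈ 𝓝 ζ :=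
    (isOpen_lt continuous_const Complex.continuous_im).mem_nhds (by simp; linarith)
  have h := (hasDerivAt_integral_of_dominated_loc_of_deriv_le (𝕜 := ℂ) (E := ℂ) (μ := volume)
    (F := fun (ζ : ℂ) (s : ℝ) => (φ s : ℂ) * ((ζ - s) ^ n)⁻¹)
    (F' := fun (ζ : ℂ) (s : ℝ) => (φ s : ℂ) * (-(n : ℂ) * ((ζ - s) ^ (n + 1))⁻¹))
    (bound := fun s => ‖φ s‖ * (n * ((ζ.im / 2) ^ (n + 1))⁻¹)) hnb ?_ ?_ ?_ ?_ ?_ ?_).2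
  · refine HasDerivAt.congr_deriv (f := CI φ n) h ?_
    unfold CI
    rw [← integral_const_mul]
    congr 1; ext s; ring
  · filter_upwards [hnb] with z hz
    have hz' : 0 < z.im := by linarith [show ζ.im / 2 < z.im from hz]
    have := continuous_kernel hz' n
    exact (Continuous.aestronglyMeasurable (by fun_prop))
  · have := continuous_kernel hζ n
    have h1 : Continuous fun s : ℝ => (φ s : ℂ) * ((ζ - s) ^ n)⁻¹ := by fun_prop
    refine (hi.norm.mul_const ((ζ.im ^ n)⁻¹)).mono' h1.aestronglyMeasurable ?_
    refine Eventually.of_forall fun s => ?_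
    rw [norm_mul, Complex.norm_real]
    gcongr
    exact norm_inv_pow_le hζ le_rfl s n
  · have := continuous_kernel hζ (n + 1)
    exact (Continuous.aestronglyMeasurable (by fun_prop))
  · refine Eventually.of_forall fun s z hz => ?_
    rw [norm_mul, norm_mul, Complex.norm_real, norm_neg, Complex.norm_natCast]
    gcongr
    exact norm_inv_pow_le (by linarith) (le_of_lt hz) s (n + 1)
  · exact hi.norm.mul_const _
  · refine Eventually.of_forall fun s z hz => ?_
    have hz' : 0 < z.im := by linarith [show ζ.im / 2 < z.im from hz]
    have hne := sub_ne_zero' hz' s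
    have h1 : HasDerivAt (fun z : ℂ => z - s) 1 z := (hasDerivAt_id z).sub_const _
    have h2 := ((h1.pow n).inv (pow_ne_zero _ hne)).const_mul (φ s : ℂ)
    refine h2.congr_deriv ?_
    rcases n with _ | n
    · simp
    · simp only [Nat.add_sub_cancel, mul_one]
      field_simp
      simp only [Pi.pow_apply]
      ring

lemma CI_bound {φ : ℝ → ℝ} (hφ : Continuous φ) (hs : HasCompactSupport φ) (n : ℕ) {ε : ℝ}
    (hε : 0 < ε) : ∃ C : ℝ, 0 ≤ C ∧ ∀ ζ : ℂ, ε ≤ ζ.im → ‖CI φ (n + 1) ζ‖ ≤ C * (1 + |ζ.re|)⁻¹ := by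
  have hi : Integrable φ := hφ.integrable_of_hasCompactSupport hs
  obtain ⟨R, hR0, hR⟩ : ∃ R, 0 < R ∧ ∀ s, φ s ≠ 0 → |s| ≤ R := by
    obtain ⟨R, hR⟩ := hs.isCompact.isBounded.exists_pos_norm_le
    exact ⟨R, hR.1, fun s h => hR.2 s (subset_tsupport _ h)⟩
  set A := (1 + R) / ε + 1 with hA
  refine ⟨(∫ s, ‖φ s‖) * ((ε ^ n)⁻¹ * A), by positivity, fun ζ hζ => ?_⟩
  have : ‖CI φ (n + 1) ζ‖ ≤ ∫ s, ‖φ s‖ * (((ε ^ n)⁻¹ * A) * (1 + |ζ.re|)⁻¹) := by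
    refine norm_integral_le_of_norm_le (hi.norm.mul_const _) (Eventually.of_forall fun s => ?_)
    rw [norm_mul, Complex.norm_real]
    by_cases h0 : φ s = 0
    · simp [h0]
    gcongr
    rw [pow_succ, mul_inv, norm_mul, mul_assoc]
    gcongr
    · exact norm_inv_pow_le hε hζ s n
    · have h1 := le_norm_sub hζ s
      have h2 : |ζ.re - s| ≤ ‖ζ - s‖ := by
        simpa using Complex.abs_re_le_norm (ζ - s)
      have h3 := hR s h0
      have h4 : |ζ.re| ≤ |ζ.re - s| + |s| := by
        have := abs_add_le (ζ.re - s) s; simpa using this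
      have h5 : 1 + R ≤ (1 + R) / ε * ‖ζ - s‖ := by
        rw [div_mul_eq_mul_div, le_div_iff₀ hε]; gcongr
      have h6 : 1 + |ζ.re| ≤ A * ‖ζ - s‖ := by rw [hA]; linarith
      have h7 : 0 < ‖ζ - s‖ := by linarith
      rw [norm_inv, ← div_eq_mul_inv, inv_le_iff_one_le_mul₀ h7, div_mul_eq_mul_div,
        one_le_div (by positivity)]
      exact h6
  rw [integral_mul_const] at this
  linarith

lemma rpow_add_le_split {q M : ℝ} (hq : 0 < q) (hM : 1 < M) :
    ∃ C : ℝ, 0 ≤ C ∧ ∀ a b : ℝ, 0 ≤ a → 0 ≤ b → (a + b) ^ q ≤ M * b ^ q + C * a ^ q := by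
  set τ := M ^ (1 / q) - 1 with hτ
  have hτ0 : 0 < τ := by
    have := Real.one_lt_rpow hM (show 0 < 1 / q by positivity)
    linarith
  refine ⟨(1 + 1 / τ) ^ q, by positivity, fun a b ha hb => ?_⟩
  have na : 0 ≤ a ^ q := Real.rpow_nonneg ha q
  have nb : 0 ≤ b ^ q := Real.rpow_nonneg hb q
  have nC : 0 ≤ (1 + 1 / τ) ^ q := by positivity
  rcases le_total a (τ * b) with h | h
  · have h1 : (a + b) ^ q ≤ ((1 + τ) * b) ^ q :=
      Real.rpow_le_rpow (by positivity) (by linarith) hq.le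
    rw [Real.mul_rpow (by positivity) hb] at h1
    have h2 : (1 + τ) ^ q = M := by
      rw [hτ, add_sub_cancel, ← Real.rpow_mul (by linarith), one_div_mul_cancel hq.ne',
        Real.rpow_one]
    rw [h2] at h1
    have := mul_nonneg nC na
    linarith
  · have h1 : (a + b) ^ q ≤ ((1 + 1 / τ) * a) ^ q := by
      refine Real.rpow_le_rpow (by positivity) ?_ hq.le
      have : b ≤ a / τ := by rw [le_div_iff₀ hτ0]; linarith
      have e : (1 + 1 / τ) * a = a + a / τ := by ring
      rw [e]; linarith
    rw [Real.mul_rpow (by positivity) ha] at h1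
    have : 0 ≤ M * b ^ q := by positivity
    linarith

end CTW

namespace CTW
open Filter Topology

lemma poisson_integral {y : ℝ} (hy : 0 < y) :
    Integrable (fun t : ℝ => y / (t ^ 2 + y ^ 2)) ∧ ∫ t : ℝ, y / (t ^ 2 + y ^ 2) = Real.pi := by
  have e : (fun t : ℝ => y / (t ^ 2 + y ^ 2)) = fun t => y⁻¹ * (fun t => (1 + t ^ 2)⁻¹) (t / y) := by
    ext t
    have : t ^ 2 + y ^ 2 ≠ 0 := by positivity
    have : 1 + (t / y) ^ 2 ≠ 0 := by positivity
    simp only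
    field_simp
    ring
  rw [e]
  refine ⟨(integrable_inv_one_add_sq.comp_div hy.ne').const_mul _, ?_⟩
  rw [integral_const_mul, Measure.integral_comp_div (fun t : ℝ => (1 + t ^ 2)⁻¹),
    integral_univ_inv_one_add_sq, smul_eq_mul, abs_of_pos hy, inv_mul_cancel_left₀ hy.ne']

lemma poisson_lintegral {y : ℝ} (hy : 0 < y) :
    ∫⁻ t : ℝ, ENNReal.ofReal (y / (t ^ 2 + y ^ 2)) = ENNReal.ofReal Real.pi := by
  rw [← (poisson_integral hy).2, ofReal_integral_eq_lintegral_ofReal (poisson_integral hy).1]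
  exact Eventually.of_forall fun t => by positivity

lemma enorm_rpow_eq {q : ℝ} (hq : 0 ≤ q) (v : ℝ) :
    ‖v‖ₑ ^ (2 * q) = ENNReal.ofReal ((v ^ 2) ^ q) := by
  rw [← ofReal_norm, ENNReal.ofReal_rpow_of_nonneg (norm_nonneg _) (by positivity),
    Real.norm_eq_abs, Real.rpow_mul (abs_nonneg _)]
  norm_num

lemma poisson_bound {p : ℝ} (hp : 1 < p) {φ : ℝ → ℝ} (hφ : Continuous φ) {y : ℝ} (hy : 0 < y) :
    ∫⁻ x : ℝ, ‖∫ s, φ s * (y / ((x - s) ^ 2 + y ^ 2))‖ₑ ^ p ≤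
      ENNReal.ofReal Real.pi ^ p * ∫⁻ x, ‖φ x‖ₑ ^ p := by
  have h := schur (μ := (volume : Measure ℝ)) (ν := (volume : Measure ℝ)) hp
    (h := fun t x => ‖φ (x - t)‖ₑ) (k := fun t => ENNReal.ofReal (y / (t ^ 2 + y ^ 2)))
    (by
      have : Continuous fun z : ℝ × ℝ => φ (z.2 - z.1) := by fun_prop
      exact this.measurable.enorm) (by fun_prop) (B := ∫⁻ x, ‖φ x‖ₑ ^ p)
    (fun t => by rw [lintegral_sub_right_eq_self (fun x => ‖φ x‖ₑ ^ p) t])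
  rw [poisson_lintegral hy] at h
  refine le_trans (lintegral_mono fun x => ?_) h
  refine ENNReal.rpow_le_rpow ?_ (by linarith)
  refine (enorm_integral_le_lintegral_enorm _).trans (le_of_eq ?_)
  rw [← lintegral_sub_left_eq_self (fun t => ‖φ (x - t)‖ₑ * ENNReal.ofReal (y / (t ^ 2 + y ^ 2))) x]
  refine lintegral_congr fun s => ?_
  rw [enorm_mul, _root_.sub_sub_cancel, Real.enorm_eq_ofReal (by positivity : 0 ≤ y / ((x - s) ^ 2 + y ^ 2))]

lemma norm_int_kernel {φ : ℝ → ℝ} (hφ : Continuous φ) (hs : HasCompactSupport φ) {y : ℝ}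
    (hy : 0 < y) (x : ℝ) :
    (Complex.I * CI φ 1 (x + y * Complex.I)).re = ∫ s, φ s * (y / ((x - s) ^ 2 + y ^ 2)) ∧
    (Complex.I * CI φ 1 (x + y * Complex.I)).im = ∫ s, φ s * ((x - s) / ((x - s) ^ 2 + y ^ 2)) := by
  have him : ((x : ℂ) + y * Complex.I).im = y := by simp
  have hc := continuous_kernel (ζ := x + y * Complex.I) (by rw [him]; exact hy) 1
  have hi : Integrable fun s : ℝ => Complex.I * ((φ s : ℂ) * ((x + y * Complex.I - s) ^ 1)⁻¹) := by
    apply Continuous.integrable_of_hasCompactSupport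
    · fun_prop
    · refine hs.mono fun s hs h0 => hs ?_
      simp [h0]
  have e : Complex.I * CI φ 1 (x + y * Complex.I) =
      ∫ s : ℝ, Complex.I * ((φ s : ℂ) * ((x + y * Complex.I - s) ^ 1)⁻¹) := by
    rw [CI, integral_const_mul]
  have hne : ∀ s : ℝ, (x - s) ^ 2 + y ^ 2 ≠ 0 := fun s => by positivity
  have ek : ∀ s : ℝ, Complex.I * ((φ s : ℂ) * ((x + y * Complex.I - s) ^ 1)⁻¹) =
      ((φ s * (y / ((x - s) ^ 2 + y ^ 2)) : ℝ) : ℂ) +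
      ((φ s * ((x - s) / ((x - s) ^ 2 + y ^ 2)) : ℝ) : ℂ) * Complex.I := by
    intro s
    have h1 : (x : ℂ) + y * Complex.I - s ≠ 0 := sub_ne_zero' (by rw [him]; exact hy) s
    have h2 : ((x : ℂ) - s) ^ 2 + (y : ℂ) ^ 2 ≠ 0 := by exact_mod_cast hne s
    push_cast
    rw [pow_one]
    rw [← div_eq_mul_inv, ← mul_div_assoc, div_eq_iff h1]
    field_simp
    linear_combination (-(y : ℂ) * (x - s)) * (φ s : ℂ) * Complex.I_sq
  constructor
  · rw [e, ← Complex.reCLM_apply, ← Complex.reCLM.integral_comp_comm hi]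
    congr 1; ext s
    rw [ek]; simp [-Complex.ofReal_mul, -Complex.ofReal_div]
  · rw [e, ← Complex.imCLM_apply, ← Complex.imCLM.integral_comp_comm hi]
    congr 1; ext s
    rw [ek]; simp [-Complex.ofReal_mul, -Complex.ofReal_div]

set_option maxHeartbeats 1000000 in
lemma hilbert_aux {q : ℝ} (hq : 1 < q) : ∃ C : ℝ, 0 ≤ C ∧ ∀ φ : ℝ → ℝ, Continuous φ →
    HasCompactSupport φ → ∀ y : ℝ, 0 < y →
    ∫⁻ x : ℝ, ‖(Complex.I * CI φ 1 (x + y * Complex.I)).im‖ₑ ^ (2 * q) ≤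
    ENNReal.ofReal C * ∫⁻ x : ℝ, ‖(Complex.I * CI φ 1 (x + y * Complex.I)).re‖ₑ ^ (2 * q) := by
  set K := 2 * q / (2 * q - 1) with hK
  have hK1 : 1 < K := by rw [hK, one_lt_div (by linarith)]; linarith
  obtain ⟨C, hC, hsplit⟩ := rpow_add_le_split (q := q) (M := (1 + K) / 2) (by linarith) (by linarith)
  refine ⟨C / (K - (1 + K) / 2), div_nonneg hC (by linarith), fun φ hφ hs y hy => ?_⟩
  set F : ℂ → ℂ := fun ζ => Complex.I * CI φ 1 ζ with hF
  have hF1 : ∀ ζ : ℂ, 0 < ζ.im → HasDerivAt F (Complex.I * (-1 * CI φ 2 ζ)) ζ := fun ζ h => by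
    simpa using (hasDerivAt_CI hφ hs 1 h).const_mul Complex.I
  have hF2 : ∀ ζ : ℂ, 0 < ζ.im → HasDerivAt (fun ζ => Complex.I * (-1 * CI φ 2 ζ))
      (Complex.I * (-1 * (-2 * CI φ 3 ζ))) ζ := fun ζ h => by
    simpa using ((hasDerivAt_CI hφ hs 2 h).const_mul (-1)).const_mul Complex.I
  have hc3 : ContinuousOn (fun ζ => Complex.I * (-1 * (-2 * CI φ 3 ζ))) {ζ : ℂ | 0 < ζ.im} := by
    intro ζ h
    exact ((((hasDerivAt_CI hφ hs 3 h).const_mul (-2)).const_mul (-1)).const_mul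
      Complex.I).continuousAt.continuousWithinAt
  have hb : ∀ ε : ℝ, 0 < ε → ∃ C : ℝ, 0 ≤ C ∧ ∀ ζ : ℂ, ε ≤ ζ.im →
      ‖F ζ‖ ≤ C * (1 + |ζ.re|)⁻¹ ∧ ‖Complex.I * (-1 * CI φ 2 ζ)‖ ≤ C * (1 + |ζ.re|)⁻¹ ∧
      ‖Complex.I * (-1 * (-2 * CI φ 3 ζ))‖ ≤ C * (1 + |ζ.re|)⁻¹ := by
    intro ε hε
    obtain ⟨C1, h1, b1⟩ := CI_bound hφ hs 0 hε
    obtain ⟨C2, h2, b2⟩ := CI_bound hφ hs 1 hε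
    obtain ⟨C3, h3, b3⟩ := CI_bound hφ hs 2 hε
    refine ⟨C1 + C2 + 2 * C3, by positivity, fun ζ hζ => ?_⟩
    have w0 : 0 ≤ (1 + |ζ.re|)⁻¹ := by positivity
    have d1 := b1 ζ hζ
    have d2 := b2 ζ hζ
    have d3 := b3 ζ hζ
    have m1 := mul_nonneg h1 w0
    have m2 := mul_nonneg h2 w0
    have m3 := mul_nonneg h3 w0
    norm_num at d1 d2 d3
    simp only [hF, norm_mul, Complex.norm_I, norm_neg, norm_one, one_mul]
    norm_num
    refine ⟨by linarith, by linarith, by linarith⟩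
  have h0 : ∀ x : ℝ, Tendsto (fun y : ℝ => F (x + y * Complex.I)) atTop (𝓝 0) := by
    intro x
    have hi : Integrable φ := hφ.integrable_of_hasCompactSupport hs
    refine squeeze_zero_norm' (a := fun y => (∫ s, ‖φ s‖) * y⁻¹) ?_ ?_
    · filter_upwards [eventually_gt_atTop (0 : ℝ)] with y hy
      rw [hF, norm_mul, Complex.norm_I, one_mul, ← integral_mul_const]
      refine norm_integral_le_of_norm_le (hi.norm.mul_const _) (Eventually.of_forall fun s => ?_)
      rw [norm_mul, Complex.norm_real]
      gcongr
      have := norm_inv_pow_le hy (ζ := x + y * Complex.I) (by simp) s 1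
      simpa using this
    · simpa using tendsto_inv_atTop_zero.const_mul (∫ s, ‖φ s‖)
  have hJ : ∀ δ : ℝ, 0 < δ → δ ≤ 1 → 0 ≤ ∫ x : ℝ, P0 q δ K (F (x + y * Complex.I)) :=
    fun δ h1 h2 => J_nonneg hF1 hF2 hc3 hb h0 hq h1 h2 hy
  have cF : Continuous (fun x : ℝ => F (x + y * Complex.I)) :=
    continuous_iff_continuousAt.2 fun x => (line_hor (hF1 _ (by simpa using hy))).continuousAt
  have cFre : Continuous (fun x : ℝ => (F (x + y * Complex.I)).re) := Complex.continuous_re.comp cF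
  have cFim : Continuous (fun x : ℝ => (F (x + y * Complex.I)).im) := Complex.continuous_im.comp cF
  obtain ⟨C0, hC0, hbd⟩ := hb y hy
  have hbd' : ∀ x : ℝ, ‖F (x + y * Complex.I)‖ ≤ C0 * (1 + |x|)⁻¹ := fun x => by
    simpa using (hbd (x + y * Complex.I) (by simp)).1
  have hw1 : ∀ x : ℝ, (1 + |x|)⁻¹ ≤ 1 := fun x =>
    inv_le_one_of_one_le₀ (by linarith [abs_nonneg x])
  have hbd1 : ∀ x : ℝ, ‖F (x + y * Complex.I)‖ ≤ C0 := fun x =>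
    (hbd' x).trans (mul_le_of_le_one_right hC0 (hw1 x))
  have hlim : Tendsto (fun δ : ℝ => ∫ x : ℝ, P0 q δ K (F (x + y * Complex.I))) (𝓝[>] 0)
      (𝓝 (∫ x : ℝ, P0 q 0 K (F (x + y * Complex.I)))) := by
    obtain ⟨A, hA, hA'⟩ := P0_bound hq hC0 (by linarith : 0 ≤ K)
    refine tendsto_integral_filter_of_dominated_convergence
      (fun x => A * C0 ^ 2 * ((1 + |x|)⁻¹) ^ 2) ?_ ?_ (integrable_W.const_mul _) ?_
    · filter_upwards [self_mem_nhdsWithin] with δ hδ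
      exact (continuous_P0 hδ cF).aestronglyMeasurable
    · filter_upwards [Ioc_mem_nhdsGT (zero_lt_one' ℝ)] with δ hδ
      refine Eventually.of_forall fun x => (hA' δ hδ.1.le hδ.2 _ (hbd1 x)).trans ?_
      rw [mul_assoc, ← mul_pow]
      gcongr
      exact hbd' x
    · refine Eventually.of_forall fun x => ?_
      have : Continuous fun δ => P0 q δ K (F (x + y * Complex.I)) := by
        unfold P0
        have hr : ∀ a : ℝ, Continuous fun δ : ℝ => (a + δ) ^ q := fun a =>
          Continuous.rpow_const (by fun_prop) fun _ => Or.inr (by linarith)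
        have hr1 := hr ((F (x + y * Complex.I)).re ^ 2 + (F (x + y * Complex.I)).im ^ 2)
        have hr2 := hr ((F (x + y * Complex.I)).im ^ 2)
        have hr3 : Continuous fun δ : ℝ => δ ^ q := by simpa using hr 0
        fun_prop
      exact (this.tendsto 0).mono_left nhdsWithin_le_nhds
  have hnn : 0 ≤ ∫ x : ℝ, P0 q 0 K (F (x + y * Complex.I)) := by
    refine ge_of_tendsto hlim ?_
    filter_upwards [Ioc_mem_nhdsGT (zero_lt_one' ℝ)] with δ hδ
    exact hJ δ hδ.1 hδ.2
  have hIntg : ∀ v : ℝ → ℝ, Continuous v → (∀ x, |v x| ≤ ‖F (x + y * Complex.I)‖) →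
      Integrable fun x => (v x ^ 2) ^ q := by
    intro v hv hvb
    refine (integrable_W.const_mul ((C0 ^ 2) ^ q)).mono' ?_ (Eventually.of_forall fun x => ?_)
    · exact (Continuous.rpow_const (by fun_prop) fun _ => Or.inr (by linarith)).aestronglyMeasurable
    · rw [Real.norm_of_nonneg (by positivity)]
      set w := (1 + |x|)⁻¹ with hw
      have hw0 : 0 ≤ w := by positivity
      have h1 : v x ^ 2 ≤ (C0 * w) ^ 2 := by
        rw [← sq_abs]
        have := (hvb x).trans (hbd' x)
        gcongr
      calc (v x ^ 2) ^ q ≤ ((C0 * w) ^ 2) ^ q := Real.rpow_le_rpow (by positivity) h1 (by linarith)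
        _ = (C0 ^ 2) ^ q * (w ^ 2) ^ q := by rw [mul_pow, Real.mul_rpow (by positivity) (by positivity)]
        _ ≤ (C0 ^ 2) ^ q * w ^ 2 := by
          gcongr
          have hw2 : w ^ 2 ≤ 1 := pow_le_one₀ hw0 (hw1 x)
          rcases hw0.eq_or_lt with h | h
          · rw [← h]; simp [Real.zero_rpow (by linarith : q ≠ 0)]
          · calc (w ^ 2) ^ q ≤ (w ^ 2) ^ (1 : ℝ) :=
                Real.rpow_le_rpow_of_exponent_ge (by positivity) hw2 hq.le
              _ = w ^ 2 := Real.rpow_one _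
  have iU := hIntg (fun x => (F (x + y * Complex.I)).re) cFre
    (fun x => Complex.abs_re_le_norm _)
  have iV := hIntg (fun x => (F (x + y * Complex.I)).im) cFim
    (fun x => Complex.abs_im_le_norm _)
  have hd : 0 < K - (1 + K) / 2 := by linarith
  have hreal : (K - (1 + K) / 2) * ∫ x : ℝ, ((F (x + y * Complex.I)).im ^ 2) ^ q ≤
      C * ∫ x : ℝ, ((F (x + y * Complex.I)).re ^ 2) ^ q := by
    rw [← integral_const_mul, ← integral_const_mul, ← sub_nonneg,
      ← integral_sub (iU.const_mul _) (iV.const_mul _)]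
    by_cases hi0 : Integrable fun x : ℝ => P0 q 0 K (F (x + y * Complex.I))
    · refine hnn.trans (integral_mono hi0 ((iU.const_mul _).sub (iV.const_mul _)) fun x => ?_)
      have := hsplit ((F (x + y * Complex.I)).re ^ 2) ((F (x + y * Complex.I)).im ^ 2)
        (by positivity) (by positivity)
      simp only [P0, add_zero, Real.zero_rpow (by linarith : q ≠ 0), sub_zero]
      linarith
    · exfalso
      apply hi0
      obtain ⟨A, hA, hA'⟩ := P0_bound hq hC0 (by linarith : 0 ≤ K)
      refine (integrable_W.const_mul (A * C0 ^ 2)).mono' ?_ (Eventually.of_forall fun x => ?_)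
      · have h1 : Continuous fun x : ℝ => ((F (x + y * Complex.I)).re ^ 2 +
            (F (x + y * Complex.I)).im ^ 2) ^ q :=
          Continuous.rpow_const ((cFre.pow 2).add (cFim.pow 2)) fun _ => Or.inr (by linarith)
        have h2 : Continuous fun x : ℝ => ((F (x + y * Complex.I)).im ^ 2) ^ q :=
          Continuous.rpow_const (cFim.pow 2) fun _ => Or.inr (by linarith)
        simp only [P0, add_zero, Real.zero_rpow (by linarith : q ≠ 0), sub_zero]
        exact (h1.sub (continuous_const.mul h2)).aestronglyMeasurable
      · refine (hA' 0 le_rfl zero_le_one _ (hbd1 x)).trans ?_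
        rw [mul_assoc, ← mul_pow]
        gcongr
        exact hbd' x
  have q0 : 0 ≤ q := by linarith
  simp only [enorm_rpow_eq q0]
  rw [← ofReal_integral_eq_lintegral_ofReal iV (Eventually.of_forall fun x => by positivity),
    ← ofReal_integral_eq_lintegral_ofReal iU (Eventually.of_forall fun x => by positivity),
    ← ENNReal.ofReal_mul (by positivity)]
  apply ENNReal.ofReal_le_ofReal
  rw [div_mul_eq_mul_div, le_div_iff₀ hd]
  linarith

lemma hilbert_real {p : ℝ} (hp : 2 < p) : ∃ C : ℝ, 0 ≤ C ∧ ∀ φ : ℝ → ℝ, Continuous φ →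
    HasCompactSupport φ → ∀ y : ℝ, 0 < y →
    ∫⁻ x : ℝ, ‖∫ s, φ s * ((x - s) / ((x - s) ^ 2 + y ^ 2))‖ₑ ^ p ≤
    ENNReal.ofReal C * ∫⁻ x : ℝ, ‖φ x‖ₑ ^ p := by
  obtain ⟨C, hC, h⟩ := hilbert_aux (q := p / 2) (by linarith)
  refine ⟨C * Real.pi ^ p, by positivity, fun φ hφ hs y hy => ?_⟩
  have h1 := h φ hφ hs y hy
  rw [mul_div_cancel₀ p two_ne_zero] at h1
  simp only [(norm_int_kernel hφ hs hy _).1, (norm_int_kernel hφ hs hy _).2] at h1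
  refine h1.trans ?_
  rw [ENNReal.ofReal_mul hC, mul_assoc, ← ENNReal.ofReal_rpow_of_nonneg Real.pi_pos.le (by linarith)]
  gcongr
  exact poisson_bound (by linarith) hφ hy

lemma hilbert_complex {p : ℝ} (hp : 2 < p) : ∃ C : ℝ≥0∞, C ≠ ⊤ ∧ ∀ φ : ℝ → ℂ, Continuous φ →
    HasCompactSupport φ → ∀ y : ℝ, 0 < y →
    ∫⁻ x : ℝ, ‖∫ r, φ (x - r) * ((r / (r ^ 2 + y ^ 2) : ℝ) : ℂ)‖ₑ ^ p ≤
    C * ∫⁻ x : ℝ, ‖φ x‖ₑ ^ p := by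
  obtain ⟨C, hC, h⟩ := hilbert_real hp
  refine ⟨2 ^ p * (ENNReal.ofReal C + ENNReal.ofReal C), by
    simp only [ne_eq, ENNReal.mul_eq_top, not_or, not_and_or]
    exact ⟨Or.inr (by simp), Or.inl (ENNReal.rpow_ne_top_of_nonneg (by linarith) (by simp))⟩,
    fun φ hφ hs y hy => ?_⟩
  have hp0 : 0 ≤ p := by linarith
  have hk : Continuous fun s : ℝ => s / (s ^ 2 + y ^ 2) :=
    Continuous.div (by fun_prop) (by fun_prop) fun s => by positivity
  have e : ∀ x : ℝ, (∫ r, φ (x - r) * ((r / (r ^ 2 + y ^ 2) : ℝ) : ℂ)) =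
      ((∫ s, (φ s).re * ((x - s) / ((x - s) ^ 2 + y ^ 2)) : ℝ) : ℂ) +
      ((∫ s, (φ s).im * ((x - s) / ((x - s) ^ 2 + y ^ 2)) : ℝ) : ℂ) * Complex.I := by
    intro x
    have hk' : Continuous fun s : ℝ => (x - s) / ((x - s) ^ 2 + y ^ 2) :=
      hk.comp (continuous_const.sub continuous_id)
    have i : Integrable fun s => φ s * (((x - s) / ((x - s) ^ 2 + y ^ 2) : ℝ) : ℂ) := by
      apply Continuous.integrable_of_hasCompactSupport
      · fun_prop
      · exact hs.mul_right
    have e1 := integral_sub_left_eq_self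
      (fun r => φ (x - r) * ((r / (r ^ 2 + y ^ 2) : ℝ) : ℂ)) volume x
    simp only [_root_.sub_sub_cancel] at e1
    rw [← e1]
    rw [← Complex.re_add_im (∫ s, φ s * (((x - s) / ((x - s) ^ 2 + y ^ 2) : ℝ) : ℂ))]
    congr 2
    · congr 1
      rw [← Complex.reCLM_apply, ← Complex.reCLM.integral_comp_comm i]
      congr 1; ext s
      rw [Complex.reCLM_apply, Complex.re_mul_ofReal]
    · congr 1
      rw [← Complex.imCLM_apply, ← Complex.imCLM.integral_comp_comm i]
      congr 1; ext s
      rw [Complex.imCLM_apply, Complex.im_mul_ofReal]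
  have hre := h (fun s => (φ s).re) (by fun_prop) (hs.comp_left (g := Complex.re) rfl) y hy
  have him := h (fun s => (φ s).im) (by fun_prop) (hs.comp_left (g := Complex.im) rfl) y hy
  have key : ∀ a b : ℝ, ‖(a : ℂ) + b * Complex.I‖ₑ ^ p ≤ 2 ^ p * (‖a‖ₑ ^ p + ‖b‖ₑ ^ p) := by
    intro a b
    have h1 : ‖(a : ℂ) + b * Complex.I‖ₑ ≤ ‖a‖ₑ + ‖b‖ₑ := by
      refine (enorm_add_le _ _).trans (le_of_eq ?_)
      simp [enorm_eq_nnnorm]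
    have h2 : ‖a‖ₑ + ‖b‖ₑ ≤ 2 * max ‖a‖ₑ ‖b‖ₑ := by
      rw [two_mul]; exact add_le_add (le_max_left _ _) (le_max_right _ _)
    refine (ENNReal.rpow_le_rpow (h1.trans h2) hp0).trans ?_
    rw [ENNReal.mul_rpow_of_nonneg _ _ hp0]
    gcongr
    rcases max_choice ‖a‖ₑ ‖b‖ₑ with h | h <;> rw [h]
    · exact le_self_add
    · exact le_add_self
  have mre : Measurable fun x : ℝ => ∫ s, (φ s).re * ((x - s) / ((x - s) ^ 2 + y ^ 2)) := by
    have : Continuous (Function.uncurry fun (x s : ℝ) =>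
        (φ s).re * ((x - s) / ((x - s) ^ 2 + y ^ 2))) := by
      have := hk.comp (continuous_fst.sub (continuous_snd (X := ℝ) (Y := ℝ)))
      exact (by fun_prop : Continuous fun z : ℝ × ℝ => (φ z.2).re).mul this
    exact this.stronglyMeasurable.integral_prod_right.measurable
  calc ∫⁻ x : ℝ, ‖∫ r, φ (x - r) * ((r / (r ^ 2 + y ^ 2) : ℝ) : ℂ)‖ₑ ^ p
      ≤ ∫⁻ x : ℝ, 2 ^ p * (‖∫ s, (φ s).re * ((x - s) / ((x - s) ^ 2 + y ^ 2))‖ₑ ^ p +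
        ‖∫ s, (φ s).im * ((x - s) / ((x - s) ^ 2 + y ^ 2))‖ₑ ^ p) := by
        refine lintegral_mono fun x => ?_
        simp only
        rw [e]; exact key _ _
    _ = 2 ^ p * ((∫⁻ x : ℝ, ‖∫ s, (φ s).re * ((x - s) / ((x - s) ^ 2 + y ^ 2))‖ₑ ^ p) +
        ∫⁻ x : ℝ, ‖∫ s, (φ s).im * ((x - s) / ((x - s) ^ 2 + y ^ 2))‖ₑ ^ p) := by
        rw [lintegral_const_mul' _ _ (ENNReal.rpow_ne_top_of_nonneg hp0 (by simp)),
          lintegral_add_left (mre.enorm.pow_const p)]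
    _ ≤ 2 ^ p * (ENNReal.ofReal C * (∫⁻ x : ℝ, ‖φ x‖ₑ ^ p) +
        ENNReal.ofReal C * ∫⁻ x : ℝ, ‖φ x‖ₑ ^ p) := by
        gcongr
        · refine hre.trans ?_
          gcongr with x
          rw [enorm_le_iff_norm_le]
          exact Complex.abs_re_le_norm _
        · refine him.trans ?_
          gcongr with x
          rw [enorm_le_iff_norm_le]
          exact Complex.abs_im_le_norm _
    _ = _ := by ring

end CTW

namespace CTW
open Filter Topology

/-- The truncated kernel of the odd singular integral operator. -/
noncomputable def kk (ε : ℝ) (w : ℂ) : ℂ :=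
  (starRingEnd ℂ) w * ((‖w‖ * (‖w‖ ^ 2 + ε ^ 2) : ℝ) : ℂ)⁻¹

lemma measurable_kk (ε : ℝ) : Measurable (kk ε) := by
  unfold kk
  have : Measurable (starRingEnd ℂ) := Complex.continuous_conj.measurable
  fun_prop

lemma kk_neg (ε : ℝ) (w : ℂ) : kk ε (-w) = -kk ε w := by
  simp [kk]

lemma norm_kk_le (ε : ℝ) (w : ℂ) : ‖kk ε w‖ ≤ (‖w‖ ^ 2 + ε ^ 2)⁻¹ := by
  unfold kk
  rw [norm_mul, norm_inv, Complex.norm_real, RCLike.norm_conj, Real.norm_of_nonneg (by positivity),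
    mul_inv, ← mul_assoc]
  refine mul_le_of_le_one_left (by positivity) ?_
  exact mul_inv_le_one

lemma kk_polar (ε r θ : ℝ) (hr : 0 < r) :
    (r : ℂ) * kk ε (r * Complex.exp (θ * Complex.I)) =
      Complex.exp (-(θ * Complex.I)) * ((r / (r ^ 2 + ε ^ 2) : ℝ) : ℂ) := by
  unfold kk
  have h1 : ‖(r : ℂ) * Complex.exp (θ * Complex.I)‖ = r := by
    rw [norm_mul, Complex.norm_exp_ofReal_mul_I, Complex.norm_real, mul_one,
      Real.norm_of_nonneg hr.le]
  rw [h1, map_mul, Complex.conj_ofReal, ← Complex.exp_conj, map_mul, Complex.conj_ofReal,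
    Complex.conj_I, mul_neg]
  push_cast
  have h2 : (r : ℂ) ≠ 0 := by exact_mod_cast hr.ne'
  have h3 : (r : ℂ) ^ 2 + (ε : ℂ) ^ 2 ≠ 0 := by
    have : r ^ 2 + ε ^ 2 ≠ 0 := by positivity
    exact_mod_cast this
  field_simp

/-- The radial Hilbert-type integrand. -/
noncomputable def hk (ε r : ℝ) : ℂ := ((r / (r ^ 2 + ε ^ 2) : ℝ) : ℂ)

lemma continuous_hk {ε : ℝ} (hε : 0 < ε) : Continuous (hk ε) := by
  unfold hk
  exact Complex.continuous_ofReal.comp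
    (Continuous.div (by fun_prop) (by fun_prop) fun s => by positivity)

lemma hk_neg (ε r : ℝ) : hk ε (-r) = -hk ε r := by
  simp [hk, neg_div]

lemma polar_half {Φ : ℂ → ℂ} (hΦ : Continuous Φ) (hs : HasCompactSupport Φ) {ε : ℝ} (hε : 0 < ε) :
    IntegrableOn (fun θ : ℝ => ∫ r in Ioi (0 : ℝ), Complex.exp (-(θ * Complex.I)) *
      (Φ (r * Complex.exp (θ * Complex.I)) * hk ε r)) (Ioo (-Real.pi) Real.pi) ∧
    ∫ w, Φ w * kk ε w = ∫ θ in Ioo (-Real.pi) Real.pi, ∫ r in Ioi (0 : ℝ),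
      Complex.exp (-(θ * Complex.I)) * (Φ (r * Complex.exp (θ * Complex.I)) * hk ε r) := by
  obtain ⟨R, hR0, hR⟩ : ∃ R, 0 < R ∧ ∀ s, Φ s ≠ 0 → ‖s‖ ≤ R := by
    obtain ⟨R, hR⟩ := hs.isCompact.isBounded.exists_pos_norm_le
    exact ⟨R, hR.1, fun s h => hR.2 s (subset_tsupport _ h)⟩
  set G : ℝ × ℝ → ℂ := fun z => Complex.exp (-(z.2 * Complex.I)) *
      (Φ (z.1 * Complex.exp (z.2 * Complex.I)) * hk ε z.1) with hG
  have cG : Continuous G := by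
    have := continuous_hk hε
    fun_prop
  have iG : Integrable G (((volume : Measure ℝ).restrict (Ioi 0)).prod
      ((volume : Measure ℝ).restrict (Ioo (-Real.pi) Real.pi))) := by
    rw [Measure.prod_restrict]
    have h1 : IntegrableOn G (Icc 0 R ×ˢ Icc (-Real.pi) Real.pi) (volume.prod volume) :=
      cG.continuousOn.integrableOn_compact (isCompact_Icc.prod isCompact_Icc)
    refine h1.of_forall_sdiff_eq_zero (measurableSet_Ioi.prod measurableSet_Ioo) ?_
    rintro ⟨r, θ⟩ ⟨⟨hr, hθ⟩, hn⟩
    simp only [mem_Ioi] at hr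
    have hrR : R < r := by
      by_contra hle
      push Not at hle
      exact hn ⟨⟨le_of_lt hr, hle⟩, ⟨hθ.1.le, hθ.2.le⟩⟩
    have h0 : Φ (r * Complex.exp (θ * Complex.I)) = 0 := by
      by_contra hne
      have := hR _ hne
      rw [norm_mul, Complex.norm_exp_ofReal_mul_I, Complex.norm_real, mul_one,
        Real.norm_of_nonneg (le_of_lt hr)] at this
      linarith
    simp [hG, h0]
  refine ⟨iG.integral_prod_right, ?_⟩
  rw [← Complex.integral_comp_polarCoord_symm, ← integral_prod_symm G iG, Measure.prod_restrict]
  refine setIntegral_congr_fun (measurableSet_Ioi.prod measurableSet_Ioo) ?_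
  rintro ⟨r, θ⟩ ⟨hr, hθ⟩
  simp only [mem_Ioi] at hr
  have e : (Complex.polarCoord.symm (r, θ) : ℂ) = r * Complex.exp (θ * Complex.I) := by
    rw [Complex.polarCoord_symm_apply, Complex.exp_mul_I, Complex.ofReal_cos, Complex.ofReal_sin]
  have := kk_polar ε r θ hr
  simp only [e, hG, hk, Complex.real_smul]
  linear_combination Φ (r * Complex.exp (θ * Complex.I)) * this

lemma polar_odd {Φ : ℂ → ℂ} (hΦ : Continuous Φ) (hs : HasCompactSupport Φ) {ε : ℝ} (hε : 0 < ε) :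
    2 * ∫ w, Φ w * kk ε w = ∫ θ in Ioo (-Real.pi) Real.pi,
      Complex.exp (-(θ * Complex.I)) * ∫ r : ℝ, Φ (r * Complex.exp (θ * Complex.I)) * hk ε r := by
  obtain ⟨i1, e1⟩ := polar_half hΦ hs hε
  have hs' : HasCompactSupport fun w => Φ (-w) := hs.comp_homeomorph (Homeomorph.neg ℂ)
  obtain ⟨i2, e2⟩ := polar_half (Φ := fun w => Φ (-w)) (by fun_prop) hs' hε
  have e3 : ∫ w, Φ (-w) * kk ε w = -∫ w, Φ w * kk ε w := by
    rw [← integral_neg_eq_self (fun w => Φ w * kk ε w), ← integral_neg]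
    congr 1; ext w
    rw [kk_neg]; ring
  rw [e3] at e2
  have : 2 * ∫ w, Φ w * kk ε w = (∫ w, Φ w * kk ε w) - (-∫ w, Φ w * kk ε w) := by ring
  rw [this, e2, e1, ← integral_sub i1 i2]
  refine integral_congr_ae (Eventually.of_forall fun θ => ?_)
  simp only
  have hc : Continuous fun r : ℝ => Φ (r * Complex.exp (θ * Complex.I)) * hk ε r := by
    have := continuous_hk hε
    fun_prop
  have hcs : Integrable fun r : ℝ => Φ (r * Complex.exp (θ * Complex.I)) * hk ε r := by
    apply hc.integrable_of_hasCompactSupport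
    have : IsClosedEmbedding fun r : ℝ => (r : ℂ) * Complex.exp (θ * Complex.I) :=
      (Homeomorph.mulRight₀ _ (Complex.exp_ne_zero (θ * Complex.I))).isClosedEmbedding.comp
        Complex.isometry_ofReal.isClosedEmbedding
    exact (hs.comp_isClosedEmbedding this).mul_right
  rw [← intervalIntegral.integral_Iic_add_Ioi (b := 0) hcs.integrableOn hcs.integrableOn]
  have e4 := integral_comp_neg_Ioi 0 (fun r : ℝ => Φ (r * Complex.exp (θ * Complex.I)) * hk ε r)
  rw [neg_zero] at e4
  rw [← e4, integral_const_mul, integral_const_mul, ← mul_sub]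
  congr 1
  have e5 : ∫ r in Ioi (0 : ℝ), Φ (((-r : ℝ) : ℂ) * Complex.exp (θ * Complex.I)) * hk ε (-r) =
      -∫ r in Ioi (0 : ℝ), Φ (-(r * Complex.exp (θ * Complex.I))) * hk ε r := by
    rw [← integral_neg]
    congr 1; ext r
    rw [hk_neg, Complex.ofReal_neg, neg_mul, mul_neg]
  rw [e5]
  ring

lemma lintegral_complex_eq (f : ℂ → ℝ≥0∞) (hf : Measurable f) :
    ∫⁻ z, f z = ∫⁻ y : ℝ, ∫⁻ x : ℝ, f (x + y * Complex.I) := by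
  rw [← (Complex.volume_preserving_equiv_real_prod.symm).lintegral_comp_emb
    Complex.measurableEquivRealProd.symm.measurableEmbedding, Measure.volume_eq_prod,
    lintegral_prod_symm]
  · refine lintegral_congr fun y => lintegral_congr fun x => ?_
    congr 1
    rw [Complex.measurableEquivRealProd_symm_apply, Complex.mk_eq_add_mul_I]
  · exact (hf.comp Complex.measurableEquivRealProd.symm.measurable).aemeasurable

lemma lintegral_rot (f : ℂ → ℝ≥0∞) (θ : ℝ) :
    ∫⁻ z, f (Complex.exp (θ * Complex.I) * z) = ∫⁻ z, f z := by
  have h := (rotation (Circle.exp θ)).measurePreserving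
  rw [← h.lintegral_comp_emb (rotation (Circle.exp θ)).toHomeomorph.measurableEmbedding f]
  simp [rotation_apply]

lemma line_bound {p : ℝ} (hp : 2 < p) : ∃ C : ℝ≥0∞, C ≠ ⊤ ∧ ∀ g : ℂ → ℂ, Continuous g →
    HasCompactSupport g → ∀ ε : ℝ, 0 < ε → ∀ θ : ℝ,
    ∫⁻ z : ℂ, ‖∫ r : ℝ, g (z - r * Complex.exp (θ * Complex.I)) * hk ε r‖ₑ ^ p ≤
    C * ∫⁻ z, ‖g z‖ₑ ^ p := by
  obtain ⟨C, hC, h⟩ := hilbert_complex hp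
  refine ⟨C, hC, fun g hg hs ε hε θ => ?_⟩
  have chk := continuous_hk hε
  set e := Complex.exp (θ * Complex.I) with he
  have he0 : e ≠ 0 := Complex.exp_ne_zero _
  set G : ℂ → ℂ := fun z => g (e * z) with hG
  have cG : Continuous G := by fun_prop
  have sG : HasCompactSupport G := hs.comp_homeomorph (Homeomorph.mulLeft₀ e he0)
  have m1 : Measurable fun z : ℂ => ‖∫ r : ℝ, G (z - r) * hk ε r‖ₑ ^ p := by
    have : Continuous (Function.uncurry fun (z : ℂ) (r : ℝ) => G (z - r) * hk ε r) := by
      simp only [Function.uncurry_def]; fun_prop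
    exact this.stronglyMeasurable.integral_prod_right.measurable.enorm.pow_const p
  have m2 : Measurable fun z : ℂ => ‖G z‖ₑ ^ p := cG.measurable.enorm.pow_const p
  calc ∫⁻ z : ℂ, ‖∫ r : ℝ, g (z - r * e) * hk ε r‖ₑ ^ p
      = ∫⁻ z : ℂ, ‖∫ r : ℝ, G (z - r) * hk ε r‖ₑ ^ p := by
        rw [← lintegral_rot _ θ]
        refine lintegral_congr fun z => ?_
        congr 2
        refine integral_congr_ae (Eventually.of_forall fun r => ?_)
        simp only [hG, ← he]
        congr 2; ring
    _ = ∫⁻ y : ℝ, ∫⁻ x : ℝ, ‖∫ r : ℝ, G (x + y * Complex.I - r) * hk ε r‖ₑ ^ p :=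
        lintegral_complex_eq _ m1
    _ ≤ ∫⁻ y : ℝ, C * ∫⁻ x : ℝ, ‖G (x + y * Complex.I)‖ₑ ^ p := by
        refine lintegral_mono fun y => ?_
        have hcl : IsClosedEmbedding fun x : ℝ => (x : ℂ) + y * Complex.I :=
          (Homeomorph.addRight ((y : ℂ) * Complex.I)).isClosedEmbedding.comp
            Complex.isometry_ofReal.isClosedEmbedding
        have := h (fun x => G (x + y * Complex.I)) (by fun_prop)
          (sG.comp_isClosedEmbedding hcl) ε hε
        refine le_trans (le_of_eq ?_) this
        refine lintegral_congr fun x => ?_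
        congr 2
        refine integral_congr_ae (Eventually.of_forall fun r => ?_)
        simp only [hk]
        congr 2
        push_cast; ring
    _ = C * ∫⁻ z : ℂ, ‖G z‖ₑ ^ p := by
        rw [lintegral_const_mul' _ _ hC, lintegral_complex_eq _ m2]
    _ = C * ∫⁻ z : ℂ, ‖g z‖ₑ ^ p := by
        rw [← lintegral_rot (fun z => ‖g z‖ₑ ^ p) θ]

/-- Uniform `L^p` bound for the truncated operators on continuous compactly supported functions. -/
lemma kk_bound_cc {p : ℝ} (hp : 2 < p) : ∃ C : ℝ≥0∞, C ≠ ⊤ ∧ ∀ g : ℂ → ℂ, Continuous g →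
    HasCompactSupport g → ∀ ε : ℝ, 0 < ε →
    ∫⁻ z : ℂ, ‖∫ w, g (z - w) * kk ε w‖ₑ ^ p ≤ C * ∫⁻ z, ‖g z‖ₑ ^ p := by
  obtain ⟨C, hC, h⟩ := line_bound hp
  have hp0 : 0 ≤ p := by linarith
  refine ⟨ENNReal.ofReal (2 * Real.pi) ^ p * C, ENNReal.mul_ne_top
    (ENNReal.rpow_ne_top_of_nonneg hp0 ENNReal.ofReal_ne_top) hC, fun g hg hs ε hε => ?_⟩
  have chk := continuous_hk hε
  have hsch := schur (μ := (volume : Measure ℂ))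
    (ν := (volume : Measure ℝ).restrict (Ioo (-Real.pi) Real.pi)) (p := p) (by linarith)
    (h := fun θ z => ‖∫ r : ℝ, g (z - r * Complex.exp (θ * Complex.I)) * hk ε r‖ₑ)
    (k := fun _ => 1) ?_ (by fun_prop) (B := C * ∫⁻ z, ‖g z‖ₑ ^ p) (h g hg hs ε hε)
  · have e1 : ∫⁻ _ in Ioo (-Real.pi) Real.pi, (1 : ℝ≥0∞) = ENNReal.ofReal (2 * Real.pi) := by
      rw [setLIntegral_one, Real.volume_Ioo]
      congr 1; ring
    rw [e1, ← mul_assoc] at hsch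
    refine le_trans (lintegral_mono fun z => ?_) hsch
    refine ENNReal.rpow_le_rpow ?_ hp0
    have cz : HasCompactSupport fun w => g (z - w) :=
      hs.comp_homeomorph (Homeomorph.subLeft z)
    have hpol := polar_odd (Φ := fun w => g (z - w)) (by fun_prop) cz hε
    have e2 : ‖∫ w, g (z - w) * kk ε w‖ₑ ≤ ‖2 * ∫ w, g (z - w) * kk ε w‖ₑ := by
      rw [enorm_le_iff_norm_le, norm_mul]
      norm_num
      linarith [norm_nonneg (∫ w, g (z - w) * kk ε w)]
    refine e2.trans ?_
    rw [hpol]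
    refine (enorm_integral_le_lintegral_enorm _).trans (lintegral_mono fun θ => ?_)
    simp only
    rw [enorm_mul, mul_one]
    have : ‖Complex.exp (-(θ * Complex.I))‖ₑ = 1 := by
      have : ‖Complex.exp (-(θ * Complex.I))‖ = 1 := by
        have := Complex.norm_exp_ofReal_mul_I (-θ)
        rwa [Complex.ofReal_neg, neg_mul] at this
      rw [← ofReal_norm, this, ENNReal.ofReal_one]
    rw [this, one_mul]
  · have : Continuous (Function.uncurry fun (x : ℝ × ℂ) (r : ℝ) =>
        g (x.2 - r * Complex.exp (x.1 * Complex.I)) * hk ε r) := by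
      simp only [Function.uncurry_def]; fun_prop
    exact this.stronglyMeasurable.integral_prod_right.measurable.enorm

end CTW

namespace CTW
open Filter Topology

lemma eLpNorm_rpow {α E : Type*} [MeasurableSpace α] [NormedAddCommGroup E] {μ : Measure α} {p : ℝ}
    (hp : 0 < p) (f : α → E) : eLpNorm f (ENNReal.ofReal p) μ ^ p = ∫⁻ x, ‖f x‖ₑ ^ p ∂μ := by
  rw [eLpNorm_eq_lintegral_rpow_enorm_toReal (by simpa using hp) ENNReal.ofReal_ne_top,
    ENNReal.toReal_ofReal hp.le, ← ENNReal.rpow_mul, one_div_mul_cancel hp.ne', ENNReal.rpow_one]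

lemma eLpNorm_le_of_rpow {α β E F : Type*} [MeasurableSpace α] [MeasurableSpace β]
    [NormedAddCommGroup E] [NormedAddCommGroup F]
    {μ : Measure α} {ν : Measure β} {p : ℝ}
    (hp : 0 < p) {f : α → E} {g : β → F} {C : ℝ≥0∞}
    (h : ∫⁻ x, ‖f x‖ₑ ^ p ∂μ ≤ C * ∫⁻ x, ‖g x‖ₑ ^ p ∂ν) :
    eLpNorm f (ENNReal.ofReal p) μ ≤ C ^ (1 / p) * eLpNorm g (ENNReal.ofReal p) ν := by
  rw [← ENNReal.rpow_le_rpow_iff hp, ENNReal.mul_rpow_of_nonneg _ _ hp.le, eLpNorm_rpow hp,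
    eLpNorm_rpow hp, ← ENNReal.rpow_mul, one_div_mul_cancel hp.ne', ENNReal.rpow_one]
  exact h

lemma holder_enorm {α : Type*} [MeasurableSpace α] {μ : Measure α} {p : ℝ} (hp : 1 < p)
    {f g : α → ℂ} (hf : AEStronglyMeasurable f μ) (hg : AEStronglyMeasurable g μ) :
    ∫⁻ x, ‖f x * g x‖ₑ ∂μ ≤
      eLpNorm f (ENNReal.ofReal p) μ * eLpNorm g (ENNReal.ofReal (p / (p - 1))) μ := by
  have hpq : p.HolderConjugate (p / (p - 1)) := Real.HolderConjugate.conjExponent hp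
  have := hpq.ennrealOfReal
  have h := eLpNorm_smul_le_mul_eLpNorm (p := ENNReal.ofReal p)
    (q := ENNReal.ofReal (p / (p - 1))) (r := 1) hg hf (μ := μ)
  rwa [eLpNorm_one_eq_lintegral_enorm] at h

lemma holder_integrable {α : Type*} [MeasurableSpace α] {μ : Measure α} {p : ℝ} (hp : 1 < p)
    {f g : α → ℂ} (hf : MemLp f (ENNReal.ofReal p) μ)
    (hg : MemLp g (ENNReal.ofReal (p / (p - 1))) μ) : Integrable (fun x => f x * g x) μ := by
  have hpq : p.HolderConjugate (p / (p - 1)) := Real.HolderConjugate.conjExponent hp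
  have := hpq.ennrealOfReal
  exact hf.integrable_mul hg

lemma eLpNorm_sub_left {p : ℝ≥0∞} {f : ℂ → ℂ} (hf : AEStronglyMeasurable f volume) (z : ℂ) :
    eLpNorm (fun w => f (z - w)) p volume = eLpNorm f p volume :=
  eLpNorm_comp_measurePreserving hf (Measure.measurePreserving_sub_left volume z)

lemma memLp_sub_left {p : ℝ≥0∞} {f : ℂ → ℂ} (hf : MemLp f p volume) (z : ℂ) :
    MemLp (fun w => f (z - w)) p volume :=
  hf.comp_measurePreserving (Measure.measurePreserving_sub_left volume z)

lemma memLp_kk {ε : ℝ} (hε : 0 < ε) {s : ℝ} (hs : 1 < s) :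
    MemLp (kk ε) (ENNReal.ofReal s) volume := by
  set A : ℝ := 2 * (1 + (ε ^ 2)⁻¹) with hA
  have hA0 : 0 < A := by positivity
  have hs0 : 0 < s := by linarith
  have hb : ∀ w, ‖kk ε w‖ ≤ A * (1 + ‖w‖) ^ (-2 : ℝ) := by
    intro w
    refine (norm_kk_le ε w).trans ?_
    have e : (1 + ‖w‖) ^ (-2 : ℝ) = ((1 + ‖w‖) ^ 2)⁻¹ := by
      rw [Real.rpow_neg (by positivity)]; norm_num
    rw [e, ← div_eq_mul_inv, inv_le_iff_one_le_mul₀ (by positivity), div_mul_eq_mul_div,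
      one_le_div (by positivity), hA]
    have h1 : 2 * (1 + (ε ^ 2)⁻¹) * (‖w‖ ^ 2 + ε ^ 2) =
      2 * (1 + ‖w‖ ^ 2) + 2 * ε ^ 2 + 2 * (ε ^ 2)⁻¹ * ‖w‖ ^ 2 := by field_simp; ring
    have h2 : 0 ≤ 2 * ε ^ 2 + 2 * (ε ^ 2)⁻¹ * ‖w‖ ^ 2 := by positivity
    nlinarith [sq_nonneg (1 - ‖w‖)]
  refine ⟨(measurable_kk ε).aestronglyMeasurable, ?_⟩
  rw [eLpNorm_lt_top_iff_lintegral_rpow_enorm_lt_top (by simpa using hs0) ENNReal.ofReal_ne_top,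
    ENNReal.toReal_ofReal hs0.le]
  have hfin := finite_integral_one_add_norm (E := ℂ) (μ := volume) (r := 2 * s)
    (by rw [Complex.finrank_real_complex]; push_cast; linarith)
  refine lt_of_le_of_lt ?_ (ENNReal.mul_lt_top (ENNReal.ofReal_lt_top (r := A ^ s)) hfin)
  rw [← lintegral_const_mul' _ _ ENNReal.ofReal_ne_top]
  refine lintegral_mono fun w => ?_
  simp only
  rw [← ofReal_norm, ENNReal.ofReal_rpow_of_nonneg (norm_nonneg _) hs0.le,
    ← ENNReal.ofReal_mul (by positivity)]
  apply ENNReal.ofReal_le_ofReal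
  refine (Real.rpow_le_rpow (norm_nonneg _) (hb w) hs0.le).trans (le_of_eq ?_)
  rw [Real.mul_rpow hA0.le (by positivity), ← Real.rpow_mul (by positivity)]
  congr 2; ring

/-- Uniform `L^p` bound for the truncated operators. -/
lemma kk_bound {p : ℝ} (hp : 2 < p) : ∃ C : ℝ≥0∞, C ≠ ⊤ ∧ ∀ G : ℂ → ℂ,
    MemLp G (ENNReal.ofReal p) volume → ∀ ε : ℝ, 0 < ε →
    eLpNorm (fun z => ∫ w, G (z - w) * kk ε w) (ENNReal.ofReal p) volume ≤
      C * eLpNorm G (ENNReal.ofReal p) volume := by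
  obtain ⟨C, hC, h⟩ := kk_bound_cc hp
  have hp0 : 0 < p := by linarith
  have hp1 : 1 < p := by linarith
  have hp' : 1 < p / (p - 1) := by rw [one_lt_div (by linarith)]; linarith
  have hone : 1 ≤ ENNReal.ofReal p := by simpa using hp1.le
  set C1 := C ^ (1 / p) with hC1
  have hC1t : C1 ≠ ⊤ := ENNReal.rpow_ne_top_of_nonneg (by positivity) hC
  refine ⟨C1, hC1t, fun G hG ε hε => ?_⟩
  have hkk := memLp_kk hε hp'
  set K := eLpNorm (kk ε) (ENNReal.ofReal (p / (p - 1))) volume with hK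
  have hKt : K ≠ ⊤ := hkk.eLpNorm_ne_top
  choose g hg1 hg2 hg3 hg4 using fun n : ℕ => hG.exists_hasCompactSupport_eLpNorm_sub_le
    ENNReal.ofReal_ne_top (ε := ((n : ℝ≥0∞) + 1)⁻¹) (by simp)
  have hlim0 : Tendsto (fun n : ℕ => ((n : ℝ≥0∞) + 1)⁻¹) atTop (𝓝 0) := by
    have := ENNReal.tendsto_inv_nat_nhds_zero.comp (tendsto_add_atTop_nat 1)
    refine this.congr fun n => ?_
    simp
  have bound : ∀ n, eLpNorm (fun z => ∫ w, g n (z - w) * kk ε w) (ENNReal.ofReal p) volume ≤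
      C1 * (eLpNorm G (ENNReal.ofReal p) volume + ((n : ℝ≥0∞) + 1)⁻¹) := by
    intro n
    refine (eLpNorm_le_of_rpow hp0 (h (g n) (hg3 n) (hg1 n) ε hε)).trans ?_
    gcongr
    have e : g n = G - (G - g n) := by simp
    rw [e]
    refine (eLpNorm_sub_le hG.1 (hG.1.sub (hg4 n).1) hone).trans ?_
    gcongr
    exact hg2 n
  have ptw : ∀ z, Tendsto (fun n => ∫ w, g n (z - w) * kk ε w) atTop
      (𝓝 (∫ w, G (z - w) * kk ε w)) := by
    intro z
    rw [tendsto_iff_edist_tendsto_0]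
    have hz : Tendsto (fun n : ℕ => ((n : ℝ≥0∞) + 1)⁻¹ * K) atTop (𝓝 0) := by
      have := ENNReal.Tendsto.mul_const hlim0 (Or.inr hKt)
      simpa using this
    refine tendsto_of_tendsto_of_tendsto_of_le_of_le tendsto_const_nhds hz (fun _ => bot_le)
      fun n => ?_
    simp only
    rw [edist_comm, edist_eq_enorm_sub, ← integral_sub (holder_integrable hp1 (memLp_sub_left hG z) hkk)
      (holder_integrable hp1 (memLp_sub_left (hg4 n) z) hkk)]
    refine (enorm_integral_le_lintegral_enorm _).trans ?_
    simp only [← sub_mul]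
    refine (holder_enorm hp1 ((memLp_sub_left hG z).1.sub (memLp_sub_left (hg4 n) z).1) hkk.1).trans ?_
    gcongr
    have := eLpNorm_sub_left (p := ENNReal.ofReal p) (hG.1.sub (hg4 n).1) z
    exact (le_of_eq this).trans (hg2 n)
  have hmeas : ∀ n, AEStronglyMeasurable (fun z => ∫ w, g n (z - w) * kk ε w) volume := by
    intro n
    have : StronglyMeasurable (Function.uncurry fun (z w : ℂ) => g n (z - w) * kk ε w) := by
      have h1 : Continuous fun x : ℂ × ℂ => g n (x.1 - x.2) := (hg3 n).comp (by fun_prop)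
      have h2 : Measurable fun x : ℂ × ℂ => kk ε x.2 := (measurable_kk ε).comp measurable_snd
      exact (h1.measurable.mul h2).stronglyMeasurable
    exact this.integral_prod_right.aestronglyMeasurable
  have hfat := Lp.eLpNorm_lim_le_liminf_eLpNorm (p := ENNReal.ofReal p) hmeas _
    (Eventually.of_forall ptw)
  refine hfat.trans ?_
  have hl2 : Tendsto (fun n : ℕ => C1 * (eLpNorm G (ENNReal.ofReal p) volume +
      ((n : ℝ≥0∞) + 1)⁻¹)) atTop (𝓝 (C1 * eLpNorm G (ENNReal.ofReal p) volume)) := by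
    have := ENNReal.Tendsto.const_mul (a := C1)
      (hlim0.const_add (eLpNorm G (ENNReal.ofReal p) volume)) (Or.inr hC1t)
    simpa using this
  rw [← hl2.liminf_eq]
  exact liminf_le_liminf (Eventually.of_forall bound)

end CTW

namespace CTW
open Filter Topology

noncomputable def dz (f : ℂ → ℂ) (z : ℂ) : ℂ :=
  (1 / 2 : ℂ) * (fderiv ℝ f z 1 - Complex.I * fderiv ℝ f z Complex.I)
noncomputable def db (f : ℂ → ℂ) (z : ℂ) : ℂ :=
  (1 / 2 : ℂ) * (fderiv ℝ f z 1 + Complex.I * fderiv ℝ f z Complex.I)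

lemma dz_mul {f g : ℂ → ℂ} {z : ℂ} (hf : DifferentiableAt ℝ f z) (hg : DifferentiableAt ℝ g z) :
    dz (fun w => f w * g w) z = dz f z * g z + f z * dz g z := by
  have := (hf.hasFDerivAt.mul hg.hasFDerivAt).fderiv
  have h2 : fderiv ℝ (fun w => f w * g w) z = _ := this
  simp only [dz, h2, ContinuousLinearMap.add_apply, ContinuousLinearMap.smul_apply, smul_eq_mul]
  ring

lemma db_mul {f g : ℂ → ℂ} {z : ℂ} (hf : DifferentiableAt ℝ f z) (hg : DifferentiableAt ℝ g z) :
    db (fun w => f w * g w) z = db f z * g z + f z * db g z := by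
  have := (hf.hasFDerivAt.mul hg.hasFDerivAt).fderiv
  have h2 : fderiv ℝ (fun w => f w * g w) z = _ := this
  simp only [db, h2, ContinuousLinearMap.add_apply, ContinuousLinearMap.smul_apply, smul_eq_mul]
  ring

lemma fderiv_radial {φ : ℝ → ℝ} {φ' : ℝ} {z : ℂ} (h : HasDerivAt φ φ' (‖z‖ ^ 2)) (v : ℂ) :
    fderiv ℝ (fun w : ℂ => ((φ (‖w‖ ^ 2) : ℝ) : ℂ)) z v =
      ((φ' * (2 * (z.re * v.re + z.im * v.im)) : ℝ) : ℂ) := by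
  have h1 := (hasStrictFDerivAt_norm_sq z).hasFDerivAt
  have h2 := h.comp_hasFDerivAt z h1
  have h3 := Complex.ofRealCLM.hasFDerivAt.comp z h2
  have h4 : fderiv ℝ (fun w : ℂ => ((φ (‖w‖ ^ 2) : ℝ) : ℂ)) z = _ := h3.fderiv
  rw [h4]
  simp [Complex.inner]
  ring

lemma dz_radial {φ : ℝ → ℝ} {φ' : ℝ} {z : ℂ} (h : HasDerivAt φ φ' (‖z‖ ^ 2)) :
    dz (fun w : ℂ => ((φ (‖w‖ ^ 2) : ℝ) : ℂ)) z = φ' * (starRingEnd ℂ) z := by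
  simp only [dz, fderiv_radial h]
  apply Complex.ext <;> simp <;> ring

lemma db_radial {φ : ℝ → ℝ} {φ' : ℝ} {z : ℂ} (h : HasDerivAt φ φ' (‖z‖ ^ 2)) :
    db (fun w : ℂ => ((φ (‖w‖ ^ 2) : ℝ) : ℂ)) z = φ' * z := by
  simp only [db, fderiv_radial h]
  apply Complex.ext <;> simp <;> ring

lemma db_conj (z : ℂ) : db (fun w => (starRingEnd ℂ) w) z = 1 := by
  have h : fderiv ℝ (fun w : ℂ => (starRingEnd ℂ) w) z = Complex.conjCLE.toContinuousLinearMap :=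
    Complex.conjCLE.toContinuousLinearMap.hasFDerivAt.fderiv
  simp only [db, h]
  simp
  norm_num

lemma fderiv_cs (f : ℂ → ℂ) (z w : ℂ) :
    fderiv ℝ (fun v => f (z - v)) w = - fderiv ℝ f (z - w) := by
  have h1 := (ContinuousLinearEquiv.neg ℝ (M := ℂ)).comp_right_fderiv
    (f := fun v => f (z + v)) (x := w)
  have h2 := fderiv_comp_add_left (𝕜 := ℝ) (f := f) (x := -w) z
  have h3 : (fun v => f (z - v)) = (fun v => f (z + v)) ∘ (ContinuousLinearEquiv.neg ℝ (M := ℂ)) := by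
    ext v; simp [sub_eq_add_neg]
  rw [h3, h1]
  ext v
  simp [h2, ← sub_eq_add_neg]

lemma dz_comp_sub {f : ℂ → ℂ} (z w : ℂ) : dz (fun v => f (z - v)) w = - dz f (z - w) := by
  simp only [dz, fderiv_cs]
  simp
  ring

lemma db_comp_sub {f : ℂ → ℂ} (z w : ℂ) : db (fun v => f (z - v)) w = - db f (z - w) := by
  simp only [db, fderiv_cs]
  simp
  ring

lemma continuous_dz {f : ℂ → ℂ} (hf : ContDiff ℝ 1 f) : Continuous (dz f) := by
  have := hf.continuous_fderiv (by norm_num)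
  unfold dz
  fun_prop

lemma continuous_db {f : ℂ → ℂ} (hf : ContDiff ℝ 1 f) : Continuous (db f) := by
  have := hf.continuous_fderiv (by norm_num)
  unfold db
  fun_prop

lemma contDiff_dz {f : ℂ → ℂ} (hf : ContDiff ℝ (⊤ : ℕ∞) f) : ContDiff ℝ (⊤ : ℕ∞) (dz f) := by
  have : ContDiff ℝ (⊤ : ℕ∞) (fderiv ℝ f) := hf.fderiv_right (by simp)
  unfold dz
  fun_prop

lemma contDiff_db {f : ℂ → ℂ} (hf : ContDiff ℝ (⊤ : ℕ∞) f) : ContDiff ℝ (⊤ : ℕ∞) (db f) := by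
  have : ContDiff ℝ (⊤ : ℕ∞) (fderiv ℝ f) := hf.fderiv_right (by simp)
  unfold db
  fun_prop

lemma hcs_dz {f : ℂ → ℂ} (hf : HasCompactSupport f) : HasCompactSupport (dz f) := by
  refine (hf.fderiv (𝕜 := ℝ)).mono ?_
  intro z hz h0
  simp at hz
  exact hz (by simp [dz, h0])

lemma hcs_db {f : ℂ → ℂ} (hf : HasCompactSupport f) : HasCompactSupport (db f) := by
  refine (hf.fderiv (𝕜 := ℝ)).mono ?_
  intro z hz h0
  simp at hz
  exact hz (by simp [db, h0])

lemma dz_db_comm {f : ℂ → ℂ} (hf : ContDiff ℝ (⊤ : ℕ∞) f) (z : ℂ) : dz (db f) z = db (dz f) z := by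
  have h1 : ContDiff ℝ (⊤ : ℕ∞) (fderiv ℝ f) := hf.fderiv_right (by simp)
  have h2 : DifferentiableAt ℝ (fderiv ℝ f) z := (h1.differentiable (by simp)) z
  have hs : IsSymmSndFDerivAt ℝ f z := hf.contDiffAt.isSymmSndFDerivAt (by simp; exact WithTop.coe_le_coe.2 (le_top : (2:ℕ∞) ≤ ⊤))
  have hd : ∀ v, HasFDerivAt (fun z => fderiv ℝ f z v)
      ((fderiv ℝ (fderiv ℝ f) z).flip v) z := fun v => by
    have := h2.hasFDerivAt.clm_apply (hasFDerivAt_const v z)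
    simpa using this
  have e1 : fderiv ℝ (db f) z = (1/2 : ℂ) • ((fderiv ℝ (fderiv ℝ f) z).flip 1
      + Complex.I • (fderiv ℝ (fderiv ℝ f) z).flip Complex.I) :=
    (((hd 1).add ((hd Complex.I).const_mul Complex.I)).const_mul (1/2 : ℂ)).fderiv
  have e2 : fderiv ℝ (dz f) z = (1/2 : ℂ) • ((fderiv ℝ (fderiv ℝ f) z).flip 1
      - Complex.I • (fderiv ℝ (fderiv ℝ f) z).flip Complex.I) :=
    (((hd 1).sub ((hd Complex.I).const_mul Complex.I)).const_mul (1/2 : ℂ)).fderiv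
  have e3 := hs.eq 1 Complex.I
  simp only [dz, db] at *
  rw [e1, e2]
  simp
  rw [e3]
  ring

/-- integration by parts -/
lemma ibp_v {φ N : ℂ → ℂ} (hφ : ContDiff ℝ 1 φ) (hc : HasCompactSupport φ) (hN : ContDiff ℝ 1 N)
    (v : ℂ) : ∫ w, fderiv ℝ φ w v * N w = - ∫ w, φ w * fderiv ℝ N w v := by
  have c1 : Continuous fun w => fderiv ℝ φ w v := by
    have := hφ.continuous_fderiv (by norm_num); fun_prop
  have c2 : Continuous fun w => fderiv ℝ N w v := by
    have := hN.continuous_fderiv (by norm_num); fun_prop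
  have hc1 : HasCompactSupport fun w => fderiv ℝ φ w v := hc.fderiv_apply (𝕜 := ℝ) v
  have := integral_mul_fderiv_eq_neg_fderiv_mul_of_integrable (𝕜 := ℂ) (f := φ) (g := N) (v := v)
    (μ := volume)
    ((c1.mul hN.continuous).integrable_of_hasCompactSupport hc1.mul_right)
    ((hφ.continuous.mul c2).integrable_of_hasCompactSupport hc.mul_right)
    ((hφ.continuous.mul hN.continuous).integrable_of_hasCompactSupport hc.mul_right)
    (fun x _ => hφ.differentiable (by norm_num) x) (fun x _ => hN.differentiable (by norm_num) x)
  rw [this, neg_neg]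

lemma ibp_int {φ N : ℂ → ℂ} (hφ : ContDiff ℝ 1 φ) (hc : HasCompactSupport φ) (hN : ContDiff ℝ 1 N)
    (v : ℂ) : Integrable (fun w => fderiv ℝ φ w v * N w) ∧
      Integrable (fun w => φ w * fderiv ℝ N w v) := by
  have c1 : Continuous fun w => fderiv ℝ φ w v := by
    have := hφ.continuous_fderiv (by norm_num); fun_prop
  have c2 : Continuous fun w => fderiv ℝ N w v := by
    have := hN.continuous_fderiv (by norm_num); fun_prop
  have hc1 : HasCompactSupport fun w => fderiv ℝ φ w v := hc.fderiv_apply (𝕜 := ℝ) v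
  exact ⟨((c1.mul hN.continuous).integrable_of_hasCompactSupport hc1.mul_right),
    ((hφ.continuous.mul c2).integrable_of_hasCompactSupport hc.mul_right)⟩

lemma ibp_dz {φ N : ℂ → ℂ} (hφ : ContDiff ℝ 1 φ) (hc : HasCompactSupport φ) (hN : ContDiff ℝ 1 N) :
    ∫ w, dz φ w * N w = - ∫ w, φ w * dz N w := by
  have h1 := ibp_v hφ hc hN 1
  have h2 := ibp_v hφ hc hN Complex.I
  obtain ⟨i1, j1⟩ := ibp_int hφ hc hN 1
  obtain ⟨i2, j2⟩ := ibp_int hφ hc hN Complex.I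
  have e1 : ∀ w, dz φ w * N w = (1/2 : ℂ) * (fderiv ℝ φ w 1 * N w
      - Complex.I * (fderiv ℝ φ w Complex.I * N w)) := fun w => by simp only [dz]; ring
  have e2 : ∀ w, φ w * dz N w = (1/2 : ℂ) * (φ w * fderiv ℝ N w 1
      - Complex.I * (φ w * fderiv ℝ N w Complex.I)) := fun w => by simp only [dz]; ring
  simp only [e1, e2]
  rw [integral_const_mul, integral_const_mul, integral_sub i1 (i2.const_mul _),
    integral_sub j1 (j2.const_mul _), integral_const_mul, integral_const_mul, h1, h2]
  ring

lemma ibp_db {φ N : ℂ → ℂ} (hφ : ContDiff ℝ 1 φ) (hc : HasCompactSupport φ) (hN : ContDiff ℝ 1 N) :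
    ∫ w, db φ w * N w = - ∫ w, φ w * db N w := by
  have h1 := ibp_v hφ hc hN 1
  have h2 := ibp_v hφ hc hN Complex.I
  obtain ⟨i1, j1⟩ := ibp_int hφ hc hN 1
  obtain ⟨i2, j2⟩ := ibp_int hφ hc hN Complex.I
  have e1 : ∀ w, db φ w * N w = (1/2 : ℂ) * (fderiv ℝ φ w 1 * N w
      + Complex.I * (fderiv ℝ φ w Complex.I * N w)) := fun w => by simp only [db]; ring
  have e2 : ∀ w, φ w * db N w = (1/2 : ℂ) * (φ w * fderiv ℝ N w 1
      + Complex.I * (φ w * fderiv ℝ N w Complex.I)) := fun w => by simp only [db]; ring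
  simp only [e1, e2]
  rw [integral_const_mul, integral_const_mul, integral_add i1 (i2.const_mul _),
    integral_add j1 (j2.const_mul _), integral_const_mul, integral_const_mul, h1, h2]
  ring

lemma hcs_sub {φ : ℂ → ℂ} (hc : HasCompactSupport φ) (z : ℂ) :
    HasCompactSupport (fun w => φ (z - w)) :=
  hc.comp_homeomorph (Homeomorph.subLeft z)

lemma conv_dz {φ N : ℂ → ℂ} (hφ : ContDiff ℝ 1 φ) (hc : HasCompactSupport φ) (hN : ContDiff ℝ 1 N)
    (z : ℂ) : ∫ w, dz φ (z - w) * N w = ∫ w, φ (z - w) * dz N w := by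
  have h := ibp_dz (φ := fun w => φ (z - w)) (by fun_prop) (hcs_sub hc z) hN
  simp only [dz_comp_sub, neg_mul, integral_neg] at h
  exact neg_injective h

lemma conv_db {φ N : ℂ → ℂ} (hφ : ContDiff ℝ 1 φ) (hc : HasCompactSupport φ) (hN : ContDiff ℝ 1 N)
    (z : ℂ) : ∫ w, db φ (z - w) * N w = ∫ w, φ (z - w) * db N w := by
  have h := ibp_db (φ := fun w => φ (z - w)) (by fun_prop) (hcs_sub hc z) hN
  simp only [db_comp_sub, neg_mul, integral_neg] at h
  exact neg_injective h

/-- local integrability of `‖w‖ ^ (-a)`. -/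
lemma locInt_rpow {a : ℝ} (ha : a < 2) (c : ℂ) :
    LocallyIntegrable (fun w : ℂ => ‖w - c‖ ^ (-a)) := by
  have h0 : LocallyIntegrable (fun w : ℂ => ‖w‖ ^ (-a)) :=
    locallyIntegrable_of_norm_le_rpow (C := 1) (α := a) (by simp) (by simpa using ha)
      (Eventually.of_forall fun x => by
        rw [one_mul, Real.norm_of_nonneg (by positivity)])
      (by apply Measurable.aestronglyMeasurable; fun_prop)
  rw [locallyIntegrable_iff] at h0 ⊢
  intro K hK
  have hK' : IsCompact ((fun w : ℂ => w + c) ⁻¹' K) :=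
    (Homeomorph.addRight c).isCompact_preimage.2 hK
  have := h0 _ hK'
  have mp := measurePreserving_sub_right (volume : Measure ℂ) c
  have h3 := (mp.integrableOn_comp_preimage (f := fun w : ℂ => ‖w‖ ^ (-a))
    (MeasurableEquiv.subRight c).measurableEmbedding).2 this
  refine h3.mono_set ?_
  intro x hx
  simpa using hx

lemma intOn_rpow {a : ℝ} (ha : a < 2) (c : ℂ) {K : Set ℂ} (hK : IsCompact K) :
    IntegrableOn (fun w : ℂ => ‖w - c‖ ^ (-a)) K :=
  (locallyIntegrable_iff.1 (locInt_rpow ha c)) K hK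

lemma integrable_two_sing {a : ℝ} (ha1 : 1 < a) (ha : a < 2) :
    Integrable (fun t : ℂ => ‖t‖ ^ (-a) * ‖1 - t‖⁻¹) := by
  have i1 : Integrable ((closedBall (0:ℂ) 1).indicator (fun t : ℂ => 2 * ‖t‖ ^ (-a))) := by
    rw [integrable_indicator_iff isClosed_closedBall.measurableSet]
    have := intOn_rpow ha 0 (isCompact_closedBall (0:ℂ) 1)
    simp only [sub_zero] at this
    exact this.const_mul 2
  have i2 : Integrable ((closedBall (1:ℂ) 1).indicator (fun t : ℂ => 4 * ‖t - 1‖ ^ (-1:ℝ))) := by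
    rw [integrable_indicator_iff isClosed_closedBall.measurableSet]
    have := intOn_rpow (a := 1) (by norm_num) 1 (isCompact_closedBall (1:ℂ) 1)
    exact this.const_mul 4
  have i3 : Integrable (fun t : ℂ => 5 * 3 ^ a * (1 + ‖t‖) ^ (-(a + 1))) :=
    (integrable_one_add_norm (by simp; linarith)).const_mul _
  refine ((i1.add i2).add i3).mono' (by apply Measurable.aestronglyMeasurable; fun_prop) (Eventually.of_forall fun t => ?_)
  have hn1 : 0 ≤ (closedBall (0:ℂ) 1).indicator (fun t : ℂ => 2 * ‖t‖ ^ (-a)) t :=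
    indicator_nonneg (fun _ _ => by positivity) _
  have hn2 : 0 ≤ (closedBall (1:ℂ) 1).indicator (fun t : ℂ => 4 * ‖t - 1‖ ^ (-1:ℝ)) t :=
    indicator_nonneg (fun _ _ => by positivity) _
  have hn3 : 0 ≤ 5 * 3 ^ a * (1 + ‖t‖) ^ (-(a + 1)) := by positivity
  rw [Real.norm_of_nonneg (by positivity)]
  simp only [Pi.add_apply]
  have htri : 1 ≤ ‖t‖ + ‖1 - t‖ := by
    have := norm_add_le t (1 - t); simpa using this
  have htri2 : ‖t‖ ≤ 1 + ‖1 - t‖ := by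
    have := norm_sub_le 1 (1 - t); simpa using this
  rcases le_or_gt ‖t‖ (1/2) with h | h
  · rw [indicator_of_mem (by simp; linarith)]
    have : ‖1 - t‖⁻¹ ≤ 2 := by
      rw [inv_le_comm₀ (by linarith) (by norm_num)]; linarith
    have : ‖t‖ ^ (-a) * ‖1 - t‖⁻¹ ≤ ‖t‖ ^ (-a) * 2 := by gcongr
    linarith
  rcases le_or_gt ‖1 - t‖ (1/2) with h' | h'
  · rw [indicator_of_mem (s := closedBall (1:ℂ) 1) (by simp [dist_eq_norm_sub' t 1]; linarith)]
    have : ‖t‖ ^ (-a) ≤ 4 := by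
      calc ‖t‖ ^ (-a) ≤ (1/2) ^ (-a) :=
            Real.rpow_le_rpow_of_nonpos (by norm_num) h.le (by linarith)
        _ ≤ (1/2:ℝ) ^ (-2:ℝ) :=
            Real.rpow_le_rpow_of_exponent_ge (by norm_num) (by norm_num) (by linarith)
        _ = 4 := by rw [Real.rpow_neg (by norm_num)]; norm_num
    have e : ‖t - 1‖ ^ (-1:ℝ) = ‖1 - t‖⁻¹ := by rw [Real.rpow_neg_one, norm_sub_rev]
    have : ‖t‖ ^ (-a) * ‖1 - t‖⁻¹ ≤ 4 * ‖1 - t‖⁻¹ := by gcongr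
    rw [e]; linarith
  · have b1 : ‖t‖ ^ (-a) ≤ 3 ^ a * (1 + ‖t‖) ^ (-a) := by
      calc ‖t‖ ^ (-a) ≤ ((1 + ‖t‖) / 3) ^ (-a) :=
            Real.rpow_le_rpow_of_nonpos (by positivity) (by linarith) (by linarith)
        _ = _ := by
          rw [Real.div_rpow (by positivity) (by norm_num), Real.rpow_neg (by norm_num : (0:ℝ) ≤ 3)]
          field_simp
    have b2 : ‖1 - t‖⁻¹ ≤ 5 * (1 + ‖t‖)⁻¹ := by
      rw [← div_eq_mul_inv, le_div_iff₀ (by positivity), inv_mul_le_iff₀ (by linarith)]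
      linarith
    have : ‖t‖ ^ (-a) * ‖1 - t‖⁻¹ ≤ (3 ^ a * (1 + ‖t‖) ^ (-a)) * (5 * (1 + ‖t‖)⁻¹) := by gcongr
    have e : (1 + ‖t‖) ^ (-(a + 1)) = (1 + ‖t‖) ^ (-a) * (1 + ‖t‖)⁻¹ := by
      rw [neg_add, Real.rpow_add (by positivity), Real.rpow_neg_one]
    rw [e]; linarith

/-- products of a continuous compactly supported function with a translate of the inverse norm. -/
lemma integrable_cc_mul {ψ : ℂ → ℂ} (hψ : Continuous ψ) (hc : HasCompactSupport ψ) (z : ℂ) :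
    Integrable (fun w => ‖ψ (z - w)‖ * ‖w‖⁻¹) := by
  have h := locInt_rpow (a := 1) (by norm_num) 0
  simp only [sub_zero, Real.rpow_neg_one] at h
  have := h.integrable_smul_left_of_hasCompactSupport (g := fun w => ‖ψ (z - w)‖) (by fun_prop)
    (hcs_sub hc z).norm
  simpa using this

end CTW

namespace CTW
open Filter Topology

lemma map_mulLeft {y : ℂ} (hy : y ≠ 0) :
    Measure.map (fun t : ℂ => y * t) volume = ENNReal.ofReal ((‖y‖ ^ 2)⁻¹) • (volume : Measure ℂ) := by
  have hu : ‖y / (‖y‖ : ℂ)‖ = 1 := by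
    have : ‖y‖ ≠ 0 := by simpa using hy
    simp [this]
  let c : Circle := ⟨y / (‖y‖ : ℂ), by simpa [Submonoid.unitSphere] using hu⟩
  have e : (fun t : ℂ => y * t) = (fun t : ℂ => ‖y‖ • t) ∘ (rotation c) := by
    ext t
    have : (‖y‖ : ℂ) ≠ 0 := by simpa using hy
    have e : rotation c t = y / (‖y‖ : ℂ) * t := rfl
    simp only [Function.comp, e, Complex.real_smul]
    field_simp
  rw [e, ← Measure.map_map (by fun_prop) (by fun_prop),
    ((rotation c).measurePreserving).map_eq, Measure.map_addHaar_smul _ (by simpa using hy)]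
  simp

lemma integral_comp_mulLeft {y : ℂ} (hy : y ≠ 0) (F : ℂ → ℂ) :
    ∫ w, F w = ((‖y‖ ^ 2 : ℝ) : ℂ) * ∫ t, F (y * t) := by
  have h : ∫ t, F (y * t) = ∫ w, F w ∂(Measure.map (fun t : ℂ => y * t) volume) :=
    ((Homeomorph.mulLeft₀ y hy).measurableEmbedding.integral_map F).symm
  have : (‖y‖ : ℂ) ≠ 0 := by simpa using hy
  rw [h, map_mulLeft hy, integral_smul_measure, ENNReal.toReal_ofReal (by positivity)]
  simp
  field_simp

lemma lintegral_comp_mulLeft {y : ℂ} (hy : y ≠ 0) (F : ℂ → ℝ≥0∞) :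
    ∫⁻ t, F (y * t) = ENNReal.ofReal ((‖y‖ ^ 2)⁻¹) * ∫⁻ w, F w := by
  have h : ∫⁻ t, F (y * t) = ∫⁻ w, F w ∂(Measure.map (fun t : ℂ => y * t) volume) :=
    ((Homeomorph.mulLeft₀ y hy).measurableEmbedding.lintegral_map F).symm
  rw [h, map_mulLeft hy, lintegral_smul_measure, smul_eq_mul]

lemma integrable_comp_mulLeft {y : ℂ} (hy : y ≠ 0) {F : ℂ → ℂ} (hF : Integrable F) :
    Integrable (fun t => F (y * t)) := by
  have := (Homeomorph.mulLeft₀ y hy).measurableEmbedding.integrable_map_iff (μ := volume) (g := F)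
  refine this.1 ?_
  have e : Measure.map (⇑(Homeomorph.mulLeft₀ y hy)) volume = _ := map_mulLeft hy
  rw [e]
  exact hF.smul_measure ENNReal.ofReal_ne_top

lemma integral_bump : ∫ t : ℂ, ((((1 + ‖t‖ ^ 2) ^ 2)⁻¹ : ℝ)) = Real.pi := by
  rw [integral_fun_norm_addHaar volume (fun r : ℝ => ((1 + r ^ 2) ^ 2)⁻¹)]
  have h : ∫ y in Ioi (0:ℝ), y * ((1 + y ^ 2) ^ 2)⁻¹ = 0 - (-(1/2) * (1 + (0:ℝ) ^ 2)⁻¹) := by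
    apply integral_Ioi_of_hasDerivAt_of_nonneg' (g := fun y : ℝ => -(1/2) * (1 + y ^ 2)⁻¹)
    · intro x _
      have h0 : (1 + x ^ 2) ≠ 0 := by positivity
      have h1 := ((((hasDerivAt_pow 2 x).const_add 1).inv h0).const_mul (-(1/2)))
      refine h1.congr_deriv ?_
      simp
      field_simp
    · intro x hx
      have : (0:ℝ) < x := hx
      positivity
    · have : Tendsto (fun y : ℝ => (1 + y ^ 2)) atTop atTop :=
        tendsto_atTop_add_const_left _ _ (tendsto_pow_atTop (by norm_num))
      have h2 := (this.inv_tendsto_atTop).const_mul (-(1/2))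
      rw [mul_zero] at h2
      exact h2
  simp only [Complex.finrank_real_complex, smul_eq_mul]
  simp
  rw [h]
  simp [Measure.real, Complex.volume_ball]
  ring

lemma integrable_bump : Integrable (fun t : ℂ => ((((1 + ‖t‖ ^ 2) ^ 2)⁻¹ : ℝ))) := by
  by_contra h
  have := integral_bump
  rw [integral_undef h] at this
  exact Real.pi_ne_zero this.symm

noncomputable def ee (η : ℝ) (w : ℂ) : ℂ := (starRingEnd ℂ) w * (((‖w‖ ^ 2 + η ^ 2)⁻¹ : ℝ) : ℂ)

lemma contDiff_radial {φ : ℝ → ℝ} {n : WithTop ℕ∞} (h : ∀ x, 0 ≤ x → ContDiffAt ℝ n φ x) :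
    ContDiff ℝ n (fun w : ℂ => ((φ (‖w‖ ^ 2) : ℝ) : ℂ)) := by
  rw [contDiff_iff_contDiffAt]
  intro w
  have h1 : ContDiffAt ℝ n (fun w : ℂ => ‖w‖ ^ 2) w := (contDiff_norm_sq ℝ).contDiffAt
  have h2 : ContDiffAt ℝ n (fun w : ℂ => φ (‖w‖ ^ 2)) w :=
    (h (‖w‖ ^ 2) (by positivity)).comp w h1
  exact (Complex.ofRealCLM.contDiff.contDiffAt).comp w h2

lemma contDiff_conj {n : WithTop ℕ∞} : ContDiff ℝ n (fun w : ℂ => (starRingEnd ℂ) w) :=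
  Complex.conjCLE.toContinuousLinearMap.contDiff

lemma db_ee {η : ℝ} (hη : 0 < η) (w : ℂ) :
    ContDiff ℝ 1 (ee η) ∧ db (ee η) w = ((η ^ 2 * ((‖w‖ ^ 2 + η ^ 2) ^ 2)⁻¹ : ℝ) : ℂ) := by
  have c2 : ContDiff ℝ 1 (fun w : ℂ => (((fun x : ℝ => (x + η ^ 2)⁻¹) (‖w‖ ^ 2) : ℝ) : ℂ)) := by
    apply contDiff_radial (φ := fun x : ℝ => (x + η ^ 2)⁻¹)
    intro x hx
    have : x + η ^ 2 ≠ 0 := by positivity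
    fun_prop (disch := assumption)
  refine ⟨contDiff_conj.mul c2, ?_⟩
  have h0 : (‖w‖ ^ 2 + η ^ 2) ≠ 0 := by positivity
  have hd : HasDerivAt (fun x : ℝ => (x + η ^ 2)⁻¹) (-((‖w‖ ^ 2 + η ^ 2) ^ 2)⁻¹) (‖w‖ ^ 2) := by
    refine (((hasDerivAt_id (‖w‖ ^ 2)).add_const (η ^ 2)).inv h0).congr_deriv ?_
    simp [div_eq_mul_inv]
  have := db_mul (f := fun w => (starRingEnd ℂ) w) (z := w)
    (contDiff_conj.differentiable (n := 1) (by norm_num) w) (c2.differentiable (by norm_num) w)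
  rw [db_conj, db_radial hd] at this
  have e : db (ee η) w = _ := this
  rw [e]
  have hw : (starRingEnd ℂ) w * w = ((‖w‖ ^ 2 : ℝ) : ℂ) := by
    rw [Complex.conj_mul']; simp
  have : (starRingEnd ℂ) w * (((-((‖w‖ ^ 2 + η ^ 2) ^ 2)⁻¹ : ℝ) : ℂ) * w) =
    ((-((‖w‖ ^ 2 + η ^ 2) ^ 2)⁻¹ * ‖w‖ ^ 2 : ℝ) : ℂ) := by
    push_cast at hw ⊢
    linear_combination (-((‖w‖ ^ 2 + η ^ 2) ^ 2 : ℂ)⁻¹) * hw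
  rw [this, one_mul, ← Complex.ofReal_add]
  congr 1
  field_simp
  ring

lemma norm_ee_le (η : ℝ) (w : ℂ) : ‖ee η w‖ ≤ ‖w‖⁻¹ := by
  unfold ee
  rw [norm_mul, RCLike.norm_conj, Complex.norm_real, Real.norm_of_nonneg (by positivity)]
  rcases eq_or_ne w 0 with rfl | hw
  · simp
  have h : 0 < ‖w‖ := by positivity
  rw [← div_eq_mul_inv, ← one_div, div_le_div_iff₀ (by positivity) h]
  nlinarith [sq_nonneg η]

lemma tendsto_ee (w : ℂ) : Tendsto (fun η => ee η w) (𝓝[>] 0) (𝓝 (w⁻¹)) := by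
  rcases eq_or_ne w 0 with rfl | hw
  · simp [ee]
  have h : ‖w‖ ^ 2 + (0:ℝ) ^ 2 ≠ 0 := by simpa using hw
  have : ContinuousAt (fun η => ee η w) 0 := by
    unfold ee
    have : ContinuousAt (fun η : ℝ => (‖w‖ ^ 2 + η ^ 2)⁻¹) 0 :=
      ContinuousAt.inv₀ (by fun_prop) h
    exact continuousAt_const.mul (Complex.continuous_ofReal.continuousAt.comp this)
  have h2 := this.tendsto.mono_left (nhdsWithin_le_nhds (s := Ioi 0))
  convert h2 using 2
  simp only [ee]
  rw [Complex.inv_def, Complex.normSq_eq_norm_sq]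
  simp

/-- Cauchy–Pompeiu. -/
lemma pompeiu {ψ : ℂ → ℂ} (hψ : ContDiff ℝ 1 ψ) (hc : HasCompactSupport ψ) (z : ℂ) :
    ∫ w, db ψ (z - w) * w⁻¹ = Real.pi * ψ z := by
  have hdb := continuous_db hψ
  have t1 : Tendsto (fun η => ∫ w, db ψ (z - w) * ee η w) (𝓝[>] 0)
      (𝓝 (∫ w, db ψ (z - w) * w⁻¹)) := by
    apply tendsto_integral_filter_of_dominated_convergence
      (bound := fun w => ‖db ψ (z - w)‖ * ‖w‖⁻¹)
    · filter_upwards [self_mem_nhdsWithin] with η hη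
      have := (db_ee hη 0).1.continuous
      exact Continuous.aestronglyMeasurable (by fun_prop)
    · refine Eventually.of_forall fun η => Eventually.of_forall fun w => ?_
      rw [norm_mul]
      gcongr
      exact norm_ee_le η w
    · exact integrable_cc_mul hdb (hcs_db hc) z
    · exact Eventually.of_forall fun w => (tendsto_ee w).const_mul _
  have t2 : Tendsto (fun η : ℝ => ∫ t, ψ (z - η * t) * ((((1 + ‖t‖ ^ 2) ^ 2)⁻¹ : ℝ) : ℂ)) (𝓝[>] 0)
      (𝓝 (∫ t : ℂ, ψ z * ((((1 + ‖t‖ ^ 2) ^ 2)⁻¹ : ℝ) : ℂ))) := by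
    obtain ⟨M, hM⟩ := hc.exists_bound_of_continuous hψ.continuous
    have hψc := hψ.continuous
    apply tendsto_integral_filter_of_dominated_convergence
      (bound := fun t => M * (((1 + ‖t‖ ^ 2) ^ 2)⁻¹ : ℝ))
    · refine Eventually.of_forall fun η => ?_
      exact Measurable.aestronglyMeasurable (by fun_prop)
    · refine Eventually.of_forall fun η => Eventually.of_forall fun w => ?_
      rw [norm_mul, Complex.norm_real, Real.norm_of_nonneg (by positivity)]
      gcongr
      exact hM _
    · exact integrable_bump.const_mul _
    · refine Eventually.of_forall fun t => Tendsto.mul_const _ ?_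
      have : Continuous fun η : ℝ => ψ (z - η * t) := by fun_prop
      have := this.tendsto 0
      simp at this
      exact this.mono_left nhdsWithin_le_nhds
  have e : ∀ η : ℝ, 0 < η → ∫ w, db ψ (z - w) * ee η w =
      ∫ t, ψ (z - η * t) * ((((1 + ‖t‖ ^ 2) ^ 2)⁻¹ : ℝ) : ℂ) := by
    intro η hη
    have hη' : (η : ℂ) ≠ 0 := by exact_mod_cast hη.ne'
    rw [conv_db hψ hc (db_ee hη 0).1, integral_comp_mulLeft hη', ← integral_const_mul]
    congr 1
    ext t
    rw [(db_ee hη _).2, mul_left_comm, ← Complex.ofReal_mul]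
    congr 2
    rw [norm_mul, Complex.norm_real, Real.norm_of_nonneg hη.le]
    field_simp
    ring
  have t3 := t1.congr' (by
    filter_upwards [self_mem_nhdsWithin] with η hη
    exact e η hη)
  rw [tendsto_nhds_unique t3 t2, integral_const_mul, integral_complex_ofReal, integral_bump]
  ring

/-- general odd-kernel limit -/
lemma odd_limit {G : ℂ → ℂ} (hG : ContDiff ℝ 1 G) (hc : HasCompactSupport G)
    {m : ℝ → ℂ → ℂ} {k : ℂ → ℂ} (hm : ∀ η, Measurable (m η)) (hodd : ∀ η w, m η (-w) = - m η w)
    (hb : ∀ η w, ‖m η w‖ ≤ (‖w‖ ^ 2)⁻¹)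
    (hi : ∀ η > 0, ∀ z, Integrable (fun w => G (z - w) * m η w))
    (ht : ∀ w, w ≠ 0 → Tendsto (fun η => m η w) (𝓝[>] 0) (𝓝 (k w))) (z : ℂ) :
    Tendsto (fun η => ∫ w, G (z - w) * m η w) (𝓝[>] 0)
      (𝓝 (∫ w, (1/2 : ℂ) * (G (z - w) - G (z + w)) * k w)) := by
  have hGc := hG.continuous
  obtain ⟨L, hL⟩ := ContDiff.lipschitzWith_of_hasCompactSupport hc hG (by norm_num)
  have e : ∀ η > 0, ∫ w, G (z - w) * m η w = ∫ w, (1/2 : ℂ) * (G (z - w) - G (z + w)) * m η w := by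
    intro η hη
    have h1 : ∫ w, G (z + w) * m η w = - ∫ w, G (z - w) * m η w := by
      rw [← integral_neg_eq_self, ← integral_neg]
      simp [hodd, sub_eq_add_neg]
    have i1 : Integrable (fun w => G (z + w) * m η w) := by
      have := (hi η hη z).comp_neg.neg
      simpa [hodd, sub_eq_add_neg, Pi.neg_def] using this
    have : ∀ w, (1/2 : ℂ) * (G (z - w) - G (z + w)) * m η w =
      (1/2 : ℂ) * (G (z - w) * m η w - G (z + w) * m η w) := fun w => by ring
    simp only [this]
    rw [integral_const_mul, integral_sub (hi η hη z) i1, h1]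
    ring
  refine Tendsto.congr' (f₁ := fun η => ∫ w, (1/2 : ℂ) * (G (z - w) - G (z + w)) * m η w) ?_ ?_
  · filter_upwards [self_mem_nhdsWithin] with η hη
    exact (e η hη).symm
  obtain ⟨R, hR⟩ := hc.isBounded.subset_closedBall 0
  set K : Set ℂ := closedBall (0:ℂ) (|R| + ‖z‖) with hK
  have hKi := intOn_rpow (a := 1) (by norm_num) 0 (isCompact_closedBall (0:ℂ) (|R| + ‖z‖))
  simp only [sub_zero, Real.rpow_neg_one] at hKi
  have hbi : Integrable (K.indicator fun w : ℂ => (L : ℝ) * ‖w‖⁻¹) := by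
    rw [integrable_indicator_iff isClosed_closedBall.measurableSet]
    exact hKi.const_mul _
  apply tendsto_integral_filter_of_dominated_convergence _ _ _ hbi
  · have : ∀ᵐ w : ℂ, w ≠ 0 := by simp [ae_iff]
    filter_upwards [this] with w hw
    exact (ht w hw).const_mul _
  · refine Eventually.of_forall fun η => ?_
    have := hm η
    exact Measurable.aestronglyMeasurable (by fun_prop)
  · refine Eventually.of_forall fun η => Eventually.of_forall fun w => ?_
    by_cases hw : w ∈ K
    · rw [indicator_of_mem hw, norm_mul, norm_mul]
      have h1 : ‖G (z - w) - G (z + w)‖ ≤ L * (2 * ‖w‖) := by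
        have := hL.dist_le_mul (z - w) (z + w)
        rw [dist_eq_norm, dist_eq_norm] at this
        have e : ‖z - w - (z + w)‖ = 2 * ‖w‖ := by
          have : z - w - (z + w) = -(2 * w) := by ring
          rw [this, norm_neg, norm_mul]; norm_num
        rwa [e] at this
      calc ‖(1/2:ℂ)‖ * ‖G (z - w) - G (z + w)‖ * ‖m η w‖ ≤ (1/2) * (L * (2 * ‖w‖)) * (‖w‖ ^ 2)⁻¹ := by
            gcongr
            · norm_num
            · exact hb η w
        _ = L * ‖w‖⁻¹ := by
            rcases eq_or_ne w 0 with rfl | h0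
            · simp
            · have : ‖w‖ ≠ 0 := by simpa using h0
              field_simp
    · have hz : ∀ v, v ∉ closedBall (0:ℂ) R → G v = 0 := fun v hv => by
        by_contra h
        exact hv (hR (subset_tsupport _ h))
      simp only [hK, mem_closedBall, dist_zero_right, not_le] at hw
      have a1 : G (z - w) = 0 := hz _ (by
        simp only [mem_closedBall, dist_zero_right, not_le]
        have := norm_sub_norm_le w z
        rw [norm_sub_rev] at this
        have := le_abs_self R
        linarith)
      have a2 : G (z + w) = 0 := hz _ (by
        simp only [mem_closedBall, dist_zero_right, not_le]
        have := norm_sub_le (z + w) z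
        simp at this
        have := le_abs_self R
        linarith)
      simp only [a1, a2]
      simp
      exact indicator_nonneg (fun _ _ => by positivity) _

end CTW

namespace CTW
open Filter Topology

noncomputable def k0 (w : ℂ) : ℂ := (starRingEnd ℂ) w * (((‖w‖ ^ 3)⁻¹ : ℝ) : ℂ)

lemma kk_bd (ε : ℝ) (w : ℂ) : ‖kk ε w‖ ≤ (‖w‖ ^ 2)⁻¹ := by
  rcases eq_or_ne w 0 with rfl | hw
  · simp [kk]
  · refine (norm_kk_le ε w).trans ?_
    have : 0 < ‖w‖ := by positivity
    gcongr
    nlinarith [sq_nonneg ε]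

lemma tendsto_kk {w : ℂ} (hw : w ≠ 0) : Tendsto (fun ε => kk ε w) (𝓝[>] 0) (𝓝 (k0 w)) := by
  have h0 : ‖w‖ ≠ 0 := by simpa using hw
  have : ContinuousAt (fun ε => kk ε w) 0 := by
    unfold kk
    have h1 : ContinuousAt (fun ε : ℝ => ((‖w‖ * (‖w‖ ^ 2 + ε ^ 2) : ℝ) : ℂ)) 0 := by fun_prop
    refine continuousAt_const.mul (h1.inv₀ ?_)
    simp [hw]
  have h2 := this.tendsto.mono_left (nhdsWithin_le_nhds (s := Ioi 0))
  convert h2 using 2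
  simp [k0, kk]
  left
  ring_nf

noncomputable def mm (η : ℝ) (w : ℂ) : ℂ :=
  (starRingEnd ℂ) w * (((‖w‖ ^ 2 + η ^ 2) ^ (-(3/2) : ℝ) : ℝ) : ℂ)

noncomputable def NN (η : ℝ) (w : ℂ) : ℂ := (((‖w‖ ^ 2 + η ^ 2) ^ (-(1/2) : ℝ) : ℝ) : ℂ)

lemma NN_props {η : ℝ} (hη : 0 < η) (w : ℂ) :
    ContDiff ℝ 1 (NN η) ∧ dz (NN η) w = (-(1/2) : ℂ) * mm η w := by
  have c2 : ContDiff ℝ 1 (NN η) := by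
    apply contDiff_radial (φ := fun x : ℝ => (x + η ^ 2) ^ (-(1/2) : ℝ))
    intro x hx
    have : x + η ^ 2 ≠ 0 := by positivity
    exact ContDiffAt.rpow_const_of_ne (by fun_prop) this
  refine ⟨c2, ?_⟩
  have h0 : (‖w‖ ^ 2 + η ^ 2) ≠ 0 := by positivity
  have hd : HasDerivAt (fun x : ℝ => (x + η ^ 2) ^ (-(1/2) : ℝ))
      (-(1/2) * (‖w‖ ^ 2 + η ^ 2) ^ (-(3/2) : ℝ)) (‖w‖ ^ 2) := by
    refine (((hasDerivAt_id (‖w‖ ^ 2)).add_const (η ^ 2)).rpow_const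
      (p := (-(1/2) : ℝ)) (Or.inl h0)).congr_deriv ?_
    norm_num
  have e : dz (NN η) w = _ := dz_radial hd
  rw [e, mm]
  push_cast
  ring

lemma rpow_bd {x η : ℝ} (hx : 0 < x) {s : ℝ} (hs : 0 ≤ s) :
    (x ^ 2 + η ^ 2) ^ (-(s/2) : ℝ) ≤ x ^ (-s) := by
  calc (x ^ 2 + η ^ 2) ^ (-(s/2) : ℝ) ≤ (x ^ 2) ^ (-(s/2) : ℝ) :=
        Real.rpow_le_rpow_of_nonpos (by positivity) (by nlinarith [sq_nonneg η]) (by linarith)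
    _ = x ^ (-s) := by
        rw [← Real.rpow_natCast, ← Real.rpow_mul hx.le]; congr 1; push_cast; ring

lemma mm_bd (η : ℝ) (w : ℂ) : ‖mm η w‖ ≤ (‖w‖ ^ 2)⁻¹ := by
  unfold mm
  rw [norm_mul, RCLike.norm_conj, Complex.norm_real, Real.norm_of_nonneg (by positivity)]
  rcases eq_or_ne w 0 with rfl | hw
  · simp
  have h : 0 < ‖w‖ := by positivity
  calc ‖w‖ * (‖w‖ ^ 2 + η ^ 2) ^ (-(3/2) : ℝ) ≤ ‖w‖ * ‖w‖ ^ (-3 : ℝ) := by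
        gcongr; exact rpow_bd h (by norm_num)
    _ = (‖w‖ ^ 2)⁻¹ := by
        rw [Real.rpow_neg h.le]; norm_cast; field_simp

lemma NN_bd (η : ℝ) {w : ℂ} (hw : w ≠ 0) : ‖NN η w‖ ≤ ‖w‖⁻¹ := by
  unfold NN
  rw [Complex.norm_real, Real.norm_of_nonneg (by positivity), ← Real.rpow_neg_one]
  exact rpow_bd (by positivity) (by norm_num)

lemma rpow_lim {x : ℝ} (hx : 0 < x) (s : ℝ) :
    Tendsto (fun η : ℝ => (x ^ 2 + η ^ 2) ^ (-(s/2) : ℝ)) (𝓝[>] 0) (𝓝 (x ^ (-s))) := by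
  have : ContinuousAt (fun η : ℝ => (x ^ 2 + η ^ 2) ^ (-(s/2) : ℝ)) 0 := by
    refine ContinuousAt.rpow_const (by fun_prop) (Or.inl ?_)
    positivity
  have h2 := this.tendsto.mono_left (nhdsWithin_le_nhds (s := Ioi 0))
  convert h2 using 2
  simp
  rw [← Real.rpow_natCast, ← Real.rpow_mul hx.le]; congr 1; push_cast; ring

lemma tendsto_mm {w : ℂ} (hw : w ≠ 0) : Tendsto (fun ε => mm ε w) (𝓝[>] 0) (𝓝 (k0 w)) := by
  have h0 : 0 < ‖w‖ := by positivity
  have := (rpow_lim h0 3).ofReal.const_mul ((starRingEnd ℂ) w)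
  unfold k0
  rw [Real.rpow_neg h0.le] at this
  exact_mod_cast this

lemma tendsto_NN {w : ℂ} (hw : w ≠ 0) : Tendsto (fun ε => NN ε w) (𝓝[>] 0) (𝓝 ((‖w‖⁻¹ : ℝ) : ℂ)) := by
  have h0 : 0 < ‖w‖ := by positivity
  have := (rpow_lim h0 1).ofReal
  rwa [Real.rpow_neg_one] at this

noncomputable def Lam (D : ℂ → ℂ) (z : ℂ) : ℂ := ∫ w, D (z - w) * ((‖w‖⁻¹ : ℝ) : ℂ)

lemma ae_ne (a : ℂ) : ∀ᵐ w : ℂ, w ≠ a := by simp [ae_iff]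

lemma Lam_tendsto {G : ℂ → ℂ} (hG : ContDiff ℝ 1 G) (hc : HasCompactSupport G) (z : ℂ) :
    Tendsto (fun ε => (-(1/2) : ℂ) * ∫ w, G (z - w) * kk ε w) (𝓝[>] 0) (𝓝 (Lam (dz G) z)) := by
  have hGc := hG.continuous
  have hd := continuous_dz hG
  have t1 := (odd_limit hG hc (m := mm) (k := k0) (fun η => by unfold mm; fun_prop)
    (fun η w => by simp [mm]) mm_bd (fun η hη z => by
      have : Continuous (mm η) := by
        unfold mm
        have : Continuous fun w : ℂ => (‖w‖ ^ 2 + η ^ 2) ^ (-(3/2) : ℝ) :=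
          Continuous.rpow_const (by fun_prop) (fun w => Or.inl (by positivity))
        have h2 := Complex.continuous_ofReal.comp this
        exact Complex.continuous_conj.mul h2
      exact Continuous.integrable_of_hasCompactSupport (by fun_prop) ((hcs_sub hc z).mul_right))
    (fun w hw => tendsto_mm hw) z).const_mul (-(1/2) : ℂ)
  have t2 := (odd_limit hG hc (m := kk) (k := k0) (fun η => measurable_kk η)
    (fun η w => kk_neg η w) kk_bd (fun η hη z => by
      refine holder_integrable (p := 3) (by norm_num) ?_ (memLp_kk hη (by norm_num))
      exact (hGc.comp (by fun_prop)).memLp_of_hasCompactSupport (hcs_sub hc z))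
    (fun w hw => tendsto_kk hw) z).const_mul (-(1/2) : ℂ)
  have t3 : Tendsto (fun η => ∫ w, dz G (z - w) * NN η w) (𝓝[>] 0) (𝓝 (Lam (dz G) z)) := by
    apply tendsto_integral_filter_of_dominated_convergence
      (bound := fun w => ‖dz G (z - w)‖ * ‖w‖⁻¹)
    · filter_upwards [self_mem_nhdsWithin] with η hη
      have := (NN_props hη 0).1.continuous
      exact Continuous.aestronglyMeasurable (by fun_prop)
    · refine Eventually.of_forall fun η => ?_
      filter_upwards [ae_ne 0] with w hw
      rw [norm_mul]
      gcongr
      exact NN_bd η hw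
    · exact integrable_cc_mul hd (hcs_dz hc) z
    · filter_upwards [ae_ne 0] with w hw
      exact (tendsto_NN hw).const_mul _
  have t4 := t3.congr' (f₂ := fun η => (-(1/2) : ℂ) * ∫ w, G (z - w) * mm η w) (by
    filter_upwards [self_mem_nhdsWithin] with η hη
    rw [conv_dz hG hc (NN_props hη 0).1, ← integral_const_mul]
    congr 1; ext w
    rw [(NN_props hη w).2]; ring)
  rw [tendsto_nhds_unique t4 t1]
  exact t2

lemma stronglyMeasurable_conv {D k : ℂ → ℂ} (hD : Measurable D) (hk : Measurable k) :
    StronglyMeasurable (fun z => ∫ w, D (z - w) * k w) := by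
  have : Measurable (Function.uncurry fun z w => D (z - w) * k w) := by
    unfold Function.uncurry
    fun_prop
  exact this.stronglyMeasurable.integral_prod_right

lemma Lam_bound {p : ℝ} (hp : 2 < p) : ∃ C : ℝ≥0∞, C ≠ ⊤ ∧ ∀ G : ℂ → ℂ,
    ContDiff ℝ 1 G → HasCompactSupport G →
    MemLp (Lam (dz G)) (ENNReal.ofReal p) volume ∧
    eLpNorm (Lam (dz G)) (ENNReal.ofReal p) volume ≤ C * eLpNorm G (ENNReal.ofReal p) volume := by
  obtain ⟨C, hC, h⟩ := kk_bound hp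
  refine ⟨C, hC, fun G hG hc => ?_⟩
  have hGL : MemLp G (ENNReal.ofReal p) volume := hG.continuous.memLp_of_hasCompactSupport hc
  have hb : eLpNorm (Lam (dz G)) (ENNReal.ofReal p) volume ≤
      C * eLpNorm G (ENNReal.ofReal p) volume := by
    refine Lp.eLpNorm_le_of_ae_tendsto (u := 𝓝[>] (0:ℝ))
      (f := fun ε z => (-(1/2) : ℂ) * ∫ w, G (z - w) * kk ε w) ?_ ?_ ?_
    · filter_upwards [self_mem_nhdsWithin] with ε hε
      refine (eLpNorm_le_nnreal_smul_eLpNorm_of_ae_le_mul (c := 1)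
        (g := fun z => ∫ w, G (z - w) * kk ε w) (Eventually.of_forall fun z => ?_) _).trans ?_
      · rw [nnnorm_mul, one_mul]
        have : ‖(-(1/2) : ℂ)‖₊ ≤ 1 := by
          rw [← NNReal.coe_le_coe]; simp; norm_num
        exact mul_le_of_le_one_left bot_le this
      · simpa using h G hGL ε hε
    · intro ε
      exact ((stronglyMeasurable_conv hG.continuous.measurable
        (measurable_kk ε)).const_mul _).aestronglyMeasurable
    · exact Eventually.of_forall fun z => Lam_tendsto hG hc z
  refine ⟨⟨?_, hb.trans_lt ?_⟩, hb⟩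
  · exact (stronglyMeasurable_conv (continuous_dz hG).measurable
      (k := fun w => ((‖w‖⁻¹ : ℝ) : ℂ)) (by fun_prop)).aestronglyMeasurable
  · exact ENNReal.mul_lt_top hC.lt_top hGL.2

end CTW

namespace CTW
open Filter Topology

lemma kk_bd32 {ε : ℝ} (hε : 0 < ε) (w : ℂ) :
    ‖kk ε w‖ ≤ ε ^ (-(1/2) : ℝ) * ‖w‖ ^ (-(3/2) : ℝ) := by
  rcases eq_or_ne w 0 with rfl | hw
  · simp [kk]
  refine (norm_kk_le ε w).trans ?_
  have hx : 0 < ‖w‖ := by positivity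
  set x := ‖w‖
  have key : ε ^ (1/2 : ℝ) * x ^ (3/2 : ℝ) ≤ x ^ 2 + ε ^ 2 := by
    have := Real.geom_mean_le_arith_mean2_weighted (w₁ := 1/4) (w₂ := 3/4) (p₁ := ε ^ 2)
      (p₂ := x ^ 2) (by norm_num) (by norm_num) (by positivity) (by positivity) (by norm_num)
    have e1 : (ε ^ 2) ^ (1/4 : ℝ) = ε ^ (1/2 : ℝ) := by
      rw [← Real.rpow_natCast, ← Real.rpow_mul hε.le]; norm_num
    have e2 : (x ^ 2) ^ (3/4 : ℝ) = x ^ (3/2 : ℝ) := by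
      rw [← Real.rpow_natCast, ← Real.rpow_mul hx.le]; norm_num
    rw [e1, e2] at this
    nlinarith [sq_nonneg ε, sq_nonneg x]
  rw [Real.rpow_neg hε.le, Real.rpow_neg hx.le, ← mul_inv]
  gcongr

lemma integrable_ts2 : Integrable (fun t : ℂ => ‖t‖ ^ (-(3/2) : ℝ) * ‖1 - t‖⁻¹) :=
  integrable_two_sing (by norm_num) (by norm_num)

lemma kk_t_bd {ε : ℝ} (hε : 0 < ε) (y t : ℂ) :
    ‖((‖1 - t‖⁻¹ : ℝ) : ℂ) * kk ε (y * t)‖ ≤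
      ε ^ (-(1/2) : ℝ) * ‖y‖ ^ (-(3/2) : ℝ) * (‖t‖ ^ (-(3/2) : ℝ) * ‖1 - t‖⁻¹) := by
  rw [norm_mul, Complex.norm_real, Real.norm_of_nonneg (by positivity)]
  have := kk_bd32 hε (y * t)
  rw [norm_mul, Real.mul_rpow (by positivity) (by positivity)] at this
  calc ‖1 - t‖⁻¹ * ‖kk ε (y * t)‖ ≤ ‖1 - t‖⁻¹ *
      (ε ^ (-(1/2) : ℝ) * (‖y‖ ^ (-(3/2) : ℝ) * ‖t‖ ^ (-(3/2) : ℝ))) := by gcongr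
    _ = _ := by ring

lemma kk_t_int {ε : ℝ} (hε : 0 < ε) (y : ℂ) :
    Integrable (fun t : ℂ => ((‖1 - t‖⁻¹ : ℝ) : ℂ) * kk ε (y * t)) := by
  refine (integrable_ts2.const_mul (ε ^ (-(1/2) : ℝ) * ‖y‖ ^ (-(3/2) : ℝ))).mono' ?_
    (Eventually.of_forall fun t => kk_t_bd hε y t)
  have := measurable_kk ε
  exact Measurable.aestronglyMeasurable (by fun_prop)

noncomputable def KK (ε : ℝ) (y : ℂ) : ℂ := ∫ w, ((‖y - w‖⁻¹ : ℝ) : ℂ) * kk ε w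

noncomputable def dd (t : ℂ) : ℝ := (1/2) * (‖1 - t‖⁻¹ - ‖1 + t‖⁻¹)

lemma measurable_dd : Measurable dd := by unfold dd; fun_prop

lemma KK_eq {ε : ℝ} (hε : 0 < ε) {y : ℂ} (hy : y ≠ 0) :
    KK ε y = ∫ t, (‖y‖ : ℂ) * ((dd t : ℂ) * kk ε (y * t)) := by
  have hy' : (‖y‖ : ℂ) ≠ 0 := by simpa using hy
  have e1 : KK ε y = (‖y‖ : ℂ) * ∫ t, ((‖1 - t‖⁻¹ : ℝ) : ℂ) * kk ε (y * t) := by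
    unfold KK
    rw [integral_comp_mulLeft hy, ← integral_const_mul, ← integral_const_mul]
    congr 1; ext t
    have : ‖y - y * t‖ = ‖y‖ * ‖1 - t‖ := by rw [← norm_mul]; congr 1; ring
    rw [this]
    push_cast
    field_simp
  have i1 := kk_t_int hε y
  have i2 : Integrable (fun t : ℂ => ((‖1 + t‖⁻¹ : ℝ) : ℂ) * kk ε (y * t)) := by
    have := i1.comp_neg.neg
    simpa [kk_neg, sub_eq_add_neg, Pi.neg_def] using this
  have h1 : ∫ t, ((‖1 + t‖⁻¹ : ℝ) : ℂ) * kk ε (y * t) =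
      - ∫ t, ((‖1 - t‖⁻¹ : ℝ) : ℂ) * kk ε (y * t) := by
    rw [← integral_neg_eq_self, ← integral_neg]
    simp [kk_neg, sub_eq_add_neg]
  rw [e1, integral_const_mul]
  congr 1
  have : ∀ t, (dd t : ℂ) * kk ε (y * t) = (1/2 : ℂ) * (((‖1 - t‖⁻¹ : ℝ) : ℂ) * kk ε (y * t) -
    ((‖1 + t‖⁻¹ : ℝ) : ℂ) * kk ε (y * t)) := fun t => by unfold dd; push_cast; ring
  simp only [this]
  rw [integral_const_mul, integral_sub i1 i2, h1]
  ring

lemma dd_bd (t : ℂ) (h0 : t ≠ 0) (h1 : t ≠ 1) (h2 : t ≠ -1) : |dd t| * (‖t‖ ^ 2)⁻¹ ≤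
    ‖t‖ ^ (-(3/2) : ℝ) * ‖1 - t‖⁻¹ + ‖-t‖ ^ (-(3/2) : ℝ) * ‖1 - (-t)‖⁻¹ := by
  have p0 : 0 < ‖t‖ := by positivity
  have p1 : 0 < ‖1 - t‖ := by
    rw [norm_pos_iff]; intro h; exact h1 (sub_eq_zero.1 h).symm
  have p2 : 0 < ‖1 + t‖ := by
    rw [norm_pos_iff]; intro h; exact h2 (by linear_combination h)
  rw [norm_neg, sub_neg_eq_add, ← mul_add]
  have hdiff : |‖1 + t‖ - ‖1 - t‖| ≤ 2 * ‖t‖ := by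
    have := abs_norm_sub_norm_le (1 + t) (1 - t)
    have e : (1 + t) - (1 - t) = 2 * t := by ring
    rw [e, norm_mul] at this
    simpa using this
  have hpar : ‖1 + t‖ * ‖1 + t‖ + ‖1 - t‖ * ‖1 - t‖ = 2 * (1 + ‖t‖ * ‖t‖) := by
    have := parallelogram_law_with_norm ℝ (1:ℂ) t
    simp at this
    linarith
  have hs : ‖t‖ ^ (1/2 : ℝ) ≤ ‖1 + t‖ + ‖1 - t‖ := by
    rw [← Real.sqrt_eq_rpow]
    apply Real.sqrt_le_iff.2
    refine ⟨by positivity, ?_⟩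
    nlinarith [sq_nonneg (1 - ‖t‖), mul_pos p1 p2]
  have e1 : dd t = (1/2) * ((‖1 + t‖ - ‖1 - t‖) * (‖1 - t‖⁻¹ * ‖1 + t‖⁻¹)) := by
    unfold dd; field_simp
  have e2 : ‖1 - t‖⁻¹ + ‖1 + t‖⁻¹ = (‖1 + t‖ + ‖1 - t‖) * (‖1 - t‖⁻¹ * ‖1 + t‖⁻¹) := by
    field_simp
  have e3 : ‖t‖ ^ (-(3/2) : ℝ) * ‖t‖ ^ (1/2 : ℝ) = ‖t‖⁻¹ := by
    rw [← Real.rpow_add p0, ← Real.rpow_neg_one]; norm_num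
  rw [e2, e1, abs_mul, abs_mul, abs_of_pos (by norm_num : (0:ℝ) < 1/2),
    abs_of_pos (a := ‖1 - t‖⁻¹ * ‖1 + t‖⁻¹) (by positivity)]
  set P := ‖1 - t‖⁻¹ * ‖1 + t‖⁻¹
  have hP : 0 < P := by positivity
  calc 1/2 * (|‖1 + t‖ - ‖1 - t‖| * P) * (‖t‖ ^ 2)⁻¹ ≤ 1/2 * ((2 * ‖t‖) * P) * (‖t‖ ^ 2)⁻¹ := by gcongr
    _ = ‖t‖⁻¹ * P := by field_simp
    _ = ‖t‖ ^ (-(3/2) : ℝ) * (‖t‖ ^ (1/2 : ℝ) * P) := by rw [← e3]; ring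
    _ ≤ _ := by gcongr

lemma integrable_dd : Integrable (fun t : ℂ => |dd t| * (‖t‖ ^ 2)⁻¹) := by
  have i1 := integrable_ts2
  have i2 := integrable_ts2.comp_neg
  refine (i1.add i2).mono' ?_ ?_
  · have := measurable_dd
    exact Measurable.aestronglyMeasurable (by fun_prop)
  · filter_upwards [ae_ne 0, ae_ne 1, ae_ne (-1)] with t h0 h1 h2
    rw [Real.norm_of_nonneg (by positivity)]
    exact dd_bd t h0 h1 h2

lemma KK_integrand_bd (ε : ℝ) {y : ℂ} (hy : y ≠ 0) (t : ℂ) :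
    ‖(‖y‖ : ℂ) * ((dd t : ℂ) * kk ε (y * t))‖ ≤ ‖y‖⁻¹ * (|dd t| * (‖t‖ ^ 2)⁻¹) := by
  have hy' : ‖y‖ ≠ 0 := by simpa using hy
  have := kk_bd ε (y * t)
  rw [norm_mul] at this
  rw [norm_mul, norm_mul, Complex.norm_real, Complex.norm_real, norm_norm, Real.norm_eq_abs]
  calc ‖y‖ * (|dd t| * ‖kk ε (y * t)‖) ≤ ‖y‖ * (|dd t| * ((‖y‖ * ‖t‖) ^ 2)⁻¹) := by gcongr
    _ = _ := by rw [mul_pow, mul_inv]; field_simp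

lemma KK_bd {ε : ℝ} (hε : 0 < ε) {y : ℂ} (hy : y ≠ 0) :
    ‖KK ε y‖ ≤ (∫ t : ℂ, |dd t| * (‖t‖ ^ 2)⁻¹) * ‖y‖⁻¹ := by
  rw [KK_eq hε hy]
  refine (norm_integral_le_of_norm_le (integrable_dd.const_mul (‖y‖⁻¹))
    (Eventually.of_forall fun t => KK_integrand_bd ε hy t)).trans ?_
  rw [integral_const_mul, mul_comm]

noncomputable def cc : ℂ := ∫ t, (dd t : ℂ) * k0 t

lemma k0_mul {y : ℂ} (hy : y ≠ 0) (t : ℂ) : (‖y‖ : ℂ) * k0 (y * t) = y⁻¹ * k0 t := by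
  have hy' : (‖y‖ : ℂ) ≠ 0 := by simpa using hy
  unfold k0
  rw [Complex.inv_def, Complex.normSq_eq_norm_sq, norm_mul, map_mul]
  rcases eq_or_ne t 0 with rfl | ht
  · simp
  have ht' : (‖t‖ : ℂ) ≠ 0 := by simpa using ht
  push_cast
  field_simp

lemma KK_tendsto {y : ℂ} (hy : y ≠ 0) : Tendsto (fun ε => KK ε y) (𝓝[>] 0) (𝓝 (cc * y⁻¹)) := by
  have t1 : Tendsto (fun ε => ∫ t, (‖y‖ : ℂ) * ((dd t : ℂ) * kk ε (y * t))) (𝓝[>] 0)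
      (𝓝 (∫ t, (‖y‖ : ℂ) * ((dd t : ℂ) * k0 (y * t)))) := by
    apply tendsto_integral_filter_of_dominated_convergence
      (bound := fun t => ‖y‖⁻¹ * (|dd t| * (‖t‖ ^ 2)⁻¹))
    · refine Eventually.of_forall fun ε => ?_
      have := measurable_kk ε
      have := measurable_dd
      exact Measurable.aestronglyMeasurable (by fun_prop)
    · exact Eventually.of_forall fun ε => Eventually.of_forall fun t => KK_integrand_bd ε hy t
    · exact integrable_dd.const_mul _
    · filter_upwards [ae_ne 0] with t ht
      exact ((tendsto_kk (mul_ne_zero hy ht)).const_mul _).const_mul _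
  have e : ∫ t, (‖y‖ : ℂ) * ((dd t : ℂ) * k0 (y * t)) = cc * y⁻¹ := by
    unfold cc
    rw [mul_comm, ← integral_const_mul]
    congr 1; ext t
    rw [mul_left_comm, k0_mul hy]; ring
  rw [e] at t1
  refine t1.congr' ?_
  filter_upwards [self_mem_nhdsWithin] with ε hε
  exact (KK_eq hε hy).symm

lemma cc_ne : cc ≠ 0 := by
  have hIntg : Integrable (fun t => (dd t : ℂ) * k0 t) := by
    refine integrable_dd.mono' ?_ (Eventually.of_forall fun t => ?_)
    · have := measurable_dd
      unfold k0
      exact Measurable.aestronglyMeasurable (by fun_prop)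
    · rw [norm_mul, Complex.norm_real, Real.norm_eq_abs]
      gcongr
      unfold k0
      rw [norm_mul, RCLike.norm_conj, Complex.norm_real, Real.norm_of_nonneg (by positivity)]
      rcases eq_or_ne t 0 with rfl | ht
      · simp
      have ht' : ‖t‖ ≠ 0 := by simpa using ht
      apply le_of_eq; field_simp
  have hre : ∀ t : ℂ, ((dd t : ℂ) * k0 t).re = dd t * t.re * (‖t‖ ^ 3)⁻¹ := by
    intro t
    simp only [k0, Complex.mul_re, Complex.mul_im, Complex.ofReal_re, Complex.ofReal_im,
      Complex.conj_re, Complex.conj_im]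
    ring
  have hsq : ∀ t : ℂ, ‖1 + t‖ ^ 2 - ‖1 - t‖ ^ 2 = 4 * t.re := by
    intro t
    simp only [← Complex.normSq_eq_norm_sq, Complex.normSq_apply]
    simp; ring
  have hpos : ∀ t : ℂ, t ≠ 0 → t ≠ 1 → t ≠ -1 → t.re ≠ 0 → 0 < dd t * t.re * (‖t‖ ^ 3)⁻¹ := by
    intro t h0 h1 h2 hr
    have p0 : 0 < ‖t‖ := by positivity
    have p1 : 0 < ‖1 - t‖ := by
      rw [norm_pos_iff]; intro h; exact h1 (sub_eq_zero.1 h).symm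
    have p2 : 0 < ‖1 + t‖ := by
      rw [norm_pos_iff]; intro h; exact h2 (by linear_combination h)
    have e1 : dd t = (1/2) * ((‖1 + t‖ ^ 2 - ‖1 - t‖ ^ 2) *
        (‖1 - t‖⁻¹ * ‖1 + t‖⁻¹ * (‖1 + t‖ + ‖1 - t‖)⁻¹)) := by
      unfold dd; field_simp; ring
    rw [e1, hsq]
    have : 0 < t.re * t.re := mul_self_pos.2 hr
    have h3 : 0 < ‖1 - t‖⁻¹ * ‖1 + t‖⁻¹ * (‖1 + t‖ + ‖1 - t‖)⁻¹ := by positivity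
    have h4 : 0 < (‖t‖ ^ 3)⁻¹ := by positivity
    have := mul_pos (mul_pos this h3) h4
    nlinarith
  have hre_ae : ∀ᵐ t : ℂ, t.re ≠ 0 := by
    have := Complex.volume_preserving_equiv_real_prod
    have h0 : ∀ᵐ q : ℝ × ℝ, q.1 ≠ 0 := by
      have : (volume : Measure (ℝ × ℝ)) = (volume : Measure ℝ).prod volume := rfl
      rw [this]
      have h : ∀ᵐ x : ℝ, x ≠ 0 := by simp [ae_iff]
      exact Measure.quasiMeasurePreserving_fst.ae h
    have h2 := this.quasiMeasurePreserving.ae h0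
    simpa using h2
  intro h
  have hr : ∫ t : ℂ, dd t * t.re * (‖t‖ ^ 3)⁻¹ = 0 := by
    have h1 : ∫ t, ((dd t : ℂ) * k0 t).re = (∫ t, (dd t : ℂ) * k0 t).re := integral_re hIntg
    rw [show (∫ t, (dd t : ℂ) * k0 t) = 0 from h] at h1
    simp only [hre] at h1
    simpa using h1
  have hi : Integrable (fun t : ℂ => dd t * t.re * (‖t‖ ^ 3)⁻¹) := by
    have : Integrable (fun t => ((dd t : ℂ) * k0 t).re) := hIntg.re
    simpa only [hre] using this
  have hp : ∀ᵐ t : ℂ, 0 < dd t * t.re * (‖t‖ ^ 3)⁻¹ := by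
    filter_upwards [ae_ne 0, ae_ne 1, ae_ne (-1), hre_ae] with t h0 h1 h2 h3
    exact hpos t h0 h1 h2 h3
  have hz := (integral_eq_zero_iff_of_nonneg_ae (hp.mono fun t ht => ht.le) hi).1 hr
  have : ∀ᵐ t : ℂ, False := by
    filter_upwards [hp, hz] with t h1 h2
    simp at h2 h1
    rcases h2 with (h2 | h2) | h2 <;> simp [h2] at h1
  simp at this
  exact NeZero.ne (volume : Measure ℂ) this

lemma kk_Lam {D : ℂ → ℂ} (hD : Continuous D) (hc : HasCompactSupport D) {ε : ℝ} (hε : 0 < ε)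
    (z : ℂ) : ∫ w, Lam D (z - w) * kk ε w = ∫ y, D (z - y) * KK ε y := by
  have hkm := measurable_kk ε
  have e1 : ∀ w, Lam D (z - w) * kk ε w = ∫ y, D (z - y) * (((‖y - w‖⁻¹ : ℝ) : ℂ) * kk ε w) := by
    intro w
    unfold Lam
    rw [← integral_mul_const, ← integral_sub_right_eq_self _ w]
    congr 1; ext y
    rw [_root_.sub_sub_sub_cancel_right]
    ring
  have hmeas : Measurable (Function.uncurry fun w y : ℂ =>
      D (z - y) * (((‖y - w‖⁻¹ : ℝ) : ℂ) * kk ε w)) := by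
    unfold Function.uncurry
    fun_prop
  simp only [e1]
  rw [integral_integral_swap]
  · congr 1; ext y
    rw [integral_const_mul]; rfl
  rw [integrable_prod_iff' hmeas.aestronglyMeasurable]
  have hsec : ∀ y : ℂ, y ≠ 0 → Integrable (fun w => ((‖y - w‖⁻¹ : ℝ) : ℂ) * kk ε w) ∧
      ∫ w, ‖((‖y - w‖⁻¹ : ℝ) : ℂ) * kk ε w‖ ≤ ε ^ (-(1/2) : ℝ) *
        (∫ t : ℂ, ‖t‖ ^ (-(3/2) : ℝ) * ‖1 - t‖⁻¹) * ‖y‖ ^ (-(1/2) : ℝ) := by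
    intro y hy
    have hy0 : 0 < ‖y‖ := by positivity
    have hs : ∀ t, ‖y - y * t‖⁻¹ = ‖y‖⁻¹ * ‖1 - t‖⁻¹ := fun t => by
      rw [← mul_inv, ← norm_mul]; congr 2; ring
    constructor
    · have := integrable_comp_mulLeft (inv_ne_zero hy) ((kk_t_int hε y).const_mul ((‖y‖⁻¹ : ℝ) : ℂ))
      refine this.congr (Eventually.of_forall fun w => ?_)
      have e : y * (y⁻¹ * w) = w := by field_simp
      have := hs (y⁻¹ * w)
      rw [e] at this
      simp only [e, this]
      push_cast; ring
    · have h1 := integral_comp_mulLeft hy (fun w => ((‖((‖y - w‖⁻¹ : ℝ) : ℂ) * kk ε w‖ : ℝ) : ℂ))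
      rw [integral_complex_ofReal, integral_complex_ofReal, ← Complex.ofReal_mul,
        Complex.ofReal_inj] at h1
      rw [h1]
      have h2 : ∫ t, ‖((‖y - y * t‖⁻¹ : ℝ) : ℂ) * kk ε (y * t)‖ ≤
          ∫ t : ℂ, ‖y‖⁻¹ * (ε ^ (-(1/2) : ℝ) * ‖y‖ ^ (-(3/2) : ℝ) *
            (‖t‖ ^ (-(3/2) : ℝ) * ‖1 - t‖⁻¹)) := by
        apply integral_mono_of_nonneg (Eventually.of_forall fun t => norm_nonneg _)
          ((integrable_ts2.const_mul _).const_mul _)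
        refine Eventually.of_forall fun t => ?_
        simp only [hs]
        have := kk_t_bd hε y t
        rw [norm_mul, Complex.norm_real, Real.norm_of_nonneg (by positivity)] at this ⊢
        rw [mul_assoc]
        gcongr
      rw [integral_const_mul, integral_const_mul] at h2
      calc ‖y‖ ^ 2 * ∫ t, ‖((‖y - y * t‖⁻¹ : ℝ) : ℂ) * kk ε (y * t)‖ ≤ ‖y‖ ^ 2 * _ :=
            mul_le_mul_of_nonneg_left h2 (by positivity)
        _ = ε ^ (-(1/2) : ℝ) * (∫ t : ℂ, ‖t‖ ^ (-(3/2) : ℝ) * ‖1 - t‖⁻¹) *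
            (‖y‖ ^ (2:ℕ) * ‖y‖⁻¹ * ‖y‖ ^ (-(3/2) : ℝ)) := by ring
        _ = _ := by
          congr 1
          rw [← Real.rpow_natCast, ← Real.rpow_neg_one, ← Real.rpow_add hy0, ← Real.rpow_add hy0]
          norm_num
  constructor
  · filter_upwards [ae_ne 0] with y hy
    exact (hsec y hy).1.const_mul (D (z - y))
  · have hl := locInt_rpow (a := 1/2) (by norm_num) 0
    simp only [sub_zero] at hl
    have hb := (hl.integrable_smul_left_of_hasCompactSupport (g := fun w => ‖D (z - w)‖)
      (by fun_prop) (hcs_sub hc z).norm).const_mul (ε ^ (-(1/2) : ℝ) *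
        (∫ t : ℂ, ‖t‖ ^ (-(3/2) : ℝ) * ‖1 - t‖⁻¹))
    refine hb.mono' ?_ ?_
    · exact (hmeas.norm.stronglyMeasurable.integral_prod_left (μ := volume)).aestronglyMeasurable
    · filter_upwards [ae_ne 0] with y hy
      rw [Real.norm_of_nonneg (integral_nonneg fun _ => norm_nonneg _)]
      simp only [Function.uncurry, norm_mul (D (z - y)), smul_eq_mul]
      rw [integral_const_mul]
      have := (hsec y hy).2
      calc _ ≤ ‖D (z - y)‖ * _ := mul_le_mul_of_nonneg_left this (norm_nonneg _)
        _ = _ := by ring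

/-- L7: a priori bound. -/
lemma dz_le_db {p : ℝ} (hp : 2 < p) : ∃ C : ℝ≥0∞, C ≠ ⊤ ∧ ∀ f : ℂ → ℂ,
    ContDiff ℝ (⊤ : ℕ∞) f → HasCompactSupport f →
    eLpNorm (dz f) (ENNReal.ofReal p) volume ≤ C * eLpNorm (db f) (ENNReal.ofReal p) volume := by
  obtain ⟨C1, hC1, h1⟩ := kk_bound hp
  obtain ⟨C2, hC2, h2⟩ := Lam_bound hp
  set a : ℂ := cc * Real.pi with ha
  have ha0 : a ≠ 0 := mul_ne_zero cc_ne (by exact_mod_cast Real.pi_ne_zero)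
  have ha1 : ‖a‖ₑ ≠ 0 := by simpa using ha0
  refine ⟨‖a‖ₑ⁻¹ * (C1 * C2), ENNReal.mul_ne_top (by simpa using ha0)
    (ENNReal.mul_ne_top hC1 hC2), fun f hf hc => ?_⟩
  have hG := contDiff_db hf
  have hG1 : ContDiff ℝ 1 (db f) := hG.of_le (mod_cast le_top)
  obtain ⟨hm, hb⟩ := h2 (db f) hG1 (hcs_db hc)
  set D := dz (db f) with hD
  have hDc : Continuous D := continuous_dz hG1
  have hDs : HasCompactSupport D := hcs_dz (hcs_db hc)
  have hlim : ∀ z, Tendsto (fun ε => ∫ w, Lam D (z - w) * kk ε w) (𝓝[>] 0) (𝓝 (a * dz f z)) := by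
    intro z
    have t1 : Tendsto (fun ε => ∫ y, D (z - y) * KK ε y) (𝓝[>] 0)
        (𝓝 (∫ y, D (z - y) * (cc * y⁻¹))) := by
      apply tendsto_integral_filter_of_dominated_convergence
        (bound := fun y => (∫ t : ℂ, |dd t| * (‖t‖ ^ 2)⁻¹) * (‖D (z - y)‖ * ‖y‖⁻¹))
      · refine Eventually.of_forall fun ε => ?_
        have : StronglyMeasurable (KK ε) := by
          have hk := measurable_kk ε
          have : Measurable (Function.uncurry fun y w : ℂ => ((‖y - w‖⁻¹ : ℝ) : ℂ) * kk ε w) := by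
            unfold Function.uncurry; fun_prop
          exact this.stronglyMeasurable.integral_prod_right
        exact ((hDc.comp (by fun_prop : Continuous fun y => z - y)).aestronglyMeasurable).mul
          this.aestronglyMeasurable
      · filter_upwards [self_mem_nhdsWithin] with ε hε
        filter_upwards [ae_ne 0] with y hy
        rw [norm_mul]
        calc _ ≤ ‖D (z - y)‖ * _ := mul_le_mul_of_nonneg_left (KK_bd hε hy) (norm_nonneg _)
          _ = _ := by ring
      · exact (integrable_cc_mul hDc hDs z).const_mul _
      · filter_upwards [ae_ne 0] with y hy
        exact (KK_tendsto hy).const_mul _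
    have e : ∫ y, D (z - y) * (cc * y⁻¹) = a * dz f z := by
      have := pompeiu ((contDiff_dz hf).of_le (mod_cast le_top)) (hcs_dz hc) z
      have e2 : ∀ y, D (z - y) * (cc * y⁻¹) = cc * (db (dz f) (z - y) * y⁻¹) := fun y => by
        rw [hD, dz_db_comm hf]; ring
      simp only [e2]
      rw [integral_const_mul, this, ha]
      ring
    rw [← e]
    refine t1.congr' ?_
    filter_upwards [self_mem_nhdsWithin] with ε hε
    exact (kk_Lam hDc hDs hε z).symm
  have hfin : eLpNorm (fun z => a * dz f z) (ENNReal.ofReal p) volume ≤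
      C1 * (C2 * eLpNorm (db f) (ENNReal.ofReal p) volume) := by
    refine Lp.eLpNorm_le_of_ae_tendsto (u := 𝓝[>] (0:ℝ))
      (f := fun ε z => ∫ w, Lam D (z - w) * kk ε w) ?_ ?_ (Eventually.of_forall hlim)
    · filter_upwards [self_mem_nhdsWithin] with ε hε
      exact (h1 _ hm ε hε).trans (by gcongr)
    · intro ε
      refine (stronglyMeasurable_conv ?_ (measurable_kk ε)).aestronglyMeasurable
      exact (stronglyMeasurable_conv hDc.measurable (by fun_prop)).measurable
  have e : eLpNorm (fun z => a * dz f z) (ENNReal.ofReal p) volume =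
      ‖a‖ₑ * eLpNorm (dz f) (ENNReal.ofReal p) volume := by
    rw [← eLpNorm_const_smul]; rfl
  rw [e] at hfin
  calc eLpNorm (dz f) (ENNReal.ofReal p) volume
      = ‖a‖ₑ⁻¹ * (‖a‖ₑ * eLpNorm (dz f) (ENNReal.ofReal p) volume) := by
        rw [← mul_assoc, ENNReal.inv_mul_cancel ha1 enorm_ne_top, one_mul]
    _ ≤ ‖a‖ₑ⁻¹ * _ := mul_le_mul_right hfin _
    _ = _ := by ring

end CTW

namespace CTW
open Filter Topology

noncomputable def CT (g : ℂ → ℂ) (z : ℂ) : ℂ := (Real.pi : ℂ)⁻¹ * ∫ w, g (z - w) * w⁻¹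

lemma locInt_inv : LocallyIntegrable (fun w : ℂ => w⁻¹) :=
  locallyIntegrable_of_norm_le_rpow (C := 1) (α := 1) (by simp) (by simp)
    (Eventually.of_forall fun x => by rw [one_mul, norm_inv, Real.rpow_neg_one])
    (Measurable.aestronglyMeasurable (by fun_prop))

lemma CT_eq_conv (g : ℂ → ℂ) : CT g = fun z => (Real.pi : ℂ)⁻¹ *
    (convolution (fun w : ℂ => w⁻¹) g (ContinuousLinearMap.mul ℝ ℂ) volume) z := by
  ext z
  simp only [CT, convolution, ContinuousLinearMap.mul_apply']
  congr 2; ext w; ring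

lemma contDiff_CT {g : ℂ → ℂ} (hg : ContDiff ℝ (⊤ : ℕ∞) g) (hc : HasCompactSupport g) :
    ContDiff ℝ (⊤ : ℕ∞) (CT g) := by
  rw [CT_eq_conv]
  exact contDiff_const.mul (hc.contDiff_convolution_right _ locInt_inv hg)

lemma fderiv_CT {g : ℂ → ℂ} (hg : ContDiff ℝ 1 g) (hc : HasCompactSupport g) (z v : ℂ) :
    fderiv ℝ (CT g) z v = (Real.pi : ℂ)⁻¹ * ∫ w, fderiv ℝ g (z - w) v * w⁻¹ := by
  rw [CT_eq_conv]
  have h := (hc.hasFDerivAt_convolution_right (ContinuousLinearMap.mul ℝ ℂ) locInt_inv hg z).const_mul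
    ((Real.pi : ℂ)⁻¹)
  rw [h.fderiv]
  rw [ContinuousLinearMap.smul_apply, convolution_precompR_apply _ locInt_inv (hc.fderiv (𝕜 := ℝ))
    (hg.continuous_fderiv (by norm_num))]
  simp only [convolution, ContinuousLinearMap.mul_apply', smul_eq_mul]
  congr 2; ext w; ring

lemma integrable_cc_inv {ψ : ℂ → ℂ} (hψ : Continuous ψ) (hc : HasCompactSupport ψ) (z : ℂ) :
    Integrable (fun w => ψ (z - w) * w⁻¹) := by
  have := locInt_inv.integrable_smul_left_of_hasCompactSupport (g := fun w => ψ (z - w)) (by fun_prop)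
    (hcs_sub hc z)
  simpa using this

lemma db_CT {g : ℂ → ℂ} (hg : ContDiff ℝ 1 g) (hc : HasCompactSupport g) (z : ℂ) :
    db (CT g) z = g z := by
  have h := pompeiu hg hc z
  have hp : (Real.pi : ℂ) ≠ 0 := by exact_mod_cast Real.pi_ne_zero
  have c : ∀ v, Continuous fun w => fderiv ℝ g w v := fun v => by
    have := hg.continuous_fderiv (by norm_num); fun_prop
  have i1 := integrable_cc_inv (c 1) (hc.fderiv_apply (𝕜 := ℝ) 1) z
  have i2 := integrable_cc_inv (c Complex.I) (hc.fderiv_apply (𝕜 := ℝ) Complex.I) z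
  have e : ∫ w, db g (z - w) * w⁻¹ = (1/2 : ℂ) * ((∫ w, fderiv ℝ g (z - w) 1 * w⁻¹) +
      Complex.I * ∫ w, fderiv ℝ g (z - w) Complex.I * w⁻¹) := by
    rw [← integral_const_mul Complex.I, ← integral_add i1 (i2.const_mul _), ← integral_const_mul]
    congr 1; ext w; simp only [db]; ring
  rw [db, fderiv_CT hg hc, fderiv_CT hg hc]
  rw [h] at e
  field_simp at e ⊢
  rw [e]

lemma CT_sub {g h : ℂ → ℂ} (hg : Continuous g) (hgc : HasCompactSupport g)
    (hh : Continuous h) (hhc : HasCompactSupport h) (z : ℂ) :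
    CT (g - h) z = CT g z - CT h z := by
  unfold CT
  rw [← mul_sub, ← integral_sub (integrable_cc_inv hg hgc z) (integrable_cc_inv hh hhc z)]
  congr 2; ext w; simp only [Pi.sub_apply]; ring

/-- weighted measure -/
noncomputable def nu : Measure ℂ := (volume : Measure ℂ).withDensity (fun z => ‖z‖ₑ⁻¹)

lemma lintegral_nu {F : ℂ → ℝ≥0∞} (hF : Measurable F) :
    ∫⁻ z, F z ∂nu = ∫⁻ z, F z * ‖z‖ₑ⁻¹ := by
  unfold nu
  rw [lintegral_withDensity_eq_lintegral_mul _ (by fun_prop) hF]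
  congr 1; ext z; simp [mul_comm]

instance : SFinite nu := by unfold nu; infer_instance

lemma enorm_inv_eq {z : ℂ} (hz : z ≠ 0) : ‖z‖ₑ⁻¹ = ENNReal.ofReal (‖z‖⁻¹) := by
  rw [ENNReal.ofReal_inv_of_pos (by positivity), ofReal_norm]

lemma CT_sub_zero {g : ℂ → ℂ} (hg : Continuous g) (hc : HasCompactSupport g) {z : ℂ} (hz : z ≠ 0) :
    ‖CT g z - CT g 0‖ₑ * ‖z‖ₑ⁻¹ ≤
      ∫⁻ η, ‖g (z * η)‖ₑ * ENNReal.ofReal (‖η‖⁻¹ * ‖1 - η‖⁻¹) := by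
  have hpi : (Real.pi : ℂ) ≠ 0 := by exact_mod_cast Real.pi_ne_zero
  have j1 : Integrable (fun w => g w * (z - w)⁻¹) := by
    have := (integrable_cc_inv hg hc z).comp_sub_left z
    simpa using this
  have j2 : Integrable (fun w => g w * (0 - w)⁻¹) := by
    have := (integrable_cc_inv hg hc 0).comp_sub_left 0
    simpa using this
  have e1 : ∫ w, g (z - w) * w⁻¹ = ∫ w, g w * (z - w)⁻¹ := by
    rw [← integral_sub_left_eq_self _ volume z]; simp
  have e2 : ∫ w, g (0 - w) * w⁻¹ = ∫ w, g w * (0 - w)⁻¹ := by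
    rw [← integral_sub_left_eq_self _ volume 0]; simp
  have e3 : CT g z - CT g 0 = (Real.pi : ℂ)⁻¹ * (((‖z‖ ^ 2 : ℝ) : ℂ) *
      ∫ η, g (z * η) * (z⁻¹ * (η⁻¹ * (1 - η)⁻¹))) := by
    unfold CT
    rw [← mul_sub, e1, e2, ← integral_sub j1 j2, integral_comp_mulLeft hz]
    congr 2
    apply integral_congr_ae
    filter_upwards [ae_ne 0, ae_ne 1] with η h0 h1
    have h2 : (1 - η) ≠ 0 := sub_ne_zero.2 h1.symm
    have h3 : z - z * η = z * (1 - η) := by ring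
    rw [h3, zero_sub]
    field_simp
    ring
  rw [e3]
  have hz0 : ‖z‖ₑ ≠ 0 := by simpa using hz
  have hpi1 : ‖(Real.pi : ℂ)⁻¹‖ₑ ≤ 1 := by
    rw [← ofReal_norm, norm_inv, Complex.norm_real, Real.norm_of_nonneg Real.pi_pos.le]
    rw [ENNReal.ofReal_le_one]
    exact inv_le_one_of_one_le₀ (by linarith [Real.pi_gt_three])
  have hin : ‖∫ η, g (z * η) * (z⁻¹ * (η⁻¹ * (1 - η)⁻¹))‖ₑ ≤
      ‖z‖ₑ⁻¹ * ∫⁻ η, ‖g (z * η)‖ₑ * ENNReal.ofReal (‖η‖⁻¹ * ‖1 - η‖⁻¹) := by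
    refine (enorm_integral_le_lintegral_enorm _).trans ?_
    rw [← lintegral_const_mul' _ _ (by simpa using hz)]
    refine lintegral_mono fun η => le_of_eq ?_
    simp only [enorm_mul]
    rw [enorm_inv hz, ← ofReal_norm (η⁻¹), ← ofReal_norm ((1 - η)⁻¹), norm_inv, norm_inv,
      ENNReal.ofReal_mul (by positivity)]
    ring
  have hzz : ‖((‖z‖ ^ 2 : ℝ) : ℂ)‖ₑ = ‖z‖ₑ * ‖z‖ₑ := by
    rw [← ofReal_norm, Complex.norm_real, Real.norm_of_nonneg (by positivity), sq,
      ENNReal.ofReal_mul (by positivity), ofReal_norm]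
  rw [enorm_mul, enorm_mul, hzz]
  calc _ ≤ 1 * (‖z‖ₑ * ‖z‖ₑ * (‖z‖ₑ⁻¹ * ∫⁻ η, ‖g (z * η)‖ₑ * ENNReal.ofReal (‖η‖⁻¹ * ‖1 - η‖⁻¹)))
        * ‖z‖ₑ⁻¹ := by gcongr
    _ = (‖z‖ₑ * ‖z‖ₑ⁻¹) * (‖z‖ₑ * ‖z‖ₑ⁻¹) * ∫⁻ η, ‖g (z * η)‖ₑ * ENNReal.ofReal (‖η‖⁻¹ * ‖1 - η‖⁻¹) := by
        ring
    _ = _ := by rw [ENNReal.mul_inv_cancel hz0 enorm_ne_top]; simp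

/-- Hardy-type inequality -/
lemma hardy {p : ℝ} (hp : 2 < p) : ∃ C : ℝ≥0∞, C ≠ ⊤ ∧ ∀ g : ℂ → ℂ,
    Continuous g → HasCompactSupport g →
    ∫⁻ z, (‖CT g z - CT g 0‖ₑ * ‖z‖ₑ⁻¹) ^ p ∂nu ≤ C * ∫⁻ z, ‖g z‖ₑ ^ p ∂nu := by
  have hp0 : 0 < p := by linarith
  have hpi : 0 < 1 / p := by positivity
  have hpi1 : 1 / p < 1 := by rw [div_lt_one hp0]; linarith
  set k : ℂ → ℝ≥0∞ := fun η => ENNReal.ofReal (‖η‖ ^ (-(1 + 1/p)) * ‖1 - η‖⁻¹) with hk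
  have hkm : Measurable k := by fun_prop
  have hki : ∫⁻ η, k η ≠ ⊤ := by
    have := (integrable_two_sing (a := 1 + 1/p) (by linarith) (by linarith)).lintegral_lt_top
    exact this.ne
  refine ⟨(∫⁻ η, k η) ^ p, ENNReal.rpow_ne_top_of_nonneg hp0.le hki, fun g hg hc => ?_⟩
  set h : ℂ → ℂ → ℝ≥0∞ := fun η z => ‖g (z * η)‖ₑ * ENNReal.ofReal (‖η‖ ^ (1/p)) with hh
  have hgm := hg.measurable
  have hhm : Measurable (Function.uncurry h) := by
    simp only [hh]; unfold Function.uncurry; fun_prop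
  have hB : ∀ η, ∫⁻ z, h η z ^ p ∂nu ≤ ∫⁻ z, ‖g z‖ₑ ^ p ∂nu := by
    intro η
    rcases eq_or_ne η 0 with rfl | hη
    · simp [hh, hp0, hp0.ne']
    have hη0 : 0 < ‖η‖ := by positivity
    rw [lintegral_nu (by simp only [hh]; fun_prop), lintegral_nu (by fun_prop)]
    have e : ∀ z, z ≠ 0 → h η z ^ p * ‖z‖ₑ⁻¹ =
        ENNReal.ofReal (‖η‖ ^ 2) * (‖g (η * z)‖ₑ ^ p * ‖η * z‖ₑ⁻¹) := by
      intro z hz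
      simp only [hh]
      rw [ENNReal.mul_rpow_of_nonneg _ _ hp0.le, ENNReal.ofReal_rpow_of_nonneg (by positivity) hp0.le,
        ← Real.rpow_mul hη0.le, one_div_mul_cancel hp0.ne', Real.rpow_one, mul_comm z η,
        enorm_inv_eq hz, enorm_inv_eq (mul_ne_zero hη hz), norm_mul]
      have : ‖η‖ = ‖η‖ ^ 2 * ‖η‖⁻¹ := by field_simp
      calc _ = ‖g (η * z)‖ₑ ^ p * (ENNReal.ofReal ‖η‖ * ENNReal.ofReal (‖z‖⁻¹)) := by ring
        _ = ‖g (η * z)‖ₑ ^ p * (ENNReal.ofReal (‖η‖ ^ 2 * ‖η‖⁻¹) * ENNReal.ofReal (‖z‖⁻¹)) := by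
            rw [← this]
        _ = _ := by
            rw [mul_inv, ENNReal.ofReal_mul (by positivity), ENNReal.ofReal_mul (by positivity)]
            ring
    rw [lintegral_congr_ae ((ae_ne 0).mono e), lintegral_const_mul' _ _ ENNReal.ofReal_ne_top,
      lintegral_comp_mulLeft hη (fun w => ‖g w‖ₑ ^ p * ‖w‖ₑ⁻¹), ← mul_assoc,
      ← ENNReal.ofReal_mul (by positivity), mul_inv_cancel₀ (by positivity)]
    simp
  have hs := schur (μ := nu) (ν := (volume : Measure ℂ)) (p := p) (by linarith) hhm hkm hB
  refine le_trans ?_ hs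
  have hne : ∀ᵐ z ∂nu, z ≠ 0 := (withDensity_absolutelyContinuous _ _).ae_le (ae_ne 0)
  refine lintegral_mono_ae ?_
  filter_upwards [hne] with z hz
  refine ENNReal.rpow_le_rpow ((CT_sub_zero hg hc hz).trans (le_of_eq ?_)) hp0.le
  refine lintegral_congr_ae ((ae_ne 0).mono fun η hη => ?_)
  simp only [hh, hk]
  have hη0 : 0 < ‖η‖ := by positivity
  rw [mul_assoc, ← ENNReal.ofReal_mul (by positivity), ← mul_assoc, ← Real.rpow_add hη0]
  congr 3
  rw [← Real.rpow_neg_one]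
  congr 1
  ring

end CTW

namespace CTW
open Filter Topology

lemma exists_cutoff : ∃ χ : ℂ → ℂ, ContDiff ℝ (⊤ : ℕ∞) χ ∧ HasCompactSupport χ ∧
    (∀ z ∈ closedBall (0:ℂ) 1, χ z = 1) ∧ (∀ z, ‖χ z‖ ≤ 1) ∧ (∀ z, 2 ≤ ‖z‖ → χ z = 0) := by
  let b : ContDiffBump (0:ℂ) := ⟨1, 2, by norm_num, by norm_num⟩
  refine ⟨fun z => ((b z : ℝ) : ℂ), ?_, ?_, ?_, ?_, ?_⟩
  · exact Complex.ofRealCLM.contDiff.comp b.contDiff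
  · exact b.hasCompactSupport.comp_left (g := fun x : ℝ => (x : ℂ)) (by simp)
  · intro z hz; simp only [b.one_of_mem_closedBall hz]; simp
  · intro z
    rw [Complex.norm_real, Real.norm_of_nonneg b.nonneg]; exact b.le_one
  · intro z hz
    simp only [b.zero_of_le_dist (x := z) (by simpa using hz)]; simp

lemma wt_pow {p : ℝ} (hp : 0 < p) {z : ℂ} (hz : z ≠ 0) (x : ℝ≥0∞) :
    (ENNReal.ofReal (‖z‖ ^ (-(1/p))) * x) ^ p = x ^ p * ‖z‖ₑ⁻¹ := by
  have h0 : 0 < ‖z‖ := by positivity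
  rw [ENNReal.mul_rpow_of_nonneg _ _ hp.le, ENNReal.ofReal_rpow_of_nonneg (by positivity) hp.le,
    ← Real.rpow_mul h0.le, enorm_inv_eq hz, mul_comm]
  congr 2
  rw [← Real.rpow_neg_one]; congr 1; field_simp

/-- regularised weight -/
noncomputable def Wd (s η : ℝ) (z : ℂ) : ℂ := (((‖z‖ ^ 2 + η ^ 2) ^ (-(s / 2)) : ℝ) : ℂ)

lemma Wd_contDiff (s : ℝ) {η : ℝ} (hη : 0 < η) : ContDiff ℝ (⊤ : ℕ∞) (Wd s η) := by
  have := contDiff_radial (n := (⊤ : ℕ∞)) (φ := fun x : ℝ => (x + η ^ 2) ^ (-(s / 2))) (fun x hx => by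
    refine ContDiffAt.rpow_const_of_ne (by fun_prop) (by positivity))
  exact this

lemma Wd_norm {s η : ℝ} (hs : 0 ≤ s) {z : ℂ} (hz : z ≠ 0) : ‖Wd s η z‖ ≤ ‖z‖ ^ (-s) := by
  have h0 : 0 < ‖z‖ := by positivity
  rw [Wd, Complex.norm_real, Real.norm_of_nonneg (by positivity)]
  exact rpow_bd h0 hs

lemma Wd_der {s η : ℝ} (hs : 0 ≤ s) (hs1 : s ≤ 1) (hη : 0 < η) {z : ℂ} (hz : z ≠ 0) :
    ‖dz (Wd s η) z‖ ≤ ‖z‖ ^ (-s) * ‖z‖⁻¹ ∧ ‖db (Wd s η) z‖ ≤ ‖z‖ ^ (-s) * ‖z‖⁻¹ := by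
  have h0 : 0 < ‖z‖ := by positivity
  have hd : HasDerivAt (fun x : ℝ => (x + η ^ 2) ^ (-(s / 2)))
      (-(s/2) * (‖z‖ ^ 2 + η ^ 2) ^ (-(s/2) - 1)) (‖z‖ ^ 2) := by
    have := ((hasDerivAt_id (‖z‖ ^ 2)).add_const (η ^ 2)).rpow_const (p := -(s/2)) (Or.inl (by simp; positivity))
    exact this.congr_deriv (by simp)
  have key : |(-(s/2) * (‖z‖ ^ 2 + η ^ 2) ^ (-(s/2) - 1))| * ‖z‖ ≤ ‖z‖ ^ (-s) * ‖z‖⁻¹ := by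
    have b := rpow_bd (η := η) h0 (show 0 ≤ s + 2 by linarith)
    have e : -((s+2)/2) = -(s/2) - 1 := by ring
    rw [e] at b
    rw [abs_mul, abs_neg, abs_of_nonneg (by linarith : 0 ≤ s/2), abs_of_nonneg (by positivity)]
    calc _ ≤ 1 * ‖z‖ ^ (-(s+2)) * ‖z‖ := by gcongr; linarith
      _ = _ := by
        rw [one_mul, ← Real.rpow_neg_one ‖z‖, ← Real.rpow_add h0]
        conv_lhs => rw [← Real.rpow_one ‖z‖, ← Real.rpow_mul h0.le, ← Real.rpow_add h0]
        congr 1; ring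
  constructor
  · have := dz_radial hd
    rw [show Wd s η = fun w => (((‖w‖ ^ 2 + η ^ 2) ^ (-(s / 2)) : ℝ) : ℂ) from rfl, this, norm_mul,
      Complex.norm_real, RCLike.norm_conj]
    exact key
  · have := db_radial hd
    rw [show Wd s η = fun w => (((‖w‖ ^ 2 + η ^ 2) ^ (-(s / 2)) : ℝ) : ℂ) from rfl, this, norm_mul,
      Complex.norm_real]
    exact key

lemma dz_sub_const (f : ℂ → ℂ) (c z : ℂ) : dz (fun w => f w - c) z = dz f z := by
  simp [dz, fderiv_sub_const]
lemma db_sub_const (f : ℂ → ℂ) (c z : ℂ) : db (fun w => f w - c) z = db f z := by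
  simp [db, fderiv_sub_const]

lemma exists_bd {h : ℂ → ℂ} (hh : Continuous h) (hc : HasCompactSupport h) :
    ∃ M : ℝ, 0 ≤ M ∧ ∀ z, z ≠ 0 → ‖h z‖ ≤ M * ‖z‖⁻¹ := by
  obtain ⟨M, hM⟩ := HasCompactSupport.exists_bound_of_continuous (f := fun z => h z * z)
    (hc.mul_right) (by fun_prop)
  refine ⟨M, (norm_nonneg _).trans (hM 0), fun z hz => ?_⟩
  have := hM z
  rw [norm_mul] at this
  rw [← div_eq_mul_inv, le_div_iff₀ (by positivity)]
  exact this

end CTW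

namespace CTW
open Filter Topology

lemma dz_CT_bound {p : ℝ} (hp : 2 < p) : ∃ C : ℝ≥0∞, C ≠ ⊤ ∧ ∀ g : ℂ → ℂ,
    ContDiff ℝ (⊤ : ℕ∞) g → HasCompactSupport g →
    eLpNorm (dz (CT g)) (ENNReal.ofReal p) (nu.restrict (ball 0 1)) ≤
      C * eLpNorm g (ENNReal.ofReal p) nu := by
  have hp0 : 0 < p := by linarith
  have hp1 : (1 : ℝ≥0∞) ≤ ENNReal.ofReal p := by
    rw [ENNReal.one_le_ofReal]; linarith
  obtain ⟨C1, hC1, hdz⟩ := dz_le_db hp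
  obtain ⟨C2, hC2, hhardy⟩ := hardy hp
  obtain ⟨χ, hχ, hχc, hχ1, hχn, hχ0⟩ := exists_cutoff
  obtain ⟨M1, hM1, hb1⟩ := exists_bd (continuous_dz (hχ.of_le (mod_cast le_top))) (hcs_dz hχc)
  obtain ⟨M2, hM2, hb2⟩ := exists_bd (continuous_db (hχ.of_le (mod_cast le_top))) (hcs_db hχc)
  set s : ℝ := 1 / p with hs
  have hs0 : 0 ≤ s := by positivity
  have hs1 : s ≤ 1 := by rw [hs, div_le_one hp0]; linarith
  set K1 : ℝ≥0∞ := ENNReal.ofReal (M1 + 1) with hK1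
  set K2 : ℝ≥0∞ := ENNReal.ofReal (M2 + 1) with hK2
  set D : ℝ≥0∞ := C2 ^ (1/p) with hD
  have hDt : D ≠ ⊤ := ENNReal.rpow_ne_top_of_nonneg (by positivity) hC2
  refine ⟨C1 * (K2 * D + 1) + K1 * D, by finiteness, fun g hg hgc => ?_⟩
  have hf := contDiff_CT hg hgc
  set f := CT g with hfdef
  set h : ℂ → ℂ := fun w => f w - f 0 with hh
  have hhs : ContDiff ℝ (⊤ : ℕ∞) h := hf.sub contDiff_const
  have hgm := hg.continuous.measurable
  have hhm := hhs.continuous.measurable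
  -- real auxiliary functions
  set A : ℂ → ℝ := fun z => ‖z‖ ^ (-s) * ‖z‖⁻¹ * ‖h z‖ with hA
  set B : ℂ → ℝ := fun z => ‖z‖ ^ (-s) * ‖g z‖ with hB
  have hAm : Measurable A := by fun_prop
  have hBm : Measurable B := by fun_prop
  have hAn : eLpNorm A (ENNReal.ofReal p) volume ≤ D * eLpNorm g (ENNReal.ofReal p) nu := by
    refine eLpNorm_le_of_rpow hp0 (le_trans (le_of_eq ?_) (hhardy g hg.continuous hgc))
    have hfm : Measurable (CT g) := hf.continuous.measurable
    rw [lintegral_nu (by fun_prop)]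
    refine lintegral_congr_ae ((ae_ne 0).mono fun z hz => ?_)
    have h0 : 0 < ‖z‖ := by positivity
    simp only []
    rw [← wt_pow hp0 hz]
    congr 1
    rw [enorm_inv_eq hz, ← ofReal_norm (f z - f 0), ← ENNReal.ofReal_mul (by positivity),
      ← ENNReal.ofReal_mul (by positivity), ← ofReal_norm, Real.norm_of_nonneg (by positivity)]
    congr 1
    simp only [hA, hh, hs]; ring
  have hBn : eLpNorm B (ENNReal.ofReal p) volume ≤ eLpNorm g (ENNReal.ofReal p) nu := by
    have := eLpNorm_le_of_rpow (μ := volume) (ν := nu) (f := B) (g := g) (C := 1) hp0 (by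
      rw [one_mul, lintegral_nu (by fun_prop)]
      refine le_of_eq (lintegral_congr_ae ((ae_ne 0).mono fun z hz => ?_))
      have h0 : 0 < ‖z‖ := by positivity
      simp only []
      rw [← wt_pow hp0 hz]
      congr 1
      rw [← ofReal_norm (g z), ← ENNReal.ofReal_mul (by positivity), ← ofReal_norm,
        Real.norm_of_nonneg (by positivity)])
    simpa using this
  set X := eLpNorm g (ENNReal.ofReal p) nu with hX
  -- the key estimate for each η
  have key : ∀ η : ℝ, 0 < η → eLpNorm (fun z => Wd s η z * dz f z) (ENNReal.ofReal p)
      (volume.restrict (ball 0 1)) ≤ (C1 * (K2 * D + 1) + K1 * D) * X := by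
    intro η hη
    have hW := Wd_contDiff s hη
    set F : ℂ → ℂ := fun z => (χ z * Wd s η z) * h z with hF
    have hFs : ContDiff ℝ (⊤ : ℕ∞) F := (hχ.mul hW).mul hhs
    have hFc : HasCompactSupport F := (hχc.mul_right).mul_right
    have dχ : Differentiable ℝ χ := hχ.differentiable (by simp)
    have dW : Differentiable ℝ (Wd s η) := hW.differentiable (by simp)
    have dh : Differentiable ℝ h := hhs.differentiable (by simp)
    have dχW : Differentiable ℝ (fun z => χ z * Wd s η z) := dχ.mul dW
    have e1 : ∀ z, dz F z = (dz χ z * Wd s η z + χ z * dz (Wd s η) z) * h z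
        + χ z * Wd s η z * dz f z := by
      intro z
      rw [hF, dz_mul (dχW z) (dh z), dz_mul (dχ z) (dW z), hh, dz_sub_const]
    have e2 : ∀ z, db F z = (db χ z * Wd s η z + χ z * db (Wd s η) z) * h z
        + χ z * Wd s η z * g z := by
      intro z
      rw [hF, db_mul (dχW z) (dh z), db_mul (dχ z) (dW z), hh, db_sub_const, hfdef,
        db_CT (hg.of_le (mod_cast le_top)) hgc]
    have aux : ∀ (a b : ℂ) (M : ℝ) (z : ℂ), z ≠ 0 → 0 ≤ M → ‖a‖ ≤ M * ‖z‖⁻¹ →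
        ‖b‖ ≤ ‖z‖ ^ (-s) * ‖z‖⁻¹ → ‖(a * Wd s η z + χ z * b) * h z‖ ≤ (M + 1) * A z := by
      intro a b M z hz hM ha hb
      have hw := Wd_norm (η := η) hs0 hz
      rw [norm_mul]
      calc _ ≤ (M * ‖z‖⁻¹ * ‖z‖ ^ (-s) + 1 * (‖z‖ ^ (-s) * ‖z‖⁻¹)) * ‖h z‖ := by
            gcongr
            refine (norm_add_le _ _).trans ?_
            rw [norm_mul, norm_mul]
            gcongr
            exact hχn z
        _ = _ := by simp only [hA]; ring
    have b2 : eLpNorm (db F) (ENNReal.ofReal p) volume ≤ (K2 * D + 1) * X := by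
      have : eLpNorm (db F) (ENNReal.ofReal p) volume ≤
          eLpNorm ((M2 + 1) • A + B) (ENNReal.ofReal p) volume := by
        refine eLpNorm_mono_ae ((ae_ne 0).mono fun z hz => ?_)
        refine le_trans ?_ (le_abs_self _)
        simp only [Pi.add_apply, Pi.smul_apply, smul_eq_mul]
        rw [e2]
        refine (norm_add_le _ _).trans (add_le_add (aux _ _ M2 z hz hM2 (hb2 z hz)
          (Wd_der hs0 hs1 hη hz).2) ?_)
        rw [norm_mul, norm_mul]
        have hw := Wd_norm (η := η) hs0 hz
        calc _ ≤ 1 * ‖z‖ ^ (-s) * ‖g z‖ := by gcongr; exact hχn z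
          _ = _ := by rw [one_mul]
      refine this.trans ((eLpNorm_add_le (hAm.const_smul _).aestronglyMeasurable
        hBm.aestronglyMeasurable hp1).trans ?_)
      rw [eLpNorm_const_smul, ← ofReal_norm, Real.norm_of_nonneg (by linarith)]
      calc _ ≤ K2 * (D * X) + X := by gcongr
        _ = _ := by ring
    have hdzF : Continuous (dz F) := continuous_dz (hFs.of_le (mod_cast le_top))
    have : eLpNorm (fun z => Wd s η z * dz f z) (ENNReal.ofReal p) (volume.restrict (ball 0 1)) ≤
        eLpNorm ((fun z => ‖dz F z‖) + (M1 + 1) • A) (ENNReal.ofReal p)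
          (volume.restrict (ball 0 1)) := by
      refine eLpNorm_mono_ae ?_
      filter_upwards [ae_restrict_mem measurableSet_ball, ae_restrict_of_ae (ae_ne 0)] with z hz1 hz
      refine le_trans ?_ (le_abs_self _)
      simp only [Pi.add_apply, Pi.smul_apply, smul_eq_mul]
      have hx1 := hχ1 z (ball_subset_closedBall hz1)
      have : Wd s η z * dz f z = dz F z - (dz χ z * Wd s η z + χ z * dz (Wd s η) z) * h z := by
        rw [e1, hx1]; ring
      rw [this]
      refine (norm_sub_le _ _).trans (add_le_add le_rfl ?_)
      exact aux _ _ M1 z hz hM1 (hb1 z hz) (Wd_der hs0 hs1 hη hz).1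
    refine this.trans ((eLpNorm_mono_measure _ Measure.restrict_le_self).trans
      ((eLpNorm_add_le hdzF.norm.aestronglyMeasurable
      (hAm.const_smul _).aestronglyMeasurable hp1).trans ?_))
    rw [eLpNorm_const_smul, ← ofReal_norm, Real.norm_of_nonneg (by linarith), eLpNorm_norm]
    calc _ ≤ C1 * ((K2 * D + 1) * X) + K1 * (D * X) := by
          gcongr
          exact (hdz F hFs hFc).trans (by gcongr)
      _ = _ := by ring
  have hdzf : Continuous (dz f) := continuous_dz (hf.of_le (mod_cast le_top))
  have lim : eLpNorm (fun z => ((‖z‖ ^ (-s) : ℝ) : ℂ) * dz f z) (ENNReal.ofReal p)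
      (volume.restrict (ball 0 1)) ≤ (C1 * (K2 * D + 1) + K1 * D) * X := by
    refine Lp.eLpNorm_le_of_ae_tendsto (u := 𝓝[>] (0:ℝ)) (f := fun η z => Wd s η z * dz f z) ?_ ?_ ?_
    · exact eventually_mem_nhdsWithin.mono fun η hη => key η hη
    · intro η
      have := hdzf.measurable
      refine Measurable.aestronglyMeasurable ?_
      unfold Wd; fun_prop
    · refine ae_restrict_of_ae ((ae_ne 0).mono fun z hz => ?_)
      have h0 : 0 < ‖z‖ := by positivity
      refine Tendsto.mul_const _ ?_
      exact (Complex.continuous_ofReal.tendsto _).comp (rpow_lim h0 s)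
  refine le_trans ?_ lim
  have := eLpNorm_le_of_rpow (μ := nu.restrict (ball 0 1)) (ν := volume.restrict (ball 0 1))
    (f := dz f) (g := fun z => ((‖z‖ ^ (-s) : ℝ) : ℂ) * dz f z) (C := 1) hp0 (by
      have hm := hdzf.measurable
      rw [one_mul, ← lintegral_indicator measurableSet_ball, lintegral_nu (by
        exact Measurable.indicator (by fun_prop) measurableSet_ball),
        ← lintegral_indicator measurableSet_ball]
      refine le_of_eq (lintegral_congr_ae ((ae_ne 0).mono fun z hz => ?_))
      by_cases hzb : z ∈ ball (0:ℂ) 1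
      · simp only [hzb, indicator_of_mem]
        rw [← wt_pow hp0 hz, enorm_mul]
        congr 2
        rw [← ofReal_norm, Complex.norm_real, Real.norm_of_nonneg (by positivity)]
      · simp [hzb])
  simpa using this

end CTW

namespace CTW
open Filter Topology

instance : IsFiniteMeasureOnCompacts nu := by
  refine ⟨fun K hK => ?_⟩
  unfold nu
  rw [withDensity_apply']
  have h := (locallyIntegrable_iff.1 locInt_inv) K hK
  have h2 : ∫⁻ z in K, ‖z⁻¹‖ₑ < ⊤ := h.2
  refine lt_of_le_of_lt (le_of_eq ?_) h2
  refine lintegral_congr_ae (ae_restrict_of_ae ((ae_ne 0).mono fun z hz => ?_))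
  simp only []
  rw [enorm_inv hz]

/-- weighted measure on the disc -/
noncomputable def nub : Measure ℂ := nu.restrict (ball 0 1)

lemma lintegral_nub {F : ℂ → ℝ≥0∞} (hF : Measurable F) :
    ∫⁻ z, F z ∂nub = ∫⁻ z in ball (0:ℂ) 1, F z * ‖z‖ₑ⁻¹ := by
  unfold nub nu
  rw [restrict_withDensity measurableSet_ball,
    lintegral_withDensity_eq_lintegral_mul _ (by fun_prop) hF]
  congr 1; ext z; simp [mul_comm]

lemma nub_univ : nub univ ≠ ⊤ := by
  unfold nub
  rw [Measure.restrict_apply_univ]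
  exact ((measure_mono ball_subset_closedBall).trans_lt
    (isCompact_closedBall (0:ℂ) 1).measure_lt_top).ne

lemma vol_le_nub : (volume : Measure ℂ).restrict (ball 0 1) ≤ nub := by
  unfold nub nu
  rw [restrict_withDensity measurableSet_ball]
  conv_lhs => rw [← withDensity_one (μ := (volume : Measure ℂ).restrict (ball 0 1))]
  refine withDensity_mono ?_
  filter_upwards [ae_restrict_mem measurableSet_ball] with z hz
  simp only [Pi.one_apply]
  rw [ENNReal.one_le_inv, ← ofReal_norm, ENNReal.ofReal_le_one]
  exact (mem_ball_zero_iff.1 hz).le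

lemma eLpNorm_vol_le_nu {p : ℝ} (hp : 0 < p) {h : ℂ → ℂ} (hm : Measurable h)
    (h0 : ∀ z, 2 ≤ ‖z‖ → h z = 0) :
    eLpNorm h (ENNReal.ofReal p) volume ≤ 2 ^ (1/p) * eLpNorm h (ENNReal.ofReal p) nu := by
  refine eLpNorm_le_of_rpow hp ?_
  rw [lintegral_nu (by fun_prop), ← lintegral_const_mul' _ _ (by simp)]
  refine lintegral_mono fun z => ?_
  by_cases hz : 2 ≤ ‖z‖
  · rw [h0 z hz]; simp [hp]
  · have : (1 : ℝ≥0∞) ≤ 2 * ‖z‖ₑ⁻¹ := by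
      rw [← div_eq_mul_inv, ENNReal.le_div_iff_mul_le (by simp) (by simp), one_mul, ← ofReal_norm]
      rw [ENNReal.ofReal_le_iff_le_toReal (by simp)]
      simp; linarith
    calc ‖h z‖ₑ ^ p = ‖h z‖ₑ ^ p * 1 := by rw [mul_one]
      _ ≤ ‖h z‖ₑ ^ p * (2 * ‖z‖ₑ⁻¹) := by gcongr
      _ = _ := by ring

lemma sup_bound {p : ℝ} (hp : 2 < p) : ∃ K : ℝ≥0∞, K ≠ ⊤ ∧ ∀ h : ℂ → ℂ, Measurable h →
    (∀ z, 2 ≤ ‖z‖ → h z = 0) → ∀ z ∈ closedBall (0:ℂ) 1,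
    ∫⁻ w, ‖h (z - w) * w⁻¹‖ₑ ≤ K * eLpNorm h (ENNReal.ofReal p) nu := by
  have hp0 : 0 < p := by linarith
  set q : ℝ := p / (p - 1) with hq
  have hq0 : 0 < q := div_pos hp0 (by linarith)
  have hq2 : q < 2 := by rw [hq, div_lt_iff₀ (by linarith)]; linarith
  set k : ℂ → ℂ := (closedBall (0:ℂ) 3).indicator (fun w => w⁻¹) with hk
  have hkm : Measurable k := Measurable.indicator (by fun_prop) measurableSet_closedBall
  have hkf : eLpNorm k (ENNReal.ofReal q) volume ≠ ⊤ := by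
    have hi := (intOn_rpow hq2 0 (isCompact_closedBall (0:ℂ) 3)).2
    have h2 : eLpNorm k (ENNReal.ofReal q) volume ^ q ≠ ⊤ := by
      rw [eLpNorm_rpow hq0]
      refine (lt_of_le_of_lt (le_of_eq ?_) hi).ne
      rw [← lintegral_indicator measurableSet_closedBall]
      refine lintegral_congr_ae ((ae_ne 0).mono fun z hz => ?_)
      by_cases hzb : z ∈ closedBall (0:ℂ) 3
      · simp only [hk, hzb, indicator_of_mem, sub_zero]
        rw [← ofReal_norm, ← ofReal_norm, ENNReal.ofReal_rpow_of_nonneg (by positivity) hq0.le,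
          norm_inv, Real.norm_of_nonneg (by positivity), Real.rpow_neg (by positivity),
          Real.inv_rpow (by positivity)]
      · simp [hk, hzb, hq0]
    intro h; rw [h] at h2; exact h2 (ENNReal.top_rpow_of_pos hq0)
  refine ⟨2 ^ (1/p) * eLpNorm k (ENNReal.ofReal q) volume, ENNReal.mul_ne_top
    (ENNReal.rpow_ne_top_of_nonneg (by positivity) (by simp)) hkf, fun h hm h0 z hz => ?_⟩
  have e : ∀ w, h (z - w) * w⁻¹ = h (z - w) * k w := by
    intro w
    by_cases hw : w ∈ closedBall (0:ℂ) 3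
    · simp [hk, hw]
    · have : h (z - w) = 0 := by
        apply h0
        simp at hw hz
        have := norm_sub_norm_le w z
        rw [norm_sub_rev]; linarith
      simp [this]
  simp only [e]
  refine (holder_enorm (p := p) (by linarith) (Measurable.aestronglyMeasurable (by fun_prop))
    hkm.aestronglyMeasurable).trans ?_
  rw [eLpNorm_sub_left hm.aestronglyMeasurable]
  calc _ ≤ (2 ^ (1/p) * eLpNorm h (ENNReal.ofReal p) nu) * eLpNorm k (ENNReal.ofReal q) volume := by
        gcongr; exact eLpNorm_vol_le_nu hp0 hm h0
    _ = _ := by ring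

lemma CT_le (h : ℂ → ℂ) (z : ℂ) : ‖CT h z‖ₑ ≤ ∫⁻ w, ‖h (z - w) * w⁻¹‖ₑ := by
  have hpi1 : ‖(Real.pi : ℂ)⁻¹‖ₑ ≤ 1 := by
    rw [← ofReal_norm, norm_inv, Complex.norm_real, Real.norm_of_nonneg Real.pi_pos.le]
    rw [ENNReal.ofReal_le_one]
    exact inv_le_one_of_one_le₀ (by linarith [Real.pi_gt_three])
  unfold CT
  rw [enorm_mul]
  calc _ ≤ 1 * ∫⁻ w, ‖h (z - w) * w⁻¹‖ₑ := by
        gcongr; exact enorm_integral_le_lintegral_enorm _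
    _ = _ := one_mul _

lemma statement_eq_CT (g : ℂ → ℂ) (z : ℂ) :
    -(Real.pi : ℂ)⁻¹ * ∫ w in ball (0:ℂ) 1, g w / (w - z) = CT ((ball (0:ℂ) 1).indicator g) z := by
  unfold CT
  have e1 : ∫ w, (ball (0:ℂ) 1).indicator g (z - w) * w⁻¹ =
      ∫ w, (ball (0:ℂ) 1).indicator g w * (z - w)⁻¹ := by
    rw [← integral_sub_left_eq_self _ volume z]; simp
  rw [e1, neg_mul, ← mul_neg, ← integral_neg, ← integral_indicator measurableSet_ball]
  congr 2; ext w
  by_cases hw : w ∈ ball (0:ℂ) 1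
  · simp only [hw, indicator_of_mem]
    rw [div_eq_mul_inv, ← neg_sub z w, inv_neg]; ring
  · simp [hw]

lemma approx {p : ℝ} (hp : 2 < p) {g : ℂ → ℂ} (hg : MemLp g (ENNReal.ofReal p) nu)
    (h0 : ∀ z, z ∉ ball (0:ℂ) 1 → g z = 0) {ε : ℝ} (hε : 0 < ε) :
    ∃ γ : ℂ → ℂ, ContDiff ℝ (⊤ : ℕ∞) γ ∧ HasCompactSupport γ ∧ (∀ z, 2 ≤ ‖z‖ → γ z = 0) ∧
      eLpNorm (γ - g) (ENNReal.ofReal p) nu ≤ ENNReal.ofReal ε := by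
  obtain ⟨χ, hχ, hχc, hχ1, hχn, hχ0⟩ := exists_cutoff
  obtain ⟨γ, hc, hs, hb⟩ := MemLp.exist_eLpNorm_sub_le (p := ENNReal.ofReal p) (by simp)
    (by rw [ENNReal.one_le_ofReal]; linarith) hg hε
  refine ⟨fun z => χ z * γ z, hχ.mul hs, hχc.mul_right, fun z hz => by simp [hχ0 z hz], ?_⟩
  rw [eLpNorm_sub_comm]
  refine le_trans (eLpNorm_mono fun z => ?_) hb
  have : (g - fun z => χ z * γ z) z = χ z * (g - γ) z := by
    simp only [Pi.sub_apply]
    by_cases hz : z ∈ ball (0:ℂ) 1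
    · rw [hχ1 z (ball_subset_closedBall hz)]; ring
    · rw [h0 z hz]; ring
  rw [this, norm_mul]
  calc _ ≤ 1 * ‖(g - γ) z‖ := by gcongr; exact hχn z
    _ = _ := one_mul _

lemma tendsto_pair {p : ℝ} (hp : 2 < p) {μ : Measure ℂ} {a : ℕ → ℂ → ℂ} {b φ : ℂ → ℂ}
    (ha : ∀ n, MemLp (a n) (ENNReal.ofReal p) μ) (hb : MemLp b (ENNReal.ofReal p) μ)
    (hφ : MemLp φ (ENNReal.ofReal (p / (p - 1))) μ)
    (h : Tendsto (fun n => eLpNorm (a n - b) (ENNReal.ofReal p) μ) atTop (𝓝 0)) :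
    Tendsto (fun n => ∫ z, a n z * φ z ∂μ) atTop (𝓝 (∫ z, b z * φ z ∂μ)) := by
  have hp1 : 1 < p := by linarith
  refine tendsto_integral_of_L1 _ (hb.1.mul hφ.1)
    (Eventually.of_forall fun n => holder_integrable hp1 (ha n) hφ) ?_
  have h2 := ENNReal.Tendsto.mul_const (b := eLpNorm φ (ENNReal.ofReal (p / (p - 1))) μ) h
    (Or.inr hφ.2.ne)
  rw [zero_mul] at h2
  refine tendsto_of_tendsto_of_tendsto_of_le_of_le tendsto_const_nhds h2 (fun _ => bot_le) fun n => ?_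
  have := holder_enorm hp1 ((ha n).1.sub hb.1) hφ.1
  refine le_trans (le_of_eq ?_) this
  congr 1; ext z; simp only [Pi.sub_apply]; rw [sub_mul]; rfl

end CTW

namespace CTW
open Filter Topology

lemma smooth_pair {γ φ : ℂ → ℂ} (hγ : ContDiff ℝ (⊤ : ℕ∞) γ) (hγc : HasCompactSupport γ)
    (hφ : ContDiff ℝ (⊤ : ℕ∞) φ) (hφc : HasCompactSupport φ) (hs : tsupport φ ⊆ ball (0:ℂ) 1) :
    (∫ z in ball (0:ℂ) 1, CT γ z * dz φ z = -∫ z in ball (0:ℂ) 1, dz (CT γ) z * φ z) ∧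
    (∫ z in ball (0:ℂ) 1, CT γ z * db φ z = -∫ z in ball (0:ℂ) 1, γ z * φ z) := by
  have hf := contDiff_CT hγ hγc
  have z0 : ∀ z, z ∉ ball (0:ℂ) 1 → φ z = 0 := fun z hz =>
    image_eq_zero_of_notMem_tsupport fun h => hz (hs h)
  have z1 : ∀ z, z ∉ ball (0:ℂ) 1 → fderiv ℝ φ z = 0 := fun z hz => by
    by_contra h
    exact hz (hs (support_fderiv_subset ℝ h))
  have i1 := ibp_dz (hφ.of_le (mod_cast le_top)) hφc (N := CT γ) (hf.of_le (mod_cast le_top))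
  have i2 := ibp_db (hφ.of_le (mod_cast le_top)) hφc (N := CT γ) (hf.of_le (mod_cast le_top))
  simp only [db_CT (hγ.of_le (mod_cast le_top)) hγc] at i2
  rw [setIntegral_eq_integral_of_forall_compl_eq_zero, setIntegral_eq_integral_of_forall_compl_eq_zero,
    setIntegral_eq_integral_of_forall_compl_eq_zero, setIntegral_eq_integral_of_forall_compl_eq_zero]
  · constructor
    · simpa only [mul_comm] using i1
    · simpa only [mul_comm] using i2
  · intro z hz; simp [z0 z hz]
  · intro z hz; simp [db, z1 z hz]
  · intro z hz; simp [z0 z hz]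
  · intro z hz; simp [dz, z1 z hz]

lemma dz_sub {f g : ℂ → ℂ} {z : ℂ} (hf : DifferentiableAt ℝ f z) (hg : DifferentiableAt ℝ g z) :
    dz (fun w => f w - g w) z = dz f z - dz g z := by
  simp only [dz]
  rw [fderiv_fun_sub hf hg]
  simp only [ContinuousLinearMap.sub_apply]; ring

lemma main_aux {p : ℝ} (hp : 2 < p) : ∃ K C : ℝ≥0∞, K ≠ ⊤ ∧ C ≠ ⊤ ∧ ∀ g : ℂ → ℂ, Measurable g →
    (∀ z, z ∉ ball (0:ℂ) 1 → g z = 0) → MemLp g (ENNReal.ofReal p) nu →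
    ContinuousOn (CT g) (closedBall (0:ℂ) 1) ∧
    (∀ z ∈ closedBall (0:ℂ) 1, ‖CT g z‖ₑ ≤ K * eLpNorm g (ENNReal.ofReal p) nu) ∧
    ∃ u : ℂ → ℂ, Measurable u ∧
      eLpNorm u (ENNReal.ofReal p) nub ≤ C * eLpNorm g (ENNReal.ofReal p) nu ∧
      ∀ φ : ℂ → ℂ, ContDiff ℝ (⊤ : ℕ∞) φ → HasCompactSupport φ → tsupport φ ⊆ ball (0:ℂ) 1 →
        (∫ z in ball (0:ℂ) 1, CT g z * dz φ z = -∫ z in ball (0:ℂ) 1, u z * φ z) ∧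
        (∫ z in ball (0:ℂ) 1, CT g z * db φ z = -∫ z in ball (0:ℂ) 1, g z * φ z) := by
  obtain ⟨K, hK, hsup⟩ := sup_bound hp
  obtain ⟨C, hC, hdz⟩ := dz_CT_bound hp
  have hp0 : 0 < p := by linarith
  have hp1 : (1 : ℝ≥0∞) ≤ ENNReal.ofReal p := by
    rw [ENNReal.one_le_ofReal]; linarith
  refine ⟨K, C, hK, hC, fun g hgm hg0 hg => ?_⟩
  have hg2 : ∀ z : ℂ, 2 ≤ ‖z‖ → g z = 0 := fun z hz => hg0 z (by simp; linarith)
  have hgi : ∀ z ∈ closedBall (0:ℂ) 1, Integrable (fun w => g (z - w) * w⁻¹) := fun z hz =>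
    ⟨Measurable.aestronglyMeasurable (by fun_prop),
      lt_of_le_of_lt (hsup g hgm hg2 z hz) (ENNReal.mul_lt_top hK.lt_top hg.2)⟩
  have hb : ∀ z ∈ closedBall (0:ℂ) 1, ‖CT g z‖ₑ ≤ K * eLpNorm g (ENNReal.ofReal p) nu :=
    fun z hz => (CT_le g z).trans (hsup g hgm hg2 z hz)
  -- approximating sequence
  have hex : ∀ n : ℕ, ∃ γ : ℂ → ℂ, ContDiff ℝ (⊤ : ℕ∞) γ ∧ HasCompactSupport γ ∧
      (∀ z, 2 ≤ ‖z‖ → γ z = 0) ∧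
      eLpNorm (γ - g) (ENNReal.ofReal p) nu ≤ (1/2 : ℝ≥0∞) ^ n := by
    intro n
    obtain ⟨γ, h1, h2, h3, h4⟩ := approx hp hg hg0 (ε := (1/2) ^ n) (by positivity)
    refine ⟨γ, h1, h2, h3, h4.trans (le_of_eq ?_)⟩
    rw [ENNReal.ofReal_pow (by norm_num), ENNReal.ofReal_div_of_pos (by norm_num)]
    simp
  choose γ hγ hγc hγ0 hγn using hex
  have hlim0 : Tendsto (fun n : ℕ => (1/2 : ℝ≥0∞) ^ n) atTop (𝓝 0) :=
    ENNReal.tendsto_pow_atTop_nhds_zero_of_lt_one (by simp)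
  have hγg : Tendsto (fun n => eLpNorm (γ n - g) (ENNReal.ofReal p) nu) atTop (𝓝 0) :=
    tendsto_of_tendsto_of_tendsto_of_le_of_le tendsto_const_nhds hlim0 (fun _ => bot_le) hγn
  have hγL : ∀ n, MemLp (γ n) (ENNReal.ofReal p) nu := fun n =>
    (hγ n).continuous.memLp_of_hasCompactSupport (hγc n)
  have hdiff : ∀ n, ∀ z ∈ closedBall (0:ℂ) 1, ‖CT (γ n) z - CT g z‖ₑ ≤ K * (1/2 : ℝ≥0∞) ^ n := by
    intro n z hz
    have e : CT (γ n) z - CT g z = CT (γ n - g) z := by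
      unfold CT
      rw [← mul_sub, ← integral_sub (integrable_cc_inv (hγ n).continuous (hγc n) z) (hgi z hz)]
      congr 2; ext w; simp only [Pi.sub_apply]; ring
    rw [e]
    refine (CT_le _ _).trans ((hsup _ ((hγ n).continuous.measurable.sub hgm) (fun z hz => by
      simp [hγ0 n z hz, hg2 z hz]) z hz).trans ?_)
    gcongr; exact hγn n
  have hKlim : Tendsto (fun n : ℕ => K * (1/2 : ℝ≥0∞) ^ n) atTop (𝓝 0) := by
    have := ENNReal.Tendsto.const_mul (a := K) hlim0 (Or.inr hK)
    simpa using this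
  have hcont : ContinuousOn (CT g) (closedBall (0:ℂ) 1) := by
    have hu : TendstoUniformlyOn (fun n => CT (γ n)) (CT g) atTop (closedBall (0:ℂ) 1) := by
      rw [EMetric.tendstoUniformlyOn_iff]
      intro ε hε
      filter_upwards [hKlim.eventually_lt_const hε] with n hn z hz
      rw [edist_comm, edist_eq_enorm_sub]
      exact (hdiff n z hz).trans_lt hn
    exact hu.continuousOn (Frequently.of_forall fun n =>
      (contDiff_CT (hγ n) (hγc n)).continuous.continuousOn)
  -- derivative sequence
  have hUs : ∀ n, Continuous (dz (CT (γ n))) := fun n =>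
    continuous_dz ((contDiff_CT (hγ n) (hγc n)).of_le (mod_cast le_top))
  have hU : ∀ n, MemLp (dz (CT (γ n))) (ENNReal.ofReal p) nub := fun n =>
    ⟨(hUs n).aestronglyMeasurable, lt_of_le_of_lt (hdz _ (hγ n) (hγc n))
      (ENNReal.mul_lt_top hC.lt_top (hγL n).2)⟩
  have hcau : ∀ N n m : ℕ, N ≤ n → N ≤ m →
      eLpNorm (dz (CT (γ n)) - dz (CT (γ m))) (ENNReal.ofReal p) nub <
        (C * 2 + 1) * (1/2 : ℝ≥0∞) ^ N := by
    intro N n m hn hm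
    have e : dz (CT (γ n)) - dz (CT (γ m)) = dz (CT (γ n - γ m)) := by
      have e2 : CT (γ n - γ m) = fun z => CT (γ n) z - CT (γ m) z := by
        ext z
        exact CT_sub (hγ n).continuous (hγc n) (hγ m).continuous (hγc m) z
      ext z
      rw [e2, dz_sub ((contDiff_CT (hγ n) (hγc n)).differentiable (by simp) z)
        ((contDiff_CT (hγ m) (hγc m)).differentiable (by simp) z)]
      rfl
    rw [e]
    have hle : eLpNorm (γ n - γ m) (ENNReal.ofReal p) nu ≤ 2 * (1/2 : ℝ≥0∞) ^ N := by
      have : γ n - γ m = (γ n - g) - (γ m - g) := by simp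
      rw [this]
      refine (eLpNorm_sub_le ((hγL n).1.sub hg.1) ((hγL m).1.sub hg.1) hp1).trans ?_
      rw [two_mul]
      refine add_le_add ((hγn n).trans ?_) ((hγn m).trans ?_)
      · exact pow_le_pow_of_le_one bot_le (by simp) hn
      · exact pow_le_pow_of_le_one bot_le (by simp) hm
    have hpos : (1/2 : ℝ≥0∞) ^ N ≠ 0 := by simp
    have hfin : (1/2 : ℝ≥0∞) ^ N ≠ ⊤ := by finiteness
    calc _ ≤ C * (2 * (1/2 : ℝ≥0∞) ^ N) :=
          (hdz _ ((hγ n).sub (hγ m)) ((hγc n).sub (hγc m))).trans (mul_le_mul_right hle C)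
      _ = C * 2 * (1/2 : ℝ≥0∞) ^ N := by ring
      _ < C * 2 * (1/2 : ℝ≥0∞) ^ N + (1/2 : ℝ≥0∞) ^ N :=
          ENNReal.lt_add_right (by finiteness) hpos
      _ = _ := by ring
  have hsum : ∑' N : ℕ, (C * 2 + 1) * (1/2 : ℝ≥0∞) ^ N ≠ ⊤ := by
    rw [ENNReal.tsum_mul_left, ENNReal.tsum_geometric]
    refine ENNReal.mul_ne_top (by finiteness) ?_
    simp
  obtain ⟨u0, hu0, hu0t⟩ := Lp.cauchy_complete_eLpNorm hp1 hU hsum hcau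
  set u : ℂ → ℂ := hu0.1.mk u0 with hu
  have hue : u0 =ᵐ[nub] u := hu0.1.ae_eq_mk
  have hum : Measurable u := hu0.1.stronglyMeasurable_mk.measurable
  have huL : MemLp u (ENNReal.ofReal p) nub := hu0.ae_eq hue
  have hut : Tendsto (fun n => eLpNorm (dz (CT (γ n)) - u) (ENNReal.ofReal p) nub) atTop (𝓝 0) := by
    refine hu0t.congr fun n => eLpNorm_congr_ae ?_
    filter_upwards [hue] with z hz
    simp [hz]
  set X := eLpNorm g (ENNReal.ofReal p) nu with hX
  have hunorm : eLpNorm u (ENNReal.ofReal p) nub ≤ C * X := by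
    have hl : Tendsto (fun n : ℕ => C * (X + (1/2 : ℝ≥0∞) ^ n) +
        eLpNorm (dz (CT (γ n)) - u) (ENNReal.ofReal p) nub) atTop (𝓝 (C * (X + 0) + 0)) :=
      (ENNReal.Tendsto.const_mul (hlim0.const_add X) (Or.inr hC)).add hut
    rw [add_zero, add_zero] at hl
    refine ge_of_tendsto' hl fun n => ?_
    have e : u = dz (CT (γ n)) - (dz (CT (γ n)) - u) := by simp
    conv_lhs => rw [e]
    refine (eLpNorm_sub_le (hU n).1 ((hU n).1.sub huL.1) hp1).trans ?_
    gcongr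
    refine (hdz _ (hγ n) (hγc n)).trans ?_
    gcongr
    have e : γ n = g + (γ n - g) := by simp
    conv_lhs => rw [e]
    refine (eLpNorm_add_le hg.1 ((hγL n).1.sub hg.1) hp1).trans ?_
    gcongr
    exact hγn n
  refine ⟨hcont, hb, u, hum, hunorm, fun φ hφ hφc hφs => ?_⟩
  -- passing to the limit in the weak identities
  set m : Measure ℂ := (volume : Measure ℂ).restrict (ball 0 1) with hm
  have hmn : m ≤ nub := vol_le_nub
  have hmu : m univ ≠ ⊤ := by
    rw [hm, Measure.restrict_apply_univ]; exact measure_ball_lt_top.ne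
  have hto : ∀ {a : ℕ → ℂ → ℂ} {b : ℂ → ℂ},
      Tendsto (fun n => eLpNorm (a n - b) (ENNReal.ofReal p) nub) atTop (𝓝 0) →
      Tendsto (fun n => eLpNorm (a n - b) (ENNReal.ofReal p) m) atTop (𝓝 0) := fun h =>
    tendsto_of_tendsto_of_tendsto_of_le_of_le tendsto_const_nhds h (fun _ => bot_le)
      fun n => eLpNorm_mono_measure _ hmn
  have hnn : nub ≤ nu := Measure.restrict_le_self
  have hφL : ∀ {ψ : ℂ → ℂ}, Continuous ψ → HasCompactSupport ψ →
      MemLp ψ (ENNReal.ofReal (p / (p - 1))) m := fun h hc =>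
    (h.memLp_of_hasCompactSupport hc).mono_measure Measure.restrict_le_self
  have hmb : ∀ᵐ z ∂m, z ∈ closedBall (0:ℂ) 1 :=
    (ae_restrict_mem measurableSet_ball).mono fun z hz => ball_subset_closedBall hz
  have hfm : AEStronglyMeasurable (CT g) m :=
    (hcont.mono ball_subset_closedBall).aestronglyMeasurable measurableSet_ball
  have hfL : MemLp (CT g) (ENNReal.ofReal p) m := by
    refine ⟨hfm, lt_of_le_of_lt (eLpNorm_le_of_ae_enorm_bound (hmb.mono hb)) ?_⟩
    rw [smul_eq_mul]
    exact ENNReal.mul_lt_top (ENNReal.mul_lt_top hK.lt_top hg.2)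
      (ENNReal.rpow_lt_top_of_nonneg (by positivity) hmu)
  have hft : Tendsto (fun n => eLpNorm (CT (γ n) - CT g) (ENNReal.ofReal p) m) atTop (𝓝 0) := by
    have h1 := ENNReal.Tendsto.mul_const (b := m univ ^ (ENNReal.ofReal p).toReal⁻¹) hKlim
      (Or.inr (ENNReal.rpow_ne_top_of_nonneg (by positivity) hmu))
    rw [zero_mul] at h1
    refine tendsto_of_tendsto_of_tendsto_of_le_of_le tendsto_const_nhds h1 (fun _ => bot_le) fun n => ?_
    exact eLpNorm_le_of_ae_enorm_bound (hmb.mono (hdiff n))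
  have hfnL : ∀ n, MemLp (CT (γ n)) (ENNReal.ofReal p) m := by
    intro n
    have h1 : eLpNorm (CT (γ n) - CT g) (ENNReal.ofReal p) m < ⊤ := by
      refine lt_of_le_of_lt (eLpNorm_le_of_ae_enorm_bound (hmb.mono (hdiff n))) ?_
      rw [smul_eq_mul]
      exact ENNReal.mul_lt_top (ENNReal.mul_lt_top hK.lt_top (by finiteness))
        (ENNReal.rpow_lt_top_of_nonneg (by positivity) hmu)
    have h2 : MemLp (CT (γ n) - CT g) (ENNReal.ofReal p) m :=
      ⟨(contDiff_CT (hγ n) (hγc n)).continuous.aestronglyMeasurable.sub hfm, h1⟩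
    have := h2.add hfL
    simpa using this
  have hφ1 : ContDiff ℝ 1 φ := hφ.of_le (mod_cast le_top)
  have t1 := tendsto_pair hp hfnL hfL (hφL (continuous_dz hφ1) (hcs_dz hφc)) hft
  have t2 := tendsto_pair hp hfnL hfL (hφL (continuous_db hφ1) (hcs_db hφc)) hft
  have t3 := tendsto_pair hp (fun n => (hU n).mono_measure hmn) (huL.mono_measure hmn)
    (hφL hφ.continuous hφc) (hto hut)
  have t4 := tendsto_pair hp (fun n => (hγL n).mono_measure (hmn.trans hnn))
    (hg.mono_measure (hmn.trans hnn)) (hφL hφ.continuous hφc)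
    (tendsto_of_tendsto_of_tendsto_of_le_of_le tendsto_const_nhds hγg (fun _ => bot_le)
      fun n => eLpNorm_mono_measure _ (hmn.trans hnn))
  constructor
  · refine tendsto_nhds_unique t1 (t3.neg.congr fun n => ?_)
    exact (smooth_pair (hγ n) (hγc n) hφ hφc hφs).1.symm
  · refine tendsto_nhds_unique t2 (t4.neg.congr fun n => ?_)
    exact (smooth_pair (hγ n) (hγc n) hφ hφc hφs).2.symm

end CTW

/-- Weighted regularity of the Cauchy transform: for `p > 2` there is `C > 0` such that for
every measurable `g` with finite weighted norm `‖g‖_{Ľᵖ(𝔻)}`, the function `f = Tg` is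
continuous on `𝔻̄`, has weak Wirtinger derivatives `u = ∂f`, `v = ∂̄f` on `𝔻` with `v = g`
a.e., and `f` together with its full weak gradient lies in weighted `Lᵖ` with
`‖(f, ∂f)‖_{Ľᵖ} ≤ C ‖g‖_{Ľᵖ}`. -/
theorem cauchy_transform_weighted_regularity (p : ℝ) (hp : 2 < p) :
    ∃ C : ℝ, 0 < C ∧
      ∀ g : ℂ → ℂ, Measurable g →
        (∫⁻ z in ball (0:ℂ) 1, (‖g z‖₊ : ℝ≥0∞) ^ p * (‖z‖₊ : ℝ≥0∞)⁻¹) ≠ ⊤ →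
        -- f = Tg is continuous on the closed disk
        ContinuousOn (fun z : ℂ => -(Real.pi : ℂ)⁻¹ * ∫ w in ball (0:ℂ) 1, g w / (w - z))
          (closedBall (0:ℂ) 1) ∧
        ∃ u v : ℂ → ℂ, Measurable u ∧ Measurable v ∧
          -- u and v are the weak Wirtinger derivatives of f on 𝔻
          (∀ φ : ℂ → ℂ, ContDiff ℝ (⊤ : ℕ∞) φ → HasCompactSupport φ →
            tsupport φ ⊆ ball (0:ℂ) 1 →
            ((∫ z in ball (0:ℂ) 1,
                (-(Real.pi : ℂ)⁻¹ * ∫ w in ball (0:ℂ) 1, g w / (w - z)) *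
                  ((1 / 2 : ℂ) * (fderiv ℝ φ z 1 - Complex.I * fderiv ℝ φ z Complex.I))) =
              -∫ z in ball (0:ℂ) 1, u z * φ z) ∧
            ((∫ z in ball (0:ℂ) 1,
                (-(Real.pi : ℂ)⁻¹ * ∫ w in ball (0:ℂ) 1, g w / (w - z)) *
                  ((1 / 2 : ℂ) * (fderiv ℝ φ z 1 + Complex.I * fderiv ℝ φ z Complex.I))) =
              -∫ z in ball (0:ℂ) 1, v z * φ z)) ∧
          -- ∂̄f = g almost everywhere
          (∀ᵐ z ∂(volume.restrict (ball (0:ℂ) 1)), v z = g z) ∧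
          -- weighted Lᵖ estimate on f and ∂f
          (∫⁻ z in ball (0:ℂ) 1,
              ((‖-(Real.pi : ℂ)⁻¹ * ∫ w in ball (0:ℂ) 1, g w / (w - z)‖₊ : ℝ≥0∞) ^ p +
                  (‖u z‖₊ : ℝ≥0∞) ^ p) * (‖z‖₊ : ℝ≥0∞)⁻¹) ≤
            ENNReal.ofReal C ^ p *
              ∫⁻ z in ball (0:ℂ) 1, (‖g z‖₊ : ℝ≥0∞) ^ p * (‖z‖₊ : ℝ≥0∞)⁻¹ := by
  have hp0 : 0 < p := by linarith
  obtain ⟨K, C, hK, hC, H⟩ := CTW.main_aux hp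
  set T : ℝ≥0∞ := K ^ p * CTW.nub univ + C ^ p with hT
  have hTt : T ≠ ⊤ := ENNReal.add_ne_top.2 ⟨ENNReal.mul_ne_top
    (ENNReal.rpow_ne_top_of_nonneg hp0.le hK) CTW.nub_univ, ENNReal.rpow_ne_top_of_nonneg hp0.le hC⟩
  have hT1 : T ^ (1/p) ≠ ⊤ := ENNReal.rpow_ne_top_of_nonneg (by positivity) hTt
  refine ⟨(T ^ (1/p)).toReal + 1, by positivity, fun g hg hfin => ?_⟩
  have hTC : T ≤ ENNReal.ofReal ((T ^ (1/p)).toReal + 1) ^ p := by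
    calc T = (T ^ (1/p)) ^ p := by
          rw [← ENNReal.rpow_mul, one_div_mul_cancel hp0.ne', ENNReal.rpow_one]
      _ ≤ _ := by
          gcongr
          calc T ^ (1/p) = ENNReal.ofReal (T ^ (1/p)).toReal := (ENNReal.ofReal_toReal hT1).symm
            _ ≤ _ := ENNReal.ofReal_le_ofReal (by linarith)
  set G : ℂ → ℂ := (ball (0:ℂ) 1).indicator g with hG
  have hGm : Measurable G := hg.indicator measurableSet_ball
  have hG0 : ∀ z, z ∉ ball (0:ℂ) 1 → G z = 0 := fun z hz => indicator_of_notMem hz g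
  have hGX : eLpNorm G (ENNReal.ofReal p) CTW.nu ^ p =
      ∫⁻ z in ball (0:ℂ) 1, (‖g z‖₊ : ℝ≥0∞) ^ p * (‖z‖₊ : ℝ≥0∞)⁻¹ := by
    rw [CTW.eLpNorm_rpow hp0, CTW.lintegral_nu (by fun_prop),
      ← lintegral_indicator measurableSet_ball]
    congr 1; ext z
    by_cases hz : z ∈ ball (0:ℂ) 1
    · simp only [hG, hz, indicator_of_mem]; rfl
    · simp [hG, hz, hp0]
  have hGL : MemLp G (ENNReal.ofReal p) CTW.nu := by
    refine ⟨hGm.aestronglyMeasurable, lt_top_iff_ne_top.2 fun h => hfin ?_⟩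
    rw [← hGX, h, ENNReal.top_rpow_of_pos hp0]
  obtain ⟨h1, h2, u, hum, hub, hweak⟩ := H G hGm hG0 hGL
  simp only [CTW.statement_eq_CT]
  refine ⟨h1, u, g, hum, hg, fun φ hφ hφc hφs => ?_, Filter.Eventually.of_forall fun _ => rfl, ?_⟩
  · obtain ⟨w1, w2⟩ := hweak φ hφ hφc hφs
    refine ⟨w1, w2.trans ?_⟩
    congr 1
    refine setIntegral_congr_fun measurableSet_ball fun z hz => ?_
    simp only [hG, hz, indicator_of_mem]
  · rw [← hGX]
    set X := eLpNorm G (ENNReal.ofReal p) CTW.nu with hX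
    calc _ ≤ ∫⁻ z in ball (0:ℂ) 1, ((K * X) ^ p + ‖u z‖ₑ ^ p) * ‖z‖ₑ⁻¹ := by
          refine setLIntegral_mono' measurableSet_ball fun z hz => ?_
          refine mul_le_mul_left (add_le_add_left (ENNReal.rpow_le_rpow
            (h2 z (ball_subset_closedBall hz)) hp0.le) _) _
      _ = ∫⁻ z, ((K * X) ^ p + ‖u z‖ₑ ^ p) ∂CTW.nub := (CTW.lintegral_nub (by fun_prop)).symm
      _ = (K * X) ^ p * CTW.nub univ + eLpNorm u (ENNReal.ofReal p) CTW.nub ^ p := by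
          rw [lintegral_add_left measurable_const, lintegral_const, CTW.eLpNorm_rpow hp0]
      _ ≤ (K * X) ^ p * CTW.nub univ + (C * X) ^ p := by gcongr
      _ = T * X ^ p := by
          rw [ENNReal.mul_rpow_of_nonneg _ _ hp0.le, ENNReal.mul_rpow_of_nonneg _ _ hp0.le, hT]
          ring
      _ ≤ _ := by gcongr
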